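/- There exist absolute constants c, C > 0 such that, with probability 1 − o(1) for a random pair (g,h) ∈ Sym(n) × Sym(n), the following holds: letting G = ⟨g,h⟩, S = {g, h, g⁻¹, h⁻¹}, and μ the lazy random-walk measure on G given by μ(e) += 1/2 and μ(s) += 1/(2|S|) for each s ∈ S (i.e., μ = (1/2)1_{{e}} + (1/(2|S|))1_S), for every integer k ≥ C·n³·(log n)^c and every x ∈ G one has |μ^{*k}(x) − 1/|G|| ≤ 1/(2|G|), where μ^{*k} denotes the k-fold convolution of μ. In other words, the strong mixing time of Γ(G,S) is O(n³·(log n)^c). -/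

import Mathlib

open Equiv
open scoped Classical

/-- Convolution of two real-valued functions on a finite group:
`(μ * ν)(x) = ∑_y μ(y)·ν(y⁻¹x)`. -/
noncomputable def conv {G : Type*} [Group G] [Fintype G] (μ ν : G → ℝ) : G → ℝ :=
  fun x => ∑ y : G, μ y * ν (y⁻¹ * x)

/-- `k`-fold convolution power of `μ` (with `μ^{*0}` the point mass at the identity). -/
noncomputable def convPow {G : Type*} [Group G] [Fintype G] (μ : G → ℝ) : ℕ → G → ℝ
  | 0 => fun x => if x = 1 then 1 else 0
  | k + 1 => conv μ (convPow μ k)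

/-- The lazy random-walk measure `μ = (1/2)·1_{{e}} + (1/(2|S|))·1_S` associated to
`S = {g, h, g⁻¹, h⁻¹}`. -/
noncomputable def lazyWalk {n : ℕ} (g h : Perm (Fin n)) : Perm (Fin n) → ℝ :=
  fun x =>
    (if x = 1 then (1 : ℝ) / 2 else 0) +
      (if x ∈ ({g, h, g⁻¹, h⁻¹} : Finset (Perm (Fin n))) then
        1 / (2 * ((({g, h, g⁻¹, h⁻¹} : Finset (Perm (Fin n)))).card : ℝ))
      else 0)

section JointEigenbasis

variable {V : Type*} [NormedAddCommGroup V] [InnerProductSpace ℝ V] [FiniteDimensional ℝ V]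

/-- A commuting family of symmetric operators has an orthonormal basis of joint eigenvectors. -/
theorem exists_joint_eigenbasis {κ : Type*} (T : κ → Module.End ℝ V)
    (hs : ∀ j, (T j).IsSymmetric) (hc : Pairwise fun i j => Commute (T i) (T j)) :
    ∃ (b : OrthonormalBasis (Fin (Module.finrank ℝ V)) ℝ V)
      (c : Fin (Module.finrank ℝ V) → κ → ℝ), ∀ i j, T j (b i) = c i j • b i := by
  have h1 := LinearMap.IsSymmetric.directSum_isInternal_of_pairwise_commute hs hc
  have h2 := LinearMap.IsSymmetric.orthogonalFamily_iInf_eigenspaces hs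
  have h3 := DirectSum.isInternal_ne_bot_iff.mpr h1
  have h4 : Finite {α : κ → ℝ // (⨅ j, Module.End.eigenspace (T j) (α j)) ≠ ⊥} :=
    WellFoundedGT.finite_ne_bot_of_iSupIndep h1.submodule_iSupIndep
  have := Fintype.ofFinite {α : κ → ℝ // (⨅ j, Module.End.eigenspace (T j) (α j)) ≠ ⊥}
  have h5 := h2.comp (Subtype.val_injective (p := fun α : κ → ℝ =>
    (⨅ j, Module.End.eigenspace (T j) (α j)) ≠ ⊥))
  refine ⟨h3.subordinateOrthonormalBasis rfl h5,
    fun i => (h3.subordinateOrthonormalBasisIndex rfl i h5).1, fun i j => ?_⟩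
  have h6 := h3.subordinateOrthonormalBasis_subordinate rfl i h5
  rw [Submodule.mem_iInf] at h6
  exact Module.End.mem_eigenspace_iff.mp (h6 j)

end JointEigenbasis

section Translations

theorem inner_eq_sum {ι : Type*} [Fintype ι] (f g : EuclideanSpace ℝ ι) :
    inner ℝ f g = ∑ x, f x * g x := by
  simp [PiLp.inner_apply, mul_comm]

variable {G : Type*} [Group G]

/-- Left translation on `ℝ^G`. -/
noncomputable def leftTrans : G →* Module.End ℝ (EuclideanSpace ℝ G) where
  toFun y :=
    { toFun := fun f => WithLp.toLp 2 fun x => f (y⁻¹ * x)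
      map_add' := fun _ _ => rfl
      map_smul' := fun _ _ => rfl }
  map_one' := by ext f x; simp
  map_mul' y z := by
    ext f x
    change f ((y * z)⁻¹ * x) = f (z⁻¹ * (y⁻¹ * x))
    rw [mul_inv_rev, mul_assoc]

theorem leftTrans_apply (y : G) (f : EuclideanSpace ℝ G) (x : G) :
    leftTrans y f x = f (y⁻¹ * x) := rfl

/-- The vector of a real character. -/
noncomputable def charVec (χ : G →* ℤˣ) : EuclideanSpace ℝ G :=
  WithLp.toLp 2 fun x => ((χ x : ℤ) : ℝ)

theorem charVec_apply (χ : G →* ℤˣ) (x : G) : charVec χ x = ((χ x : ℤ) : ℝ) := rfl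

theorem charVec_mul (χ : G →* ℤˣ) (x y : G) :
    charVec χ (x * y) = charVec χ x * charVec χ y := by
  simp [charVec_apply]

theorem charVec_sq (χ : G →* ℤˣ) (x : G) : charVec χ x * charVec χ x = 1 := by
  rw [charVec_apply]
  rcases Int.units_eq_one_or (χ x) with h | h <;> simp [h]

theorem charVec_inv (χ : G →* ℤˣ) (x : G) : charVec χ x⁻¹ = charVec χ x := by
  rw [charVec_apply, charVec_apply, map_inv, Int.units_inv_eq_self]

variable [Fintype G]

theorem inner_leftTrans (y : G) (f g : EuclideanSpace ℝ G) :
    inner ℝ (leftTrans y f) g = inner ℝ f (leftTrans y⁻¹ g) := by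
  rw [inner_eq_sum, inner_eq_sum, ← Equiv.sum_comp (Equiv.mulLeft y)]
  simp [leftTrans_apply]

theorem norm_leftTrans (y : G) (f : EuclideanSpace ℝ G) : ‖leftTrans y f‖ = ‖f‖ := by
  rw [← sq_eq_sq₀ (norm_nonneg _) (norm_nonneg _), ← real_inner_self_eq_norm_sq,
    ← real_inner_self_eq_norm_sq, inner_leftTrans, ← Module.End.mul_apply, ← map_mul]
  simp

theorem trace_leftTrans (y : G) :
    LinearMap.trace ℝ (EuclideanSpace ℝ G) (leftTrans y) =
      if y = 1 then (Fintype.card G : ℝ) else 0 := by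
  rw [LinearMap.trace_eq_sum_inner _ (EuclideanSpace.basisFun G ℝ)]
  have h (x : G) : inner ℝ (EuclideanSpace.basisFun G ℝ x)
      (leftTrans y (EuclideanSpace.basisFun G ℝ x)) = if y = 1 then (1 : ℝ) else 0 := by
    rw [EuclideanSpace.basisFun_apply, EuclideanSpace.inner_single_left, leftTrans_apply]
    simp
  simp_rw [h]
  split_ifs <;> simp

/-- Two times the Dirichlet form of a translation. -/
theorem two_mul_inner_sub_leftTrans (y : G) (f : EuclideanSpace ℝ G) :
    2 * inner ℝ f (f - leftTrans y f) = ‖f - leftTrans y f‖ ^ 2 := by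
  rw [norm_sub_sq_real, norm_leftTrans, inner_sub_right, real_inner_self_eq_norm_sq]
  ring

/-- The operator `f ↦ ∑ μ(y) f(y⁻¹ ·)`. -/
noncomputable def convOp (μ : G → ℝ) : Module.End ℝ (EuclideanSpace ℝ G) :=
  ∑ y, μ y • leftTrans y

theorem convOp_apply (μ : G → ℝ) (f : EuclideanSpace ℝ G) (x : G) :
    convOp μ f x = conv μ f x := by
  simp [convOp, conv, leftTrans_apply]

theorem convOp_pow_single (μ : G → ℝ) (k : ℕ) (x : G) :
    ((convOp μ) ^ k) (EuclideanSpace.single 1 (1 : ℝ)) x = convPow μ k x := by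
  induction k generalizing x with
  | zero => simp [convPow]
  | succ k ih =>
    rw [pow_succ', Module.End.mul_apply, convOp_apply]
    simp only [convPow, conv, ih]

theorem convOp_isSymmetric (μ : G → ℝ) (h : ∀ y, μ y⁻¹ = μ y) : (convOp μ).IsSymmetric := by
  intro f g
  simp only [convOp, LinearMap.sum_apply, LinearMap.smul_apply, sum_inner, inner_sum,
    real_inner_smul_left, real_inner_smul_right, inner_leftTrans]
  rw [← Equiv.sum_comp (Equiv.inv G)]
  simp [h]

theorem convOp_charVec (χ : G →* ℤˣ) (f : EuclideanSpace ℝ G) :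
    convOp (charVec χ) f = inner ℝ (charVec χ) f • charVec χ := by
  ext x
  rw [convOp_apply, conv, PiLp.smul_apply, inner_eq_sum, smul_eq_mul, Finset.sum_mul,
    ← Equiv.sum_comp ((Equiv.inv G).trans (Equiv.mulLeft x))]
  refine Finset.sum_congr rfl fun y _ => ?_
  simp [charVec_mul, charVec_inv]
  ring

theorem leftTrans_charVec (χ : G →* ℤˣ) (y : G) :
    leftTrans y (charVec χ) = charVec χ y • charVec χ := by
  ext x
  simp [leftTrans_apply, charVec_mul, charVec_inv]

theorem inner_charVec_self (χ : G →* ℤˣ) :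
    inner ℝ (charVec χ) (charVec χ) = (Fintype.card G : ℝ) := by
  rw [inner_eq_sum]
  simp [charVec_sq]

theorem inner_charVec_of_ne {χ ψ : G →* ℤˣ} (h : χ ≠ ψ) :
    inner ℝ (charVec χ) (charVec ψ) = (0 : ℝ) := by
  obtain ⟨g, hg⟩ := DFunLike.ne_iff.mp h
  have h1 : charVec χ g * charVec ψ g = -1 := by
    rw [charVec_apply, charVec_apply]
    rcases Int.units_eq_one_or (χ g) with h1 | h1 <;>
      rcases Int.units_eq_one_or (ψ g) with h2 | h2 <;> simp_all
  have h2 : inner ℝ (charVec χ) (charVec ψ) = -inner ℝ (charVec χ) (charVec ψ) := by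
    conv_lhs => rw [inner_eq_sum, ← Equiv.sum_comp (Equiv.mulLeft g)]
    rw [inner_eq_sum, ← Finset.sum_neg_distrib]
    refine Finset.sum_congr rfl fun y _ => ?_
    simp only [Equiv.coe_mulLeft, charVec_mul]
    linear_combination (charVec χ y * charVec ψ y) * h1
  linarith

/-- A unit eigenvector of the projection on a character is parallel or orthogonal to it. -/
theorem apply_mul_apply_of_charVec_eigen {χ : G →* ℤˣ} {u : EuclideanSpace ℝ G} (hu : ‖u‖ = 1)
    {γ : ℝ} (h : inner ℝ (charVec χ) u • charVec χ = γ • u)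
    (h0 : inner ℝ (charVec χ) u ≠ (0 : ℝ)) :
    ∃ a : ℝ, u = a • charVec χ ∧ a ^ 2 * (Fintype.card G : ℝ) = 1 := by
  have hγ : γ ≠ 0 := by
    rintro rfl
    have h1 := congrArg (fun v => v (1 : G)) h
    simp only [PiLp.smul_apply, smul_eq_mul, zero_smul, PiLp.zero_apply] at h1
    simp [charVec_apply] at h1
    exact h0 h1
  refine ⟨γ⁻¹ * inner ℝ (charVec χ) u, ?_, ?_⟩
  · rw [mul_smul, h, smul_smul, inv_mul_cancel₀ hγ, one_smul]
  · have h2 : u = (γ⁻¹ * inner ℝ (charVec χ) u) • charVec χ := by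
      rw [mul_smul, h, smul_smul, inv_mul_cancel₀ hγ, one_smul]
    have h3 : inner ℝ u u = (1 : ℝ) := by rw [real_inner_self_eq_norm_sq, hu]; norm_num
    set a := γ⁻¹ * inner ℝ (charVec χ) u
    rw [h2, real_inner_smul_left, real_inner_smul_right, inner_charVec_self] at h3
    linarith

end Translations

section SpectralBound

variable {G : Type*} [Group G] [Fintype G]

theorem convOp_mul (μ ν : G → ℝ) : convOp μ * convOp ν = convOp (conv μ ν) := by
  have h (y : G) : ∑ z, (μ y * ν z) • leftTrans (y * z) =
      ∑ x, (μ y * ν (y⁻¹ * x)) • leftTrans x := by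
    rw [← Equiv.sum_comp (Equiv.mulLeft y) fun x => (μ y * ν (y⁻¹ * x)) • leftTrans x]
    simp
  simp only [convOp, conv, Finset.sum_mul_sum, smul_mul_smul_comm, ← map_mul, h, Finset.sum_smul]
  exact Finset.sum_comm

theorem convOp_pow (μ : G → ℝ) (k : ℕ) : convOp μ ^ k = convOp (convPow μ k) := by
  induction k with
  | zero =>
    simp [convOp, convPow]
  | succ k ih => rw [pow_succ', ih, convOp_mul]; rfl

theorem convOp_single_self (μ : G → ℝ) (x : G) :
    convOp μ (EuclideanSpace.single x (1 : ℝ)) x = μ 1 := by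
  rw [convOp_apply, conv, Finset.sum_eq_single 1] <;> simp +contextual

theorem convOp_of_charVec (μ : G → ℝ) (χ : G →* ℤˣ) :
    convOp μ (charVec χ) = (∑ y, μ y * charVec χ y) • charVec χ := by
  simp only [convOp, LinearMap.sum_apply, LinearMap.smul_apply, leftTrans_charVec, smul_smul,
    Finset.sum_smul]

theorem commute_convOp_charVec (μ : G → ℝ) (h : ∀ y, μ y⁻¹ = μ y) (χ : G →* ℤˣ) :
    Commute (convOp μ) (convOp (charVec χ)) := by
  refine LinearMap.ext fun f => ?_
  rw [Module.End.mul_apply, Module.End.mul_apply, convOp_charVec, convOp_charVec, map_smul,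
    ← convOp_isSymmetric μ h, convOp_of_charVec, real_inner_smul_left, smul_smul, mul_comm]

theorem inner_sub_convOp {μ : G → ℝ} (h1 : ∑ y, μ y = 1) (f : EuclideanSpace ℝ G) :
    inner ℝ f (f - convOp μ f) = ∑ y, μ y * (‖f - leftTrans y f‖ ^ 2 / 2) := by
  have h : f - convOp μ f = ∑ y, μ y • (f - leftTrans y f) := by
    simp only [smul_sub, Finset.sum_sub_distrib, ← Finset.sum_smul, h1, one_smul, convOp,
      LinearMap.sum_apply, LinearMap.smul_apply]
  rw [h, inner_sum]
  refine Finset.sum_congr rfl fun y _ => ?_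
  rw [real_inner_smul_right, ← two_mul_inner_sub_leftTrans]
  ring

theorem inner_convOp_nonneg {μ : G → ℝ} (h0 : ∀ y, 0 ≤ μ y) (h1 : ∑ y, μ y = 1)
    (h2 : 1 / 2 ≤ μ 1) (f : EuclideanSpace ℝ G) : 0 ≤ inner ℝ f (convOp μ f) := by
  have h3 : inner ℝ f (convOp μ f) = ∑ y, μ y * inner ℝ f (leftTrans y f) := by
    simp [convOp, inner_sum, real_inner_smul_right]
  have h4 (y : G) : -‖f‖ ^ 2 ≤ inner ℝ f (leftTrans y f) := by
    have := abs_le.mp (abs_real_inner_le_norm f (leftTrans y f))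
    rw [norm_leftTrans] at this
    nlinarith
  rw [h3, ← Finset.add_sum_erase _ _ (Finset.mem_univ (1 : G)), map_one, Module.End.one_apply,
    real_inner_self_eq_norm_sq]
  rw [← Finset.add_sum_erase _ _ (Finset.mem_univ (1 : G))] at h1
  have h5 : ∑ y ∈ Finset.univ.erase (1 : G), μ y * (-‖f‖ ^ 2) ≤
      ∑ y ∈ Finset.univ.erase (1 : G), μ y * inner ℝ f (leftTrans y f) :=
    Finset.sum_le_sum fun y _ => mul_le_mul_of_nonneg_left (h4 y) (h0 y)
  rw [← Finset.sum_mul] at h5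
  nlinarith [sq_nonneg ‖f‖]

theorem convPow_eq_sum {d : ℕ} (μ : G → ℝ) (u : OrthonormalBasis (Fin d) ℝ (EuclideanSpace ℝ G))
    (l : Fin d → ℝ) (hl : ∀ i, convOp μ (u i) = l i • u i) (k : ℕ) (x y : G) :
    convOp (convPow μ k) (EuclideanSpace.single y (1 : ℝ)) x = ∑ i, l i ^ k * (u i x * u i y) := by
  have h1 (i : Fin d) : (convOp μ ^ k) (u i) = l i ^ k • u i := by
    induction k with
    | zero => simp
    | succ k ih => rw [pow_succ, Module.End.mul_apply, hl, map_smul, ih, smul_smul, pow_succ']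
  conv_lhs => rw [← u.sum_repr' (EuclideanSpace.single y (1 : ℝ)), ← convOp_pow]
  simp only [map_sum, map_smul, h1, EuclideanSpace.inner_single_right]
  rw [WithLp.ofLp_sum, Finset.sum_apply]
  refine Finset.sum_congr rfl fun i _ => ?_
  simp
  ring

/-- Comparison of the return probabilities of a walk with the spectral profile of a quadratic
form dominated by its Dirichlet form; the characters `χ b` are treated separately. -/
theorem abs_convPow_sub_le {d : ℕ} {μ : G → ℝ} (h0 : ∀ y, 0 ≤ μ y) (h1 : ∑ y, μ y = 1)
    (h2 : 1 / 2 ≤ μ 1) (hinv : ∀ y, μ y⁻¹ = μ y) {χ : Bool → G →* ℤˣ}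
    (hχ : Function.Injective χ) (e : OrthonormalBasis (Fin d) ℝ (EuclideanSpace ℝ G))
    (good : Fin d → Prop) (he : ∀ i, ¬ good i → ∃ (b : Bool) (a : ℝ), e i = a • charVec (χ b))
    {B : ℝ} (hB : 0 < B) (l : Fin d → ℝ) (hlB : ∀ i, l i ≤ B)
    (hform : ∀ f, ∑ i, l i * inner ℝ (e i) f ^ 2 ≤ B * inner ℝ f (f - convOp μ f))
    {k : ℕ} {η : ℝ}
    (hη : ∑ i, (if good i then (1 - l i / B) ^ k else 0) ≤ η) (x : G) (hk : k ≠ 0) :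
    |convPow μ k x - ∑ b, (∑ y, μ y * charVec (χ b) y) ^ k * charVec (χ b) x / Fintype.card G| ≤
      η / Fintype.card G := by
  have hG : (0 : ℝ) < Fintype.card G := by exact_mod_cast Fintype.card_pos
  let T : Option Bool → Module.End ℝ (EuclideanSpace ℝ G) := fun o =>
    o.elim (convOp μ) fun b => convOp (charVec (χ b))
  have hT1 : ∀ j, (T j).IsSymmetric := by
    rintro (_ | b)
    · exact convOp_isSymmetric μ hinv
    · exact convOp_isSymmetric _ (charVec_inv _)
  have hT2 : Pairwise fun i j => Commute (T i) (T j) := by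
    rintro (_ | b) (_ | c) _
    · exact Commute.refl _
    · exact commute_convOp_charVec μ hinv _
    · exact (commute_convOp_charVec μ hinv _).symm
    · exact commute_convOp_charVec _ (charVec_inv _) _
  obtain ⟨u, c, hu⟩ := exists_joint_eigenbasis T hT1 hT2
  set L := fun i => c i none with hL
  have huP (i) : convOp μ (u i) = L i • u i := hu i none
  have hn (i) : ‖u i‖ = 1 := u.orthonormal.1 i
  have huL (i) : L i = inner ℝ (u i) (convOp μ (u i)) := by
    rw [huP, real_inner_smul_right, real_inner_self_eq_norm_sq, hn]; ring
  have hL0 (i) : 0 ≤ L i := by rw [huL]; exact inner_convOp_nonneg h0 h1 h2 _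
  set N : ℝ := (Fintype.card G : ℝ)
  -- the part of the spectrum parallel to a character
  have hpar (i) (b : Bool) (hb : inner ℝ (charVec (χ b)) (u i) ≠ (0 : ℝ)) :
      ∃ a : ℝ, u i = a • charVec (χ b) ∧ a ^ 2 * N = 1 := by
    refine apply_mul_apply_of_charVec_eigen (hn i) (γ := c i (some b)) ?_ hb
    rw [← convOp_charVec]; exact hu i (some b)
  set Gd : Fin _ → Prop := fun i => ∀ b, inner ℝ (charVec (χ b)) (u i) = (0 : ℝ)
  have hterm (i) (x y : G) : u i x * u i y = (if Gd i then u i x * u i y else 0) +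
      ∑ b, charVec (χ b) x * charVec (χ b) y * inner ℝ (charVec (χ b)) (u i) ^ 2 / N ^ 2 := by
    by_cases hg : Gd i
    · simp [hg, hg _]
    · obtain ⟨b, hb⟩ := not_forall.mp hg
      obtain ⟨a, ha, haN⟩ := hpar i b hb
      have h3 : ∀ b', b' ≠ b → inner ℝ (charVec (χ b')) (u i) = (0 : ℝ) := fun b' hb' => by
        rw [ha, real_inner_smul_right, inner_charVec_of_ne (hχ.ne hb'), mul_zero]
      rw [if_neg hg, zero_add, Finset.sum_eq_single b (fun b' _ hb' => by simp [h3 b' hb'])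
        (by simp), ha, real_inner_smul_right, inner_charVec_self]
      simp only [PiLp.smul_apply, smul_eq_mul]
      change _ = _ * (a * N) ^ 2 / N ^ 2
      field_simp
  have hLχ (i) (b : Bool) : L i ^ k * inner ℝ (charVec (χ b)) (u i) ^ 2 =
      (∑ y, μ y * charVec (χ b) y) ^ k * inner ℝ (charVec (χ b)) (u i) ^ 2 := by
    by_cases hb : inner ℝ (charVec (χ b)) (u i) = (0 : ℝ)
    · simp [hb]
    · have h4 := convOp_isSymmetric μ hinv (charVec (χ b)) (u i)
      rw [huP, convOp_of_charVec, real_inner_smul_left, real_inner_smul_right] at h4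
      rw [mul_right_cancel₀ hb h4]
  have hsq (b : Bool) : ∑ i, inner ℝ (charVec (χ b)) (u i) ^ 2 = N := by
    have := u.sum_sq_inner_left (charVec (χ b))
    rw [this, ← real_inner_self_eq_norm_sq, inner_charVec_self]
  have hmain (x y : G) : convOp (convPow μ k) (EuclideanSpace.single y (1 : ℝ)) x =
      (∑ i, if Gd i then L i ^ k * (u i x * u i y) else 0) +
      ∑ b, (∑ z, μ z * charVec (χ b) z) ^ k * (charVec (χ b) x * charVec (χ b) y) / N := by
    rw [convPow_eq_sum μ u L huP]
    have h5 (i) : L i ^ k * (u i x * u i y) = (if Gd i then L i ^ k * (u i x * u i y) else 0) +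
        ∑ b, (∑ z, μ z * charVec (χ b) z) ^ k * (charVec (χ b) x * charVec (χ b) y) / N ^ 2 *
          inner ℝ (charVec (χ b)) (u i) ^ 2 := by
      conv_lhs => rw [hterm i x y, mul_add, Finset.mul_sum]
      congr 1
      · split_ifs <;> simp
      · refine Finset.sum_congr rfl fun b _ => ?_
        linear_combination (charVec (χ b) x * charVec (χ b) y / N ^ 2) * hLχ i b
    rw [Finset.sum_congr rfl fun i _ => h5 i, Finset.sum_add_distrib, Finset.sum_comm]
    congr 1
    refine Finset.sum_congr rfl fun b _ => ?_
    rw [← Finset.mul_sum, hsq]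
    field_simp
  -- the diagonal is constant
  set D : ℝ := (∑ i, if Gd i then L i ^ k else 0) with hD
  have hdiag (x : G) : (∑ i, if Gd i then L i ^ k * (u i x * u i x) else 0) = D / N := by
    have h6 (x : G) : (∑ i, if Gd i then L i ^ k * (u i x * u i x) else 0) =
        convPow μ k 1 - ∑ b, (∑ z, μ z * charVec (χ b) z) ^ k / N := by
      have := hmain x x
      rw [convOp_single_self] at this
      simp only [charVec_sq, mul_one] at this
      linarith
    have h7 : ∑ x, (∑ i, if Gd i then L i ^ k * (u i x * u i x) else 0) = D := by
      rw [Finset.sum_comm, hD]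
      refine Finset.sum_congr rfl fun i _ => ?_
      split_ifs
      · rw [← Finset.mul_sum, ← inner_eq_sum, real_inner_self_eq_norm_sq, hn]; ring
      · simp
    rw [← h7, Finset.sum_congr rfl fun y _ => h6 y, h6 x, Finset.sum_const, nsmul_eq_mul,
      Finset.card_univ]
    field_simp [N]
    rw [mul_comm]
  -- Jensen
  have hDη : D ≤ η := by
    refine le_trans ?_ hη
    set a : Fin d → ℝ := fun j => if good j then 1 - l j / B else 0
    have ha0 (j) : 0 ≤ a j := by
      simp only [a]; split_ifs
      · rw [sub_nonneg, div_le_one hB]; exact hlB j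
      · exact le_rfl
    have hw (i) : ∑ j, inner ℝ (e j) (u i) ^ 2 = (1 : ℝ) := by
      rw [e.sum_sq_inner_right, hn]; norm_num
    have hLa (i) (hi : Gd i) : L i ≤ ∑ j, inner ℝ (e j) (u i) ^ 2 * a j := by
      have h8 := hform (u i)
      rw [inner_sub_right, ← huL, real_inner_self_eq_norm_sq, hn] at h8
      have h9 : ∑ j, inner ℝ (e j) (u i) ^ 2 * a j =
          ∑ j, (inner ℝ (e j) (u i) ^ 2 - l j * inner ℝ (e j) (u i) ^ 2 / B) := by
        refine Finset.sum_congr rfl fun j _ => ?_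
        by_cases hj : good j
        · simp only [a, if_pos hj]; ring
        · obtain ⟨b, t, hbt⟩ := he j hj
          rw [hbt, real_inner_smul_left, hi b]; simp
      rw [h9, Finset.sum_sub_distrib, hw, ← Finset.sum_div]
      have : (∑ j, l j * inner ℝ (e j) (u i) ^ 2) / B ≤ 1 - L i := by
        rw [div_le_iff₀ hB]; linarith
      linarith
    have hLk (i) (hi : Gd i) : L i ^ k ≤ ∑ j, inner ℝ (e j) (u i) ^ 2 * a j ^ k :=
      (pow_le_pow_left₀ (hL0 i) (hLa i hi) k).trans
        (Real.pow_arith_mean_le_arith_mean_pow _ _ _ (fun j _ => sq_nonneg _) (hw i)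
          (fun j _ => ha0 j) k)
    calc D ≤ ∑ i, ∑ j, inner ℝ (e j) (u i) ^ 2 * a j ^ k := by
          refine Finset.sum_le_sum fun i _ => ?_
          split_ifs with hi
          · exact hLk i hi
          · exact Finset.sum_nonneg fun j _ => mul_nonneg (sq_nonneg _) (pow_nonneg (ha0 j) _)
      _ = ∑ j, a j ^ k := by
          rw [Finset.sum_comm]
          refine Finset.sum_congr rfl fun j _ => ?_
          rw [← Finset.sum_mul, u.sum_sq_inner_left, e.orthonormal.1 j]; ring
      _ = _ := by
          refine Finset.sum_congr rfl fun j _ => ?_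
          simp only [a]; split_ifs <;> simp [hk]
  have h10 := hmain x 1
  rw [← convOp_pow, convOp_pow_single] at h10
  have h11 (b) : charVec (χ b) (1 : G) = 1 := by simp [charVec_apply]
  simp only [h11, mul_one] at h10
  rw [h10, add_sub_cancel_right]
  refine le_trans ?_ (div_le_div_of_nonneg_right hDη hG.le)
  calc |∑ i, if Gd i then L i ^ k * (u i x * u i 1) else 0|
      ≤ ∑ i, |if Gd i then L i ^ k * (u i x * u i 1) else 0| := Finset.abs_sum_le_sum_abs _ _
    _ ≤ ∑ i, ((if Gd i then L i ^ k * (u i x * u i x) else 0) +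
          (if Gd i then L i ^ k * (u i 1 * u i 1) else 0)) / 2 := by
        refine Finset.sum_le_sum fun i _ => ?_
        split_ifs
        · rw [abs_mul, abs_of_nonneg (pow_nonneg (hL0 i) k)]
          have h12 : |u i x * u i 1| ≤ (u i x * u i x + u i 1 * u i 1) / 2 := by
            rw [abs_le]; constructor <;> nlinarith [sq_nonneg (u i x - u i 1),
              sq_nonneg (u i x + u i 1)]
          nlinarith [pow_nonneg (hL0 i) k]
        · simp
    _ = D / N := by rw [← Finset.sum_div, Finset.sum_add_distrib, hdiag, hdiag]; ring

end SpectralBound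

section JucysMurphy

variable {n : ℕ}

/-- The Jucys–Murphy element `∑_{j<m} (j m)` acting by left translation. -/
noncomputable def jucysMurphy (m : Fin n) : Module.End ℝ (EuclideanSpace ℝ (Perm (Fin n))) :=
  ∑ j ∈ Finset.Iio m, leftTrans (swap j m)

/-- The permutations of `Fin n` which fix every `i ≥ m`. -/
def fixFrom (n m : ℕ) : Subgroup (Perm (Fin n)) where
  carrier := {σ | ∀ i : Fin n, m ≤ i → σ i = i}
  mul_mem' := fun {a b} ha hb i hi => by rw [Perm.mul_apply, hb i hi, ha i hi]
  one_mem' := fun _ _ => rfl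
  inv_mem' := fun {a} ha i hi => by rw [Perm.inv_eq_iff_eq, ha i hi]

theorem mem_fixFrom {m : ℕ} {σ : Perm (Fin n)} :
    σ ∈ fixFrom n m ↔ ∀ i : Fin n, m ≤ i → σ i = i := Iff.rfl

/-- The span of the translations by elements of `fixFrom n m`. -/
noncomputable def fixSpan (n m : ℕ) : Submodule ℝ (Module.End ℝ (EuclideanSpace ℝ (Perm (Fin n)))) :=
  Submodule.span ℝ (leftTrans '' (fixFrom n m : Set (Perm (Fin n))))

theorem leftTrans_mem_fixSpan {m : ℕ} {σ : Perm (Fin n)} (h : σ ∈ fixFrom n m) :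
    leftTrans σ ∈ fixSpan n m := Submodule.subset_span ⟨σ, h, rfl⟩

theorem one_mem_fixSpan (m : ℕ) : 1 ∈ fixSpan n m := by
  rw [← map_one leftTrans]; exact leftTrans_mem_fixSpan (one_mem _)

theorem fixSpan_mono {l m : ℕ} (h : l ≤ m) : fixSpan n l ≤ fixSpan n m :=
  Submodule.span_mono (Set.image_mono fun _ hσ i hi => hσ i (h.trans hi))

theorem mul_mem_fixSpan {m : ℕ} {A B : Module.End ℝ (EuclideanSpace ℝ (Perm (Fin n)))}
    (hA : A ∈ fixSpan n m) (hB : B ∈ fixSpan n m) : A * B ∈ fixSpan n m := by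
  have h := Submodule.mul_mem_mul hA hB
  rw [fixSpan, Submodule.span_mul_span, ← Set.image_mul leftTrans, coe_mul_coe] at h
  exact h

theorem jucysMurphy_mem (m : Fin n) : jucysMurphy m ∈ fixSpan n (m + 1) := by
  refine Submodule.sum_mem _ fun j hj => leftTrans_mem_fixSpan fun i hi => ?_
  rw [Finset.mem_Iio, Fin.lt_def] at hj
  exact swap_apply_of_ne_of_ne (by rw [Ne, Fin.ext_iff]; omega) (by rw [Ne, Fin.ext_iff]; omega)

theorem lt_of_mem_fixFrom {m : Fin n} {σ : Perm (Fin n)} (hσ : σ ∈ fixFrom n m) {j : Fin n}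
    (hj : j < m) : σ j < m := by
  by_contra! h
  have := hσ _ (Fin.le_def.mp h)
  rw [σ.injective this] at h
  exact absurd hj (not_lt.mpr h)

theorem leftTrans_commute_jucysMurphy {m : Fin n} {σ : Perm (Fin n)} (hσ : σ ∈ fixFrom n m) :
    Commute (leftTrans σ) (jucysMurphy m) := by
  rw [Commute, SemiconjBy, jucysMurphy, Finset.mul_sum, Finset.sum_mul]
  refine Finset.sum_bij (fun j _ => σ j) (fun j hj => ?_) (fun _ _ _ _ h => σ.injective h)
    (fun j hj => ⟨σ⁻¹ j, ?_, by simp⟩) fun j hj => ?_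
  · rw [Finset.mem_Iio] at *; exact lt_of_mem_fixFrom hσ hj
  · rw [Finset.mem_Iio] at *; exact lt_of_mem_fixFrom (inv_mem hσ) hj
  · rw [← map_mul, ← map_mul, mul_swap_eq_swap_mul, hσ m le_rfl]

theorem commute_jucysMurphy_of_mem {m : Fin n} {A : Module.End ℝ (EuclideanSpace ℝ (Perm (Fin n)))}
    (hA : A ∈ fixSpan n m) : Commute A (jucysMurphy m) := by
  induction hA using Submodule.span_induction with
  | mem x hx => obtain ⟨σ, hσ, rfl⟩ := hx; exact leftTrans_commute_jucysMurphy hσ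
  | zero => exact Commute.zero_left _
  | add x y _ _ hx hy => exact hx.add_left hy
  | smul a x _ hx => exact hx.smul_left a

theorem jucysMurphy_commute (l m : Fin n) : Commute (jucysMurphy l) (jucysMurphy m) := by
  wlog h : l < m generalizing l m
  · rcases (not_lt.mp h).eq_or_lt with h | h
    · rw [h]
    · exact (this m l h).symm
  · exact commute_jucysMurphy_of_mem (fixSpan_mono (Fin.lt_def.mp h) (jucysMurphy_mem l))

theorem jucysMurphy_isSymmetric (m : Fin n) : (jucysMurphy m).IsSymmetric := by
  intro f g
  simp only [jucysMurphy, LinearMap.sum_apply, sum_inner, inner_sum, inner_leftTrans, swap_inv]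

theorem norm_jucysMurphy_le (m : Fin n) (f : EuclideanSpace ℝ (Perm (Fin n))) :
    ‖jucysMurphy m f‖ ≤ m * ‖f‖ := by
  rw [jucysMurphy, LinearMap.sum_apply]
  refine (norm_sum_le _ _).trans ?_
  simp [norm_leftTrans]

theorem trace_mul_jucysMurphy_sq {m : Fin n}
    {A : Module.End ℝ (EuclideanSpace ℝ (Perm (Fin n)))} (hA : A ∈ fixSpan n m) :
    LinearMap.trace ℝ _ (A * (jucysMurphy m * jucysMurphy m)) = m * LinearMap.trace ℝ _ A := by
  induction hA using Submodule.span_induction with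
  | mem x hx =>
    obtain ⟨σ, hσ, rfl⟩ := hx
    have h : ∀ i ∈ Finset.Iio m, ∀ j ∈ Finset.Iio m,
        LinearMap.trace ℝ _ (leftTrans (σ * (swap i m * swap j m))) =
          if i = j then LinearMap.trace ℝ (EuclideanSpace ℝ (Perm (Fin n))) (leftTrans σ)
            else 0 := by
      intro i hi j hj
      rw [Finset.mem_Iio] at hi hj
      split_ifs with hij
      · subst hij; simp
      · rw [trace_leftTrans, if_neg]
        intro h1
        have h2 : (σ * (swap i m * swap j m)) m = m := by rw [h1]; rfl
        rw [Perm.mul_apply, Perm.mul_apply, swap_apply_right,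
          swap_apply_of_ne_of_ne (Ne.symm hij) hj.ne] at h2
        exact absurd (h2 ▸ lt_of_mem_fixFrom hσ hj) (lt_irrefl _)
    have h3 : leftTrans σ * (jucysMurphy m * jucysMurphy m) =
        ∑ i ∈ Finset.Iio m, ∑ j ∈ Finset.Iio m, leftTrans (σ * (swap i m * swap j m)) := by
      rw [jucysMurphy, Finset.sum_mul_sum, Finset.mul_sum]
      simp only [Finset.mul_sum, map_mul]
    rw [h3, map_sum, Finset.sum_congr rfl fun i hi =>
      (map_sum _ _ _).trans (Finset.sum_congr rfl fun j hj => h i hi j hj)]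
    simp only [Finset.sum_ite_eq]
    rw [Finset.sum_congr rfl fun i hi => if_pos hi]
    simp
  | zero => simp
  | add x y _ _ hx hy => rw [add_mul, map_add, hx, hy, map_add]; ring
  | smul a x _ hx => rw [smul_mul_assoc, map_smul, hx, map_smul, smul_eq_mul, smul_eq_mul]; ring

theorem sum_fixFrom_succ {M : Type*} [AddCommMonoid M] (m : Fin n) (F : Perm (Fin n) → M) :
    ∑ σ with σ ∈ fixFrom n (m + 1), F σ =
      ∑ j ∈ Finset.Iic m, ∑ σ with σ ∈ fixFrom n m, F (swap j m * σ) := by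
  rw [← Finset.sum_product']
  refine Finset.sum_nbij' (fun σ => (σ m, swap (σ m) m * σ)) (fun p => swap p.1 m * p.2)
    (fun σ hσ => ?_) (fun p hp => ?_) (fun σ hσ => by simp) (fun p hp => ?_) (fun σ hσ => by simp)
  · rw [Finset.mem_filter] at hσ
    have h1 : σ m ≤ m := by
      by_contra! h
      have := hσ.2 (σ m) (Nat.succ_le_of_lt h)
      rw [σ.injective this] at h
      exact lt_irrefl _ h
    simp only [Finset.mem_product, Finset.mem_Iic, Finset.mem_filter, Finset.mem_univ, true_and]
    refine ⟨h1, fun i hi => ?_⟩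
    rcases hi.eq_or_lt with h | h
    · rw [← Fin.ext h]; simp
    · have h2 := hσ.2 i h
      rw [Perm.mul_apply, h2]
      refine swap_apply_of_ne_of_ne (fun h3 => ?_) (fun h3 => ?_)
      · rw [h3] at h; exact absurd h1 (not_le.mpr h)
      · rw [h3] at h; exact lt_irrefl _ h
  · simp only [Finset.mem_product, Finset.mem_Iic, Finset.mem_filter, Finset.mem_univ,
      true_and] at *
    intro i hi
    have h1 : m < i := Nat.lt_of_succ_le hi
    rw [Perm.mul_apply, hp.2 i h1.le, swap_apply_of_ne_of_ne (hp.1.trans_lt h1).ne' h1.ne']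
  · simp only [Finset.mem_product, Finset.mem_Iic, Finset.mem_filter, Finset.mem_univ,
      true_and] at hp
    have h1 : p.2 m = m := hp.2 m le_rfl
    refine Prod.ext ?_ ?_ <;> simp [h1]

theorem sum_charVec_fixFrom_succ (χ : Perm (Fin n) →* ℤˣ) (ε : ℝ)
    (hχ : ∀ i j : Fin n, i ≠ j → charVec χ (swap i j) = ε) (m : Fin n) :
    ∑ σ with σ ∈ fixFrom n (m + 1), charVec χ σ • leftTrans σ =
      (1 + ε • jucysMurphy m) * ∑ σ with σ ∈ fixFrom n m, charVec χ σ • leftTrans σ := by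
  rw [sum_fixFrom_succ, add_mul, one_mul, jucysMurphy, Finset.smul_sum, Finset.sum_mul_sum,
    ← Finset.Iio_insert, Finset.sum_insert (by simp)]
  congr 1
  · rw [swap_self]
    exact Finset.sum_congr rfl fun σ _ => by
      rw [show (Equiv.refl (Fin n)) = (1 : Perm (Fin n)) from rfl, one_mul]
  · refine Finset.sum_congr rfl fun j hj => Finset.sum_congr rfl fun σ _ => ?_
    rw [charVec_mul, hχ j m (Finset.mem_Iio.mp hj).ne, map_mul, smul_mul_smul_comm]

end JucysMurphy

section JucysMurphySpectrum

variable {n d : ℕ} {e : OrthonormalBasis (Fin d) ℝ (EuclideanSpace ℝ (Perm (Fin n)))}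
  {c : Fin d → Fin n → ℝ}

theorem exists_trace_eq_prod (hc : ∀ i m, jucysMurphy m (e i) = c i m • e i) (δ : ℝ) {M : ℕ}
    (hM : M ≤ n) : ∃ A ∈ fixSpan n M,
      (∀ i, A (e i) = (∏ m : Fin n with 2 ≤ m.val ∧ m.val < M, ((c i m / m) ^ 2 + δ)) • e i) ∧
      LinearMap.trace ℝ _ A = n.factorial * ∏ m ∈ Finset.Ico 2 M, (1 / (m : ℝ) + δ) := by
  induction M with
  | zero =>
    refine ⟨1, one_mem_fixSpan 0, fun i => by simp, ?_⟩
    rw [← map_one leftTrans, trace_leftTrans, if_pos rfl, Fintype.card_perm]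
    simp
  | succ M ih =>
    obtain ⟨A, hA, hA1, hA2⟩ := ih (by omega)
    by_cases h2 : 2 ≤ M
    · have hM' : M < n := by omega
      set m : Fin n := ⟨M, hM'⟩
      have hm0 : (M : ℝ) ≠ 0 := by positivity
      refine ⟨((M : ℝ) ^ 2)⁻¹ • (A * (jucysMurphy m * jucysMurphy m)) + δ • A, ?_, fun i => ?_, ?_⟩
      · exact add_mem (Submodule.smul_mem _ _ (mul_mem_fixSpan (fixSpan_mono (Nat.le_succ M) hA)
          (mul_mem_fixSpan (jucysMurphy_mem m) (jucysMurphy_mem m))))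
          (Submodule.smul_mem _ _ (fixSpan_mono (Nat.le_succ M) hA))
      · have h3 : (Finset.univ.filter fun k : Fin n => 2 ≤ k.val ∧ k.val < M + 1) =
            insert m (Finset.univ.filter fun k : Fin n => 2 ≤ k.val ∧ k.val < M) := by
          ext k
          simp only [Finset.mem_filter, Finset.mem_univ, true_and, Finset.mem_insert, m,
            Fin.ext_iff]
          omega
        rw [h3, Finset.prod_insert (by simp [m]), LinearMap.add_apply, LinearMap.smul_apply,
          LinearMap.smul_apply, Module.End.mul_apply, Module.End.mul_apply, hc, map_smul, hc,
          map_smul, map_smul, hA1]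
        simp only [smul_smul, ← add_smul]
        congr 1
        simp only [m]
        field_simp
      · rw [map_add, map_smul, map_smul, trace_mul_jucysMurphy_sq (m := m) hA, hA2,
          Finset.prod_Ico_succ_top h2]
        simp only [smul_eq_mul, m]
        field_simp
    · have h3 : (Finset.univ.filter fun k : Fin n => 2 ≤ k.val ∧ k.val < M + 1) =
            (Finset.univ.filter fun k : Fin n => 2 ≤ k.val ∧ k.val < M) := by
          ext k
          simp only [Finset.mem_filter, Finset.mem_univ, true_and]
          omega
      refine ⟨A, fixSpan_mono (Nat.le_succ M) hA, fun i => by rw [hA1, h3], ?_⟩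
      rw [hA2, Finset.Ico_eq_empty (by omega), Finset.Ico_eq_empty (by omega)]

theorem factorial_mul_prod_le {n M : ℕ} (hM : M + 1 ≤ n) :
    (M.factorial : ℝ) * ∏ m ∈ Finset.Ico 2 (M + 1), (1 / (m : ℝ) + 1 / (n : ℝ) ^ 2) ≤
      Real.exp (1 / n) ^ M := by
  induction M with
  | zero => simp
  | succ M ih =>
    have hn : (0 : ℝ) < n := by exact_mod_cast (by omega : 0 < n)
    rcases Nat.eq_zero_or_pos M with rfl | h0
    · simp
    · rw [Finset.prod_Ico_succ_top (by omega), Nat.factorial_succ, pow_succ (Real.exp _), Nat.cast_mul]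
      have h1 := ih (by omega)
      have hM0 : (0 : ℝ) < (M + 1 : ℕ) := by positivity
      have h2 : ((M + 1 : ℕ) : ℝ) * (1 / ((M + 1 : ℕ) : ℝ) + 1 / (n : ℝ) ^ 2) ≤
          Real.exp (1 / n) := by
        have h3 := Real.add_one_le_exp (1 / (n : ℝ))
        have h4 : ((M + 1 : ℕ) : ℝ) * (1 / (n : ℝ) ^ 2) ≤ 1 / n := by
          have : ((M + 1 : ℕ) : ℝ) ≤ n := by exact_mod_cast (by omega : M + 1 ≤ n)
          rw [mul_one_div, div_le_div_iff₀ (by positivity) hn]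
          nlinarith
        rw [mul_add, mul_one_div_cancel hM0.ne']
        linarith
      calc _ = ((M.factorial : ℝ) * ∏ m ∈ Finset.Ico 2 (M + 1),
            (1 / (m : ℝ) + 1 / (n : ℝ) ^ 2)) *
            (((M + 1 : ℕ) : ℝ) * (1 / ((M + 1 : ℕ) : ℝ) + 1 / (n : ℝ) ^ 2)) := by
            rw [mul_comm ((M + 1 : ℕ) : ℝ), mul_mul_mul_comm]
        _ ≤ _ := mul_le_mul h1 h2 (by positivity) (by positivity)

theorem exp_neg_mul_one_sub_le {t y : ℝ} (hy0 : 0 ≤ y) (hy1 : y ≤ 1) :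
    Real.exp (-(t * (1 - y))) ≤ y + Real.exp (-t) := by
  have h := convexOn_exp.2 (Set.mem_univ (-t)) (Set.mem_univ 0) (sub_nonneg.mpr hy1) hy0
    (by ring)
  simp only [smul_eq_mul, mul_zero, add_zero, Real.exp_zero, mul_one] at h
  rw [show -(t * (1 - y)) = (1 - y) * -t by ring]
  nlinarith [Real.exp_pos (-t)]

theorem abs_jucysMurphy_eigenvalue_le (hc : ∀ i m, jucysMurphy m (e i) = c i m • e i) (i : Fin d)
    (m : Fin n) : |c i m| ≤ m := by
  have h := norm_jucysMurphy_le m (e i)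
  rwa [hc, norm_smul, e.orthonormal.1 i, mul_one, mul_one] at h

theorem sq_div_le_one (hc : ∀ i m, jucysMurphy m (e i) = c i m • e i) (i : Fin d)
    (m : Fin n) : (c i m / m) ^ 2 ≤ 1 := by
  rw [sq_le_one_iff_abs_le_one, abs_div, Nat.abs_cast]
  exact div_le_one_of_le₀ (abs_jucysMurphy_eigenvalue_le hc i m) (Nat.cast_nonneg _)

theorem sum_exp_neg_le (hn : 2 ≤ n) (hc : ∀ i m, jucysMurphy m (e i) = c i m • e i) :
    ∑ i, Real.exp (-(2 * Real.log n *
      ∑ m : Fin n with 2 ≤ m.val, (1 - (c i m / m) ^ 2))) ≤ 3 * n := by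
  have hn0 : (0 : ℝ) < n := by exact_mod_cast (by omega : 0 < n)
  have he : Real.exp (-(2 * Real.log n)) = 1 / (n : ℝ) ^ 2 := by
    rw [Real.exp_neg, mul_comm, Real.exp_mul, Real.exp_log hn0]
    norm_num
  obtain ⟨A, -, hA1, hA2⟩ := exists_trace_eq_prod hc (1 / (n : ℝ) ^ 2) le_rfl
  have h1 (i : Fin d) : Real.exp (-(2 * Real.log n *
      ∑ m : Fin n with 2 ≤ m.val, (1 - (c i m / m) ^ 2))) ≤ inner ℝ (e i) (A (e i)) := by
    rw [hA1, real_inner_smul_right, real_inner_self_eq_norm_sq, e.orthonormal.1 i, one_pow,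
      mul_one, Finset.mul_sum, ← Finset.sum_neg_distrib, Real.exp_sum]
    simp only [Fin.is_lt, and_true]
    refine Finset.prod_le_prod (fun m _ => (Real.exp_pos _).le) fun m _ => ?_
    rw [← he]
    exact exp_neg_mul_one_sub_le (sq_nonneg _) (sq_div_le_one hc i m)
  refine (Finset.sum_le_sum fun i _ => h1 i).trans ?_
  rw [← LinearMap.trace_eq_sum_inner, hA2]
  obtain ⟨M, rfl⟩ : ∃ M, n = M + 1 := ⟨n - 1, by omega⟩
  have h2 := factorial_mul_prod_le (le_refl (M + 1))
  have h3 : Real.exp (1 / (M + 1 : ℕ)) ^ M ≤ 3 := by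
    rw [← Real.exp_nat_mul]
    have h4 : (M : ℝ) * (1 / ((M + 1 : ℕ) : ℝ)) ≤ 1 := by
      rw [mul_one_div, div_le_one hn0]; push_cast; linarith
    have := Real.exp_one_lt_d9
    linarith [Real.exp_le_exp.mpr h4]
  rw [Nat.factorial_succ, Nat.cast_mul, mul_assoc, mul_comm (3 : ℝ)]
  exact mul_le_mul_of_nonneg_left (h2.trans h3) hn0.le

theorem prod_one_add_smul (hc : ∀ i m, jucysMurphy m (e i) = c i m • e i)
    (χ : Perm (Fin n) →* ℤˣ) (ε : ℝ)
    (hχ : ∀ i j : Fin n, i ≠ j → charVec χ (swap i j) = ε) (i : Fin d) :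
    inner ℝ (charVec χ) (e i) • charVec χ = (∏ m, (1 + ε * c i m)) • e i := by
  have h (M : ℕ) (hM : M ≤ n) :
      (∑ σ with σ ∈ fixFrom n M, charVec χ σ • leftTrans σ) (e i) =
        (∏ m : Fin n with m.val < M, (1 + ε * c i m)) • e i := by
    induction M with
    | zero =>
      have h0 : (Finset.univ.filter fun σ => σ ∈ fixFrom n 0) = {1} := by
        ext σ
        simp [mem_fixFrom, Perm.ext_iff]
      rw [h0]
      simp [charVec_apply]
    | succ M ih =>
      have h1 := sum_charVec_fixFrom_succ χ ε hχ ⟨M, hM⟩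
      simp only at h1
      have h3 : (Finset.univ.filter fun k : Fin n => k.val < M + 1) =
            insert ⟨M, hM⟩ (Finset.univ.filter fun k : Fin n => k.val < M) := by
          ext k
          simp only [Finset.mem_filter, Finset.mem_univ, true_and, Finset.mem_insert, Fin.ext_iff]
          omega
      rw [h1, Module.End.mul_apply, ih (by omega), h3, Finset.prod_insert (by simp), map_smul,
        LinearMap.add_apply, LinearMap.smul_apply, hc, Module.End.one_apply, smul_smul]
      nth_rewrite 1 [← one_smul ℝ (e i)]
      rw [← add_smul, smul_smul, mul_comm]
  rw [← convOp_charVec, convOp]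
  have h1 := h n le_rfl
  simp only [Fin.is_lt, Finset.filter_true] at h1
  rw [← h1, Finset.filter_true_of_mem fun σ _ i hi => absurd i.2 (not_lt.mpr hi)]

theorem charVec_one_apply (σ : Perm (Fin n)) : charVec 1 σ = (1 : ℝ) := by simp [charVec_apply]

theorem charVec_sign_swap (i j : Fin n) (h : i ≠ j) : charVec Perm.sign (swap i j) = (-1 : ℝ) := by
  simp [charVec_apply, Perm.sign_swap h]

/-- A joint eigenvector is parallel to a one-dimensional character, or has a spectral gap. -/
theorem eigen_parallel_or_gap (hc : ∀ i m, jucysMurphy m (e i) = c i m • e i) (i : Fin d) :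
    (∃ (b : Bool) (a : ℝ), e i = a • charVec (b.rec 1 Perm.sign : Perm (Fin n) →* ℤˣ)) ∨
      3 / 4 ≤ ∑ m : Fin n with 2 ≤ m.val, (1 - (c i m / m) ^ 2) := by
  by_cases h : ∃ b : Bool,
      inner ℝ (charVec (b.rec 1 Perm.sign : Perm (Fin n) →* ℤˣ)) (e i) ≠ (0 : ℝ)
  · left
    obtain ⟨b, hb⟩ := h
    refine ⟨b, ?_⟩
    cases b
    · obtain ⟨a, ha, -⟩ := apply_mul_apply_of_charVec_eigen (e.orthonormal.1 i)
        (prod_one_add_smul hc 1 1 (fun _ _ _ => charVec_one_apply _) i) hb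
      exact ⟨a, ha⟩
    · obtain ⟨a, ha, -⟩ := apply_mul_apply_of_charVec_eigen (e.orthonormal.1 i)
        (prod_one_add_smul hc Perm.sign (-1) charVec_sign_swap i) hb
      exact ⟨a, ha⟩
  · right
    push Not at h
    have he : e i ≠ 0 := by
      intro h0
      have := e.orthonormal.1 i
      rw [h0, norm_zero] at this
      norm_num at this
    have h1 := prod_one_add_smul hc 1 1 (fun _ _ _ => charVec_one_apply _) i
    have h2 := prod_one_add_smul hc Perm.sign (-1) charVec_sign_swap i
    have h3 : inner ℝ (charVec 1) (e i) = (0 : ℝ) := h false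
    have h4 : inner ℝ (charVec Perm.sign) (e i) = (0 : ℝ) := h true
    rw [h3, zero_smul, eq_comm, smul_eq_zero_iff_left he, Finset.prod_eq_zero_iff] at h1
    rw [h4, zero_smul, eq_comm, smul_eq_zero_iff_left he, Finset.prod_eq_zero_iff] at h2
    obtain ⟨m1, -, hm1⟩ := h1
    obtain ⟨m2, -, hm2⟩ := h2
    have hc1 : c i m1 = -1 := by linarith
    have hc2 : c i m2 = 1 := by linarith
    have b1 := abs_jucysMurphy_eigenvalue_le hc i m1
    have b2 := abs_jucysMurphy_eigenvalue_le hc i m2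
    rw [hc1, abs_neg, abs_one, Nat.one_le_cast] at b1
    rw [hc2, abs_one, Nat.one_le_cast] at b2
    obtain ⟨m, hm, hcm⟩ : ∃ m : Fin n, 2 ≤ m.val ∧ c i m ^ 2 = 1 := by
      by_cases h5 : 2 ≤ m1.val
      · exact ⟨m1, h5, by rw [hc1]; norm_num⟩
      · refine ⟨m2, ?_, by rw [hc2]; norm_num⟩
        by_contra h6
        have : m1 = m2 := Fin.ext (by omega)
        rw [this, hc2] at hc1
        norm_num at hc1
    have h7 := Finset.single_le_sum (f := fun m : Fin n => 1 - (c i m / m) ^ 2)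
      (s := Finset.univ.filter fun m : Fin n => 2 ≤ m.val)
      (fun m _ => sub_nonneg.mpr (sq_div_le_one hc i m)) (by simp [hm] : m ∈ _)
    refine le_trans ?_ h7
    simp only [div_pow, hcm]
    have : (2 : ℝ) ≤ m.val := by exact_mod_cast hm
    have h8 : 1 / (m.val : ℝ) ^ 2 ≤ 1 / 4 :=
      one_div_le_one_div_of_le (by norm_num) (by nlinarith)
    linarith

theorem sum_gap_mul_inner_sq_le (hc : ∀ i m, jucysMurphy m (e i) = c i m • e i)
    (f : EuclideanSpace ℝ (Perm (Fin n))) {K : ℝ}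
    (hK : ∀ a b m : Fin n, a ≠ b → a ≠ m → b ≠ m →
      ‖f - leftTrans (swap a m * swap m b) f‖ ^ 2 / 2 ≤ K) (hK0 : 0 ≤ K) :
    ∑ i, (∑ m : Fin n with 2 ≤ m.val, (1 - (c i m / m) ^ 2)) * inner ℝ (e i) f ^ 2 ≤ n * K := by
  have h1 (m : Fin n) (hm : 2 ≤ m.val) :
      ∑ i, (1 - (c i m / m) ^ 2) * inner ℝ (e i) f ^ 2 ≤ K := by
    have hm0 : (0 : ℝ) < m.val := by exact_mod_cast (by omega : 0 < m.val)
    have h2 : ∑ i, (1 - (c i m / m) ^ 2) * inner ℝ (e i) f ^ 2 =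
        ‖f‖ ^ 2 - ‖jucysMurphy m f‖ ^ 2 / m ^ 2 := by
      rw [← e.sum_sq_inner_right f, ← e.sum_sq_inner_right (jucysMurphy m f), Finset.sum_div,
        ← Finset.sum_sub_distrib]
      refine Finset.sum_congr rfl fun i _ => ?_
      rw [← jucysMurphy_isSymmetric, hc, real_inner_smul_left]
      ring
    have h3 : ‖jucysMurphy m f‖ ^ 2 = ∑ a ∈ Finset.Iio m, ∑ b ∈ Finset.Iio m,
        inner ℝ f (leftTrans (swap a m * swap m b) f) := by
      rw [← real_inner_self_eq_norm_sq, jucysMurphy, LinearMap.sum_apply, sum_inner]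
      refine Finset.sum_congr rfl fun a _ => ?_
      rw [inner_sum]
      refine Finset.sum_congr rfl fun b _ => ?_
      rw [inner_leftTrans, swap_inv, ← Module.End.mul_apply, ← map_mul, swap_comm m b]
    have h4 : ∀ a ∈ Finset.Iio m, ∀ b ∈ Finset.Iio m,
        ‖f‖ ^ 2 - K ≤ inner ℝ f (leftTrans (swap a m * swap m b) f) := by
      intro a ha b hb
      rw [Finset.mem_Iio] at ha hb
      by_cases hab : a = b
      · subst hab
        rw [swap_comm m a, swap_mul_self, map_one, Module.End.one_apply,
          real_inner_self_eq_norm_sq]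
        linarith
      · have h5 := hK a b m hab ha.ne hb.ne
        rw [← two_mul_inner_sub_leftTrans, inner_sub_right, real_inner_self_eq_norm_sq] at h5
        linarith
    have h5 : ((m : ℝ)) ^ 2 * (‖f‖ ^ 2 - K) ≤ ‖jucysMurphy m f‖ ^ 2 := by
      rw [h3]
      refine le_trans (le_of_eq ?_) (Finset.sum_le_sum fun a ha =>
        Finset.sum_le_sum fun b hb => h4 a ha b hb)
      simp
      ring
    rw [h2]
    have h6 : ‖f‖ ^ 2 - K ≤ ‖jucysMurphy m f‖ ^ 2 / m ^ 2 := by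
      rw [le_div_iff₀ (by positivity)]; linarith
    linarith
  simp only [Finset.sum_mul]
  rw [Finset.sum_comm]
  refine (Finset.sum_le_sum fun m hm => h1 m (Finset.mem_filter.mp hm).2).trans ?_
  rw [Finset.sum_const, nsmul_eq_mul]
  refine mul_le_mul_of_nonneg_right ?_ hK0
  exact_mod_cast (Finset.card_le_univ _).trans (Fintype.card_fin n).le

end JucysMurphySpectrum

section WordBall

variable {G : Type*} [Group G]

/-- The elements which are products of at most `L` elements of `S`. -/
def wordBall (S : Set G) (L : ℕ) : Set G :=
  {x | ∃ l : List G, l.length ≤ L ∧ (∀ s ∈ l, s ∈ S) ∧ l.prod = x}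

theorem wordBall_mono {S : Set G} {L M : ℕ} (h : L ≤ M) : wordBall S L ⊆ wordBall S M :=
  fun _ ⟨l, hl, h1, h2⟩ => ⟨l, hl.trans h, h1, h2⟩

theorem one_mem_wordBall (S : Set G) (L : ℕ) : 1 ∈ wordBall S L := ⟨[], by simp⟩

theorem mem_wordBall_one {S : Set G} {s : G} (h : s ∈ S) : s ∈ wordBall S 1 :=
  ⟨[s], by simp [h]⟩

theorem mul_mem_wordBall {S : Set G} {x y : G} {L M : ℕ} (hx : x ∈ wordBall S L)
    (hy : y ∈ wordBall S M) : x * y ∈ wordBall S (L + M) := by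
  obtain ⟨l, hl, h1, rfl⟩ := hx
  obtain ⟨m, hm, h2, rfl⟩ := hy
  refine ⟨l ++ m, by simp; omega, fun s hs => ?_, by simp⟩
  rcases List.mem_append.mp hs with h | h
  exacts [h1 s h, h2 s h]

theorem inv_mem_wordBall {S : Set G} (hS : ∀ s ∈ S, s⁻¹ ∈ S) {x : G} {L : ℕ}
    (hx : x ∈ wordBall S L) : x⁻¹ ∈ wordBall S L := by
  obtain ⟨l, hl, h1, rfl⟩ := hx
  refine ⟨(l.map fun s => s⁻¹).reverse, by simpa using hl, fun s hs => ?_, ?_⟩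
  · simp only [List.mem_reverse, List.mem_map] at hs
    obtain ⟨t, ht, rfl⟩ := hs
    exact hS t (h1 t ht)
  · rw [List.prod_inv_reverse]

theorem pow_mem_wordBall {S : Set G} {x : G} {L : ℕ} (hx : x ∈ wordBall S L) (k : ℕ) :
    x ^ k ∈ wordBall S (k * L) := by
  induction k with
  | zero => simpa using one_mem_wordBall S 0
  | succ k ih => rw [pow_succ, Nat.succ_mul]; exact mul_mem_wordBall ih hx

theorem wordBall_subset_closure (S : Set G) (L : ℕ) : wordBall S L ⊆ Subgroup.closure S := by
  rintro _ ⟨l, -, h, rfl⟩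
  exact Subgroup.list_prod_mem _ fun s hs => Subgroup.subset_closure (h s hs)

theorem norm_sub_leftTrans_le [Fintype G] {S : Set G} {f : EuclideanSpace ℝ G} {r : ℝ}
    (hr : ∀ s ∈ S, ‖f - leftTrans s f‖ ≤ r) (hr0 : 0 ≤ r) {L : ℕ} {z : G}
    (hz : z ∈ wordBall S L) : ‖f - leftTrans z f‖ ≤ L * r := by
  obtain ⟨l, hl, h1, rfl⟩ := hz
  have h2 : ‖f - leftTrans l.prod f‖ ≤ l.length * r := by
    clear hl
    induction l with
    | nil => simp
    | cons s l ih =>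
      have h3 : f - leftTrans (s * l.prod) f =
          (f - leftTrans s f) + leftTrans s (f - leftTrans l.prod f) := by
        rw [map_sub, ← Module.End.mul_apply, ← map_mul]; abel
      rw [List.prod_cons, h3, List.length_cons]
      refine (norm_add_le _ _).trans ?_
      rw [norm_leftTrans]
      push_cast
      linarith [hr s (h1 s (by simp)), ih fun t ht => h1 t (by simp [ht])]
  exact h2.trans (mul_le_mul_of_nonneg_right (by exact_mod_cast hl) hr0)

end WordBall

section LazyWalk

variable {n : ℕ} (g h : Perm (Fin n))

/-- The symmetric generating set `{g, h, g⁻¹, h⁻¹}`. -/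
def genSet : Set (Perm (Fin n)) := {g, h, g⁻¹, h⁻¹}

theorem inv_mem_genSet : ∀ s ∈ genSet g h, s⁻¹ ∈ genSet g h := by
  rintro s (rfl | rfl | rfl | rfl) <;> simp [genSet]

theorem mem_genSet_iff (s : Perm (Fin n)) :
    s ∈ ({g, h, g⁻¹, h⁻¹} : Finset (Perm (Fin n))) ↔ s ∈ genSet g h := by
  simp [genSet]

theorem lazyWalk_nonneg (x : Perm (Fin n)) : 0 ≤ lazyWalk g h x := by
  unfold lazyWalk
  positivity

theorem lazyWalk_inv (x : Perm (Fin n)) : lazyWalk g h x⁻¹ = lazyWalk g h x := by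
  have h1 : x⁻¹ ∈ genSet g h ↔ x ∈ genSet g h :=
    ⟨fun hx => inv_inv x ▸ inv_mem_genSet g h _ hx, inv_mem_genSet g h x⟩
  simp only [lazyWalk, mem_genSet_iff, h1, inv_eq_one]

theorem half_le_lazyWalk_one : 1 / 2 ≤ lazyWalk g h 1 := by
  unfold lazyWalk
  rw [if_pos rfl]
  have : (0 : ℝ) ≤ (if (1 : Perm (Fin n)) ∈ ({g, h, g⁻¹, h⁻¹} : Finset (Perm (Fin n))) then
    1 / (2 * ((({g, h, g⁻¹, h⁻¹} : Finset (Perm (Fin n)))).card : ℝ)) else 0) := by positivity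
  linarith

theorem eighth_le_lazyWalk {s : Perm (Fin n)} (hs : s ∈ genSet g h) :
    1 / 8 ≤ lazyWalk g h s := by
  have hs' := (mem_genSet_iff g h s).mpr hs
  have h1 : (({g, h, g⁻¹, h⁻¹} : Finset (Perm (Fin n))).card : ℝ) ≤ 4 := by
    exact_mod_cast Finset.card_le_four
  have h2 : (0 : ℝ) < (({g, h, g⁻¹, h⁻¹} : Finset (Perm (Fin n))).card : ℝ) := by
    exact_mod_cast Finset.card_pos.mpr ⟨s, hs'⟩
  have h3 : (1 : ℝ) / 8 ≤ 1 / (2 * (({g, h, g⁻¹, h⁻¹} : Finset (Perm (Fin n))).card : ℝ)) :=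
    one_div_le_one_div_of_le (by positivity) (by linarith)
  unfold lazyWalk
  rw [if_pos hs']
  have : (0 : ℝ) ≤ if s = 1 then (1 : ℝ) / 2 else 0 := by positivity
  linarith

theorem sum_lazyWalk : ∑ x, lazyWalk g h x = 1 := by
  have h2 : (0 : ℝ) < (({g, h, g⁻¹, h⁻¹} : Finset (Perm (Fin n))).card : ℝ) := by
    exact_mod_cast Finset.card_pos.mpr ⟨g, by simp⟩
  unfold lazyWalk
  rw [Finset.sum_add_distrib, Finset.sum_ite_eq', ← Finset.sum_filter, Finset.filter_mem_eq_inter,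
    Finset.univ_inter, Finset.sum_const, nsmul_eq_mul, if_pos (Finset.mem_univ _)]
  field_simp
  norm_num

theorem lazyWalk_eq_zero {x : Perm (Fin n)} (h1 : x ≠ 1) (hx : x ∉ genSet g h) :
    lazyWalk g h x = 0 := by
  rw [← mem_genSet_iff] at hx
  simp [lazyWalk, h1, hx]

end LazyWalk

section MixingFromThreeCycles

variable {n : ℕ}

theorem alternatingGroup_le_of_swap_mul_swap_mem {H : Subgroup (Perm (Fin n))}
    (hH : ∀ x y z : Fin n, x ≠ y → y ≠ z → x ≠ z → swap x y * swap y z ∈ H) :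
    alternatingGroup (Fin n) ≤ H := by
  rw [← Perm.closure_three_cycles_eq_alternating, Subgroup.closure_le]
  intro σ hσ
  have hσ : σ.IsThreeCycle := hσ
  obtain ⟨a, ha⟩ : σ.support.Nonempty := by
    rw [← Finset.card_pos, hσ.card_support]; norm_num
  rw [SetLike.mem_coe, hσ.eq_swap_mul_swap_iff_mem_support.mpr ha]
  have hnd := hσ.nodup_iff_mem_support.mpr ha
  simp only [List.nodup_cons, List.mem_cons, List.not_mem_nil, or_false, not_or] at hnd
  exact hH _ _ _ hnd.1.1 hnd.2.1 hnd.1.2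

/-- The walk is close to its projection on the two one-dimensional characters. -/
theorem abs_convPow_lazyWalk_sub_le {L : ℕ} (hn : 5 ≤ n) (hL : 1 ≤ L) {g h : Perm (Fin n)}
    (H : ∀ x y z : Fin n, x ≠ y → y ≠ z → x ≠ z →
      swap x y * swap y z ∈ wordBall (genSet g h) L) {k : ℕ}
    (hk : 48 * (n : ℝ) * L ^ 2 * Real.log n ≤ k) (x : Perm (Fin n)) :
    |convPow (lazyWalk g h) k x - (1 / (n.factorial : ℝ) +
        (∑ y, lazyWalk g h y * charVec Perm.sign y) ^ k * charVec Perm.sign x / n.factorial)| ≤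
      1 / 8 / n.factorial := by
  have hn5 : (5 : ℝ) ≤ n := by exact_mod_cast hn
  have hL1 : (1 : ℝ) ≤ L := by exact_mod_cast hL
  have hlog : 0 < Real.log n := Real.log_pos (by linarith)
  set μ := lazyWalk g h with hμ
  let χ : Bool → Perm (Fin n) →* ℤˣ := fun b => b.rec 1 Perm.sign
  have hχ : Function.Injective χ := by
    have hne : (1 : Perm (Fin n) →* ℤˣ) ≠ Perm.sign := by
      intro h1
      have h2 := DFunLike.congr_fun h1 (swap ⟨0, by omega⟩ ⟨1, by omega⟩)
      rw [Perm.sign_swap (by simp)] at h2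
      rw [MonoidHom.one_apply] at h2
      exact absurd h2 (by decide)
    rintro (_ | _) (_ | _) hb
    · rfl
    · exact absurd hb hne
    · exact absurd hb.symm hne
    · rfl
  obtain ⟨e, c, hc⟩ := exists_joint_eigenbasis (jucysMurphy (n := n)) jucysMurphy_isSymmetric
    fun i j _ => jucysMurphy_commute i j
  set l := fun i => ∑ m : Fin n with 2 ≤ m.val, (1 - (c i m / m) ^ 2) with hl
  set good : Fin _ → Prop := fun i => 3 / 4 ≤ l i
  set B : ℝ := 8 * n * L ^ 2 with hBdef
  have hB : 0 < B := by positivity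
  have hln (i) : l i ≤ n := by
    refine (Finset.sum_le_sum (g := fun _ => (1 : ℝ)) fun m _ => ?_).trans ?_
    · linarith [sq_nonneg (c i m / m)]
    · rw [Finset.sum_const, nsmul_eq_mul, mul_one]
      exact_mod_cast (Finset.card_le_univ _).trans (Fintype.card_fin n).le
  have hnB : (n : ℝ) ≤ B := by
    have : (1 : ℝ) ≤ L ^ 2 := one_le_pow₀ hL1
    rw [hBdef]; nlinarith
  have hk0 : k ≠ 0 := by
    rintro rfl
    have : 0 < 48 * (n : ℝ) * L ^ 2 * Real.log n := by positivity
    simp only [Nat.cast_zero] at hk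
    linarith
  have hform (f : EuclideanSpace ℝ (Perm (Fin n))) :
      ∑ i, l i * inner ℝ (e i) f ^ 2 ≤ B * inner ℝ f (f - convOp μ f) := by
    set E := inner ℝ f (f - convOp μ f) with hE
    rw [inner_sub_convOp (sum_lazyWalk g h)] at hE
    have hpos (y) : 0 ≤ μ y * (‖f - leftTrans y f‖ ^ 2 / 2) :=
      mul_nonneg (lazyWalk_nonneg g h y) (by positivity)
    have hE0 : 0 ≤ E := by rw [hE]; exact Finset.sum_nonneg fun y _ => hpos y
    have hs : ∀ s ∈ genSet g h, ‖f - leftTrans s f‖ ≤ 4 * √E := by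
      intro s hs
      have h1 := Finset.single_le_sum (fun y _ => hpos y) (Finset.mem_univ s)
      rw [← hE] at h1
      have h2 := eighth_le_lazyWalk g h hs
      refine abs_le_of_sq_le_sq' ?_ (by positivity) |>.2
      rw [mul_pow, Real.sq_sqrt hE0]
      nlinarith [sq_nonneg ‖f - leftTrans s f‖]
    have h3 := sum_gap_mul_inner_sq_le hc f (K := 8 * L ^ 2 * E) (fun a b m hab ham hbm => by
      have h4 := norm_sub_leftTrans_le hs (by positivity) (H a m b ham hbm.symm hab)
      have h5 := pow_le_pow_left₀ (norm_nonneg _) h4 2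
      rw [mul_pow, mul_pow, Real.sq_sqrt hE0] at h5
      linarith) (by positivity)
    refine h3.trans (le_of_eq ?_)
    rw [hBdef]; ring
  have hη : ∑ i, (if good i then (1 - l i / B) ^ k else 0) ≤ 1 / 8 := by
    have h1 (i) : (if good i then (1 - l i / B) ^ k else 0) ≤
        1 / (n : ℝ) ^ 3 * Real.exp (-(2 * Real.log n * l i)) := by
      split_ifs with hi
      · have hi : 3 / 4 ≤ l i := hi
        have h2 : 1 - l i / B ≤ Real.exp (-(l i / B)) := by
          have := Real.add_one_le_exp (-(l i / B)); linarith
        have h3 : 0 ≤ 1 - l i / B := by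
          rw [sub_nonneg, div_le_one hB]; exact (hln i).trans hnB
        have h4 : 1 / (n : ℝ) ^ 3 = Real.exp (-(3 * Real.log n)) := by
          rw [Real.exp_neg, mul_comm, Real.exp_mul, Real.exp_log (by linarith)]
          norm_num
        rw [h4, ← Real.exp_add]
        refine (pow_le_pow_left₀ h3 h2 k).trans ?_
        rw [← Real.exp_nat_mul, Real.exp_le_exp]
        have h5 : 6 * Real.log n ≤ k / B := by
          rw [le_div_iff₀ hB, hBdef]; linarith
        have h6 : (k : ℝ) * -(l i / B) = -(k / B * l i) := by ring
        rw [h6]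
        nlinarith
      · positivity
    refine (Finset.sum_le_sum fun i _ => h1 i).trans ?_
    rw [← Finset.mul_sum]
    have h2 := sum_exp_neg_le (by omega : 2 ≤ n) hc
    refine (mul_le_mul_of_nonneg_left h2 (by positivity)).trans ?_
    rw [one_div_mul_eq_div, div_le_div_iff₀ (by positivity) (by norm_num)]
    nlinarith [mul_nonneg (by linarith : (0 : ℝ) ≤ n) (by nlinarith : (0 : ℝ) ≤ (n : ℝ) ^ 2 - 25)]
  have key := abs_convPow_sub_le (lazyWalk_nonneg g h) (sum_lazyWalk g h)
    (half_le_lazyWalk_one g h) (lazyWalk_inv g h) hχ e good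
    (fun i hi => (eigen_parallel_or_gap hc i).resolve_right hi) hB l
    (fun i => (hln i).trans hnB) hform hη x hk0
  rw [Fintype.card_perm, Fintype.card_fin] at key
  simp only [Fintype.sum_bool, χ, charVec_one_apply, mul_one, sum_lazyWalk, one_pow] at key
  rwa [add_comm] at key

/-- If all `3`-cycles are words of length at most `L` in the generators, the lazy random walk
mixes after `O(n L² log n)` steps. -/
theorem mixing_of_swap_mul_swap_mem_wordBall {L : ℕ} (hn : 5 ≤ n) (hL : 1 ≤ L)
    {g h : Perm (Fin n)}
    (H : ∀ x y z : Fin n, x ≠ y → y ≠ z → x ≠ z →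
      swap x y * swap y z ∈ wordBall (genSet g h) L) {k : ℕ}
    (hk : 48 * (n : ℝ) * L ^ 2 * Real.log n ≤ k) (x : Perm (Fin n))
    (hx : x ∈ Subgroup.closure ({g, h} : Set (Perm (Fin n)))) :
    |convPow (lazyWalk g h) k x -
      1 / (Nat.card ↥(Subgroup.closure ({g, h} : Set (Perm (Fin n)))) : ℝ)| ≤
      1 / (2 * (Nat.card ↥(Subgroup.closure ({g, h} : Set (Perm (Fin n)))) : ℝ)) := by
  have key := abs_convPow_lazyWalk_sub_le hn hL H hk x
  have hn5 : (5 : ℝ) ≤ n := by exact_mod_cast hn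
  have hL1 : (1 : ℝ) ≤ L := by exact_mod_cast hL
  have hf : (0 : ℝ) < n.factorial := by positivity
  set Γ := Subgroup.closure ({g, h} : Set (Perm (Fin n))) with hΓ
  have hgΓ : g ∈ Γ := Subgroup.subset_closure (by simp)
  have hhΓ : h ∈ Γ := Subgroup.subset_closure (by simp)
  have hSΓ : Subgroup.closure (genSet g h) ≤ Γ := by
    rw [Subgroup.closure_le]
    rintro s (rfl | rfl | rfl | rfl)
    exacts [hgΓ, hhΓ, inv_mem hgΓ, inv_mem hhΓ]
  have hA : alternatingGroup (Fin n) ≤ Γ := alternatingGroup_le_of_swap_mul_swap_mem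
    fun x y z h1 h2 h3 => hSΓ (wordBall_subset_closure _ _ (H x y z h1 h2 h3))
  have : Nontrivial (Fin n) := Fin.nontrivial_iff_two_le.mpr (by omega)
  set lam := ∑ y, lazyWalk g h y * charVec Perm.sign y with hlam
  have hlam' : 1 - lam = ∑ y, lazyWalk g h y * (1 - charVec Perm.sign y) := by
    simp only [mul_sub, mul_one, Finset.sum_sub_distrib, sum_lazyWalk, hlam]
  by_cases hs : ∀ s ∈ genSet g h, Perm.sign s = 1
  · have hΓA : Γ = alternatingGroup (Fin n) := by
      refine le_antisymm ?_ hA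
      rw [hΓ, Subgroup.closure_le]
      rintro s (rfl | rfl)
      · exact Perm.mem_alternatingGroup.mpr (hs _ (by simp [genSet]))
      · exact Perm.mem_alternatingGroup.mpr (hs _ (by simp [genSet]))
    have hcard : 2 * (Nat.card Γ : ℝ) = n.factorial := by
      rw [hΓA]
      have := two_mul_nat_card_alternatingGroup (α := Fin n)
      rw [Nat.card_perm, Nat.card_fin] at this
      exact_mod_cast this
    have hx1 : charVec Perm.sign x = (1 : ℝ) := by
      rw [hΓA, Perm.mem_alternatingGroup] at hx
      simp [charVec_apply, hx]
    have hlam1 : lam = 1 := by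
      have h1 : 1 - lam = 0 := by
        rw [hlam']
        refine Finset.sum_eq_zero fun y _ => ?_
        by_cases hy1 : y = 1
        · simp [hy1, charVec_apply]
        · by_cases hy : y ∈ genSet g h
          · simp [charVec_apply, hs y hy]
          · rw [lazyWalk_eq_zero g h hy1 hy, zero_mul]
      linarith
    have hcard' : (Nat.card Γ : ℝ) = n.factorial / 2 := by linarith
    rw [hcard']
    rw [hx1, hlam1, one_pow, mul_one] at key
    have e1 : 1 / ((n.factorial : ℝ) / 2) = 1 / (n.factorial : ℝ) + 1 / (n.factorial : ℝ) := by
      field_simp; norm_num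
    rw [e1]
    refine key.trans ?_
    rw [show 2 * ((n.factorial : ℝ) / 2) = n.factorial by ring]
    exact div_le_div_of_nonneg_right (by norm_num) hf.le
  · push Not at hs
    obtain ⟨s, hs, hsgn⟩ := hs
    have hsgn : Perm.sign s = -1 := (Int.units_eq_one_or _).resolve_left hsgn
    have hΓ' : Γ = ⊤ := by
      rw [eq_top_iff]
      intro y _
      rcases Int.units_eq_one_or (Perm.sign y) with hy | hy
      · exact hA (Perm.mem_alternatingGroup.mpr hy)
      · have h1 : y * s ∈ Γ := hA (Perm.mem_alternatingGroup.mpr (by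
          rw [Perm.sign_mul, hy, hsgn]; decide))
        have h2 : s ∈ Γ := hSΓ (Subgroup.subset_closure hs)
        exact (Subgroup.mul_mem_cancel_right Γ h2).mp h1
    have hcard : (Nat.card Γ : ℝ) = n.factorial := by
      rw [hΓ', Subgroup.card_top, Nat.card_perm, Nat.card_fin]
    have hpm (y : Perm (Fin n)) : 0 ≤ 1 - charVec Perm.sign y := by
      rw [charVec_apply]
      rcases Int.units_eq_one_or (Perm.sign y) with h | h <;> simp [h]
    have hlam34 : lam ≤ 3 / 4 := by
      have h1 := Finset.single_le_sum (f := fun y => lazyWalk g h y * (1 - charVec Perm.sign y))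
        (fun y _ => mul_nonneg (lazyWalk_nonneg g h y) (hpm y)) (Finset.mem_univ s)
      rw [← hlam'] at h1
      have h2 := eighth_le_lazyWalk g h hs
      have h3 : charVec Perm.sign s = (-1 : ℝ) := by simp [charVec_apply, hsgn]
      simp only [h3] at h1
      linarith
    have hlam0 : 0 ≤ lam := by
      have h1 := inner_convOp_nonneg (lazyWalk_nonneg g h) (sum_lazyWalk g h)
        (half_le_lazyWalk_one g h) (charVec Perm.sign)
      rw [convOp_of_charVec, real_inner_smul_right, inner_charVec_self] at h1
      exact nonneg_of_mul_nonneg_left h1 (by positivity)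
    have hk4 : 4 ≤ k := by
      have h1 : 1 ≤ Real.log n := by
        rw [Real.le_log_iff_exp_le (by linarith)]
        linarith [Real.exp_one_lt_d9]
      have h2 : (4 : ℝ) ≤ k := by
        have h3 : (1 : ℝ) ≤ L ^ 2 := one_le_pow₀ hL1
        have h4 : 1 ≤ (L : ℝ) ^ 2 * Real.log n := by nlinarith
        nlinarith
      exact_mod_cast h2
    have hlamk : lam ^ k ≤ 3 / 8 := by
      refine (pow_le_pow_of_le_one hlam0 (by linarith) hk4).trans ?_
      refine (pow_le_pow_left₀ hlam0 hlam34 4).trans (by norm_num)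
    rw [hcard]
    have h5 : |lam ^ k * charVec Perm.sign x / (n.factorial : ℝ)| ≤ 3 / 8 / n.factorial := by
      rw [abs_div, abs_of_pos hf, abs_mul, abs_of_nonneg (pow_nonneg hlam0 k)]
      have h6 : |charVec Perm.sign x| = (1 : ℝ) := by
        rw [charVec_apply]
        rcases Int.units_eq_one_or (Perm.sign x) with h | h <;> simp [h]
      rw [h6, mul_one]
      exact div_le_div_of_nonneg_right hlamk hf.le
    have h7 : 1 / (2 * (n.factorial : ℝ)) = 1 / 8 / n.factorial + 3 / 8 / n.factorial := by
      field_simp; norm_num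
    rw [h7]
    rw [abs_le] at *
    constructor <;> linarith [key.1, key.2, h5.1, h5.2]

end MixingFromThreeCycles

section ThreeCycles

variable {n : ℕ}

theorem conj_swap_mul_swap (x : Perm (Fin n)) (a b c : Fin n) :
    x * (swap a b * swap b c) * x⁻¹ = swap (x a) (x b) * swap (x b) (x c) := by
  rw [← mul_assoc x, mul_swap_eq_swap_mul x a b, mul_assoc _ x, mul_swap_eq_swap_mul x b c,
    ← mul_assoc, mul_inv_cancel_right]

theorem swap_mul_swap_rotate {x y z : Fin n} (hxz : x ≠ z) (hyz : y ≠ z) :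
    swap x y * swap y z = swap z x * swap x y := by
  rw [mul_swap_eq_swap_mul, swap_apply_right, swap_apply_of_ne_of_ne hxz.symm hyz.symm,
    swap_comm x z]

theorem inv_swap_mul_swap (x y z : Fin n) :
    (swap x y * swap y z)⁻¹ = swap z y * swap y x := by
  rw [mul_inv_rev, swap_inv, swap_inv, swap_comm y z, swap_comm x y]

theorem swap_mul_swap_apply {a b c : Fin n} (hac : a ≠ c) (hbc : b ≠ c) (hab : a ≠ b) :
    (swap a b * swap b c) a = b ∧ (swap a b * swap b c) b = c ∧ (swap a b * swap b c) c = a := by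
  refine ⟨?_, ?_, ?_⟩
  · rw [Perm.mul_apply, swap_apply_of_ne_of_ne hab hac, swap_apply_left]
  · rw [Perm.mul_apply, swap_apply_left, swap_apply_of_ne_of_ne hac.symm hbc.symm]
  · rw [Perm.mul_apply, swap_apply_right, swap_apply_right]

theorem swap_mul_swap_apply_of_ne {a b c y : Fin n} (ha : y ≠ a) (hb : y ≠ b) (hc : y ≠ c) :
    (swap a b * swap b c) y = y := by
  rw [Perm.mul_apply, swap_apply_of_ne_of_ne hb hc, swap_apply_of_ne_of_ne ha hb]

/-- From one `3`-cycle and short double transitivity one gets all `3`-cycles. -/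
theorem swap_mul_swap_mem_wordBall {S : Set (Perm (Fin n))} (hS : ∀ s ∈ S, s⁻¹ ∈ S) {L L₀ : ℕ}
    (htrans : ∀ p₁ p₂ q₁ q₂ : Fin n, p₁ ≠ p₂ → q₁ ≠ q₂ →
      ∃ x ∈ wordBall S L₀, x p₁ = q₁ ∧ x p₂ = q₂)
    {a b c : Fin n} (hab : a ≠ b) (hbc : b ≠ c) (hac : a ≠ c)
    (h : swap a b * swap b c ∈ wordBall S L) {x y z : Fin n} (hxy : x ≠ y) (hyz : y ≠ z)
    (hxz : x ≠ z) : swap x y * swap y z ∈ wordBall S (3 * (L + 2 * L₀)) := by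
  have hconj : ∀ p q : Fin n, p ≠ q → ∃ r, r ≠ p ∧ r ≠ q ∧
      swap p q * swap q r ∈ wordBall S (L + 2 * L₀) := by
    intro p q hpq
    obtain ⟨t, ht, rfl, rfl⟩ := htrans a b p q hab hpq
    refine ⟨t c, t.injective.ne hac.symm, t.injective.ne hbc.symm, ?_⟩
    rw [← conj_swap_mul_swap]
    exact wordBall_mono (by omega)
      (mul_mem_wordBall (mul_mem_wordBall ht h) (inv_mem_wordBall hS ht))
  obtain ⟨c', h1, h2, hA⟩ := hconj x y hxy
  by_cases hc : c' = z
  · subst hc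
    exact wordBall_mono (by omega) hA
  obtain ⟨d, h3, h4, hB⟩ := hconj c' z hc
  have happ := swap_mul_swap_apply h3.symm h4.symm hc
  set A := swap x y * swap y c' with hAdef
  set B := swap c' z * swap z d with hBdef
  have hB' : B⁻¹ z = c' ∧ B⁻¹ d = z ∧ B⁻¹ c' = d := by
    simp only [Perm.inv_eq_iff_eq]
    exact ⟨happ.1.symm, happ.2.1.symm, happ.2.2.symm⟩
  have hfix : ∀ w, w ≠ c' → w ≠ z → w ≠ d → B⁻¹ w = w := fun w p q r => by
    rw [Perm.inv_eq_iff_eq, hBdef, swap_mul_swap_apply_of_ne p q r]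
  by_cases hdx : d = x
  · have e : (B⁻¹ * A * B⁻¹⁻¹)⁻¹ = swap x y * swap y z := by
      rw [hAdef, conj_swap_mul_swap, inv_swap_mul_swap, hB'.2.2, hfix y h2.symm hyz
        (fun h => hxy (hdx ▸ h.symm)), ← hdx, hB'.2.1]
    rw [← e]
    exact wordBall_mono (by omega) (inv_mem_wordBall hS (mul_mem_wordBall (mul_mem_wordBall
      (inv_mem_wordBall hS hB) hA) (inv_mem_wordBall hS (inv_mem_wordBall hS hB))))
  by_cases hdy : d = y
  · have e : (B⁻¹ * A * B⁻¹⁻¹)⁻¹ = swap x y * swap y z := by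
      rw [hAdef, conj_swap_mul_swap, inv_swap_mul_swap, hB'.2.2, hfix x h1.symm hxz
        (Ne.symm hdx), ← hdy, hB'.2.1, hdy]
      exact swap_mul_swap_rotate hxy.symm hxz.symm
    rw [← e]
    exact wordBall_mono (by omega) (inv_mem_wordBall hS (mul_mem_wordBall (mul_mem_wordBall
      (inv_mem_wordBall hS hB) hA) (inv_mem_wordBall hS (inv_mem_wordBall hS hB))))
  · have e : B * A * B⁻¹ = swap x y * swap y z := by
      rw [hAdef, conj_swap_mul_swap, happ.1, hBdef,
        swap_mul_swap_apply_of_ne h1.symm hxz (Ne.symm hdx),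
        swap_mul_swap_apply_of_ne h2.symm hyz (Ne.symm hdy)]
    rw [← e]
    exact wordBall_mono (by omega)
      (mul_mem_wordBall (mul_mem_wordBall hB hA) (inv_mem_wordBall hS hB))

end ThreeCycles

section Commutator

theorem perm_apply_inv_apply {α : Type*} (a : Perm α) (y : α) : a (a⁻¹ y) = y :=
  a.apply_symm_apply y

theorem perm_inv_apply_apply {α : Type*} (a : Perm α) (y : α) : a⁻¹ (a y) = y :=
  a.symm_apply_apply y

variable {n : ℕ}

theorem mem_of_commutator_apply_ne {a b : Perm (Fin n)} {y : Fin n}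
    (h : (a * b * a⁻¹ * b⁻¹) y ≠ y) :
    y ∈ a.support ∩ b.support ∨ a⁻¹ y ∈ a.support ∩ b.support ∨
      b⁻¹ y ∈ a.support ∩ b.support := by
  simp only [Finset.mem_inter, Perm.mem_support, Perm.mul_apply] at h ⊢
  by_contra! hc
  obtain ⟨h1, h2, h3⟩ := hc
  apply h
  by_cases hb : b y = y
  · rw [Perm.inv_eq_iff_eq.mpr hb.symm]
    by_cases ha : a y = y
    · rw [Perm.inv_eq_iff_eq.mpr ha.symm, hb, ha]
    · rw [h2 (by rw [perm_apply_inv_apply]; exact fun e => ha (by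
        conv_lhs => rw [e]
        exact perm_apply_inv_apply a y)), perm_apply_inv_apply]
  · have ha : a y = y := by_contra fun e => hb (h1 e)
    have h4 : a (b⁻¹ y) = b⁻¹ y := by
      by_contra e
      have := h3 e
      rw [perm_apply_inv_apply] at this
      exact hb (by conv_lhs => rw [this]
                   exact perm_apply_inv_apply b y)
    rw [Perm.inv_eq_iff_eq.mpr h4.symm, perm_apply_inv_apply, ha]

theorem card_support_commutator_le (a b : Perm (Fin n)) :
    (a * b * a⁻¹ * b⁻¹).support.card ≤ 3 * (a.support ∩ b.support).card := by
  set I := a.support ∩ b.support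
  have h : (a * b * a⁻¹ * b⁻¹).support ⊆ I ∪ (I.image a ∪ I.image b) := by
    intro y hy
    simp only [Finset.mem_union, Finset.mem_image]
    rcases mem_of_commutator_apply_ne (Perm.mem_support.mp hy) with h | h | h
    exacts [Or.inl h, Or.inr (Or.inl ⟨_, h, by simp⟩), Or.inr (Or.inr ⟨_, h, by simp⟩)]
  have h1 := Finset.card_le_card h
  have h2 := Finset.card_union_le I (I.image a ∪ I.image b)
  have h3 := Finset.card_union_le (I.image a) (I.image b)
  have h4 := Finset.card_image_le (s := I) (f := a)
  have h5 := Finset.card_image_le (s := I) (f := b)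
  omega

theorem commutator_eq_swap_mul_swap {a b : Perm (Fin n)} {y : Fin n}
    (h : a.support ∩ b.support = {y}) :
    y ≠ a y ∧ a y ≠ b y ∧ y ≠ b y ∧
      a * b * a⁻¹ * b⁻¹ = swap y (a y) * swap (a y) (b y) := by
  have hI : ∀ z, a z ≠ z → b z ≠ z → z = y := fun z h1 h2 => by
    have : z ∈ a.support ∩ b.support := by simp [h1, h2]
    rwa [h, Finset.mem_singleton] at this
  have hy : y ∈ a.support ∩ b.support := by simp [h]
  simp only [Finset.mem_inter, Perm.mem_support] at hy
  have e1 : b (a y) = a y := by_contra fun e => hy.1 (hI _ (a.injective.ne hy.1) e)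
  have e2 : a (b y) = b y := by_contra fun e => hy.2 (hI _ e (b.injective.ne hy.2))
  have hab : a y ≠ b y := fun e => hy.2 (b.injective (e ▸ e1))
  refine ⟨hy.1.symm, hab, hy.2.symm, ?_⟩
  obtain ⟨s1, s2, s3⟩ := swap_mul_swap_apply hy.2.symm hab hy.1.symm
  have e3 : b (a⁻¹ y) = a⁻¹ y := by
    by_contra e
    refine hy.1 ?_
    have := hI (a⁻¹ y) (fun e' => ?_) e
    · rw [Perm.inv_eq_iff_eq] at this
      exact this.symm
    · rw [perm_apply_inv_apply, eq_comm, Perm.inv_eq_iff_eq] at e'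
      exact hy.1 e'.symm
  have e4 : a (b⁻¹ y) = b⁻¹ y := by
    by_contra e
    refine hy.2 ?_
    have := hI (b⁻¹ y) e (fun e' => ?_)
    · rw [Perm.inv_eq_iff_eq] at this
      exact this.symm
    · rw [perm_apply_inv_apply, eq_comm, Perm.inv_eq_iff_eq] at e'
      exact hy.2 e'.symm
  ext z
  congr 1
  by_cases z1 : z = y
  · subst z1
    rw [s1, Perm.mul_apply, Perm.mul_apply, Perm.mul_apply, Perm.inv_eq_iff_eq.mpr e4.symm,
      perm_apply_inv_apply]
  by_cases z2 : z = a y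
  · subst z2
    rw [s2, Perm.mul_apply, Perm.mul_apply, Perm.mul_apply, Perm.inv_eq_iff_eq.mpr e1.symm,
      perm_inv_apply_apply, e2]
  by_cases z3 : z = b y
  · subst z3
    rw [s3, Perm.mul_apply, Perm.mul_apply, Perm.mul_apply, perm_inv_apply_apply, e3,
      perm_apply_inv_apply]
  rw [swap_mul_swap_apply_of_ne z1 z2 z3]
  by_contra e
  have := mem_of_commutator_apply_ne e
  rw [h] at this
  simp only [Finset.mem_singleton, Perm.inv_eq_iff_eq] at this
  tauto

end Commutator

section PairMixing

variable {n : ℕ}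

/-- `ν` is a probability measure supported on words of length at most `L₀`, moving every ordered
pair of distinct points to an almost uniformly distributed ordered pair of distinct points. -/
structure IsPairMixing (S : Set (Perm (Fin n))) (L₀ : ℕ) (ν : Perm (Fin n) → ℝ) : Prop where
  nonneg : ∀ x, 0 ≤ ν x
  sum_eq : ∑ x, ν x = 1
  mem : ∀ x, ν x ≠ 0 → x ∈ wordBall S L₀
  lower : ∀ p₁ p₂ q₁ q₂ : Fin n, p₁ ≠ p₂ → q₁ ≠ q₂ →
    0.9 / ((n : ℝ) * (n - 1)) ≤ ∑ x, if x p₁ = q₁ ∧ x p₂ = q₂ then ν x else 0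
  upper : ∀ p₁ p₂ q₁ q₂ : Fin n, p₁ ≠ p₂ → q₁ ≠ q₂ →
    ∑ x, (if x p₁ = q₁ ∧ x p₂ = q₂ then ν x else 0) ≤ 1.1 / ((n : ℝ) * (n - 1))

variable {S : Set (Perm (Fin n))} {L₀ : ℕ} {ν : Perm (Fin n) → ℝ}

theorem IsPairMixing.exists_of_pos (hν : IsPairMixing S L₀ ν) {F : Perm (Fin n) → ℝ}
    (h : 0 < ∑ x, ν x * F x) : ∃ x ∈ wordBall S L₀, 0 < F x := by
  obtain ⟨x, -, hx⟩ := Finset.exists_lt_of_sum_lt (f := fun _ => (0 : ℝ))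
    (g := fun x => ν x * F x) (s := Finset.univ) (by simpa using h)
  refine ⟨x, hν.mem x fun e => by simp [e] at hx, ?_⟩
  by_contra! h0
  exact absurd hx (not_lt.mpr (mul_nonpos_of_nonneg_of_nonpos (hν.nonneg x) h0))

theorem IsPairMixing.exists_apply (hν : IsPairMixing S L₀ ν) (hn : 2 ≤ n) {p₁ p₂ q₁ q₂ : Fin n}
    (hp : p₁ ≠ p₂) (hq : q₁ ≠ q₂) : ∃ x ∈ wordBall S L₀, x p₁ = q₁ ∧ x p₂ = q₂ := by
  have hn' : (2 : ℝ) ≤ n := by exact_mod_cast hn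
  have h0 : (0 : ℝ) < 0.9 / ((n : ℝ) * (n - 1)) := by
    apply div_pos (by norm_num)
    nlinarith
  obtain ⟨x, hx, h⟩ := hν.exists_of_pos (F := fun x => if x p₁ = q₁ ∧ x p₂ = q₂ then 1 else 0)
    (by simpa using h0.trans_le (hν.lower p₁ p₂ q₁ q₂ hp hq))
  refine ⟨x, hx, by_contra fun e => ?_⟩
  rw [if_neg e] at h
  exact lt_irrefl _ h

theorem IsPairMixing.sum_apply (hν : IsPairMixing S L₀ ν) (hn : 2 ≤ n) (p q : Fin n) :
    0.9 / (n : ℝ) ≤ ∑ x, (if x p = q then ν x else 0) ∧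
      ∑ x, (if x p = q then ν x else 0) ≤ 1.1 / (n : ℝ) := by
  have hn' : (2 : ℝ) ≤ n := by exact_mod_cast hn
  have : Nontrivial (Fin n) := Fin.nontrivial_iff_two_le.mpr hn
  obtain ⟨p', hp'⟩ := exists_ne p
  have h1 : ∑ x, (if x p = q then ν x else 0) =
      ∑ q' ∈ Finset.univ.erase q, ∑ x, if x p = q ∧ x p' = q' then ν x else 0 := by
    rw [Finset.sum_comm]
    refine Finset.sum_congr rfl fun x _ => ?_
    by_cases h : x p = q
    · simp only [h, true_and, if_true]
      rw [Finset.sum_ite_eq, if_pos]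
      simp only [Finset.mem_erase, Finset.mem_univ, and_true]
      exact fun e => hp' (x.injective (e.trans h.symm))
    · simp [h]
  have hc : ((Finset.univ.erase q).card : ℝ) = n - 1 := by
    rw [Finset.card_erase_of_mem (Finset.mem_univ _), Finset.card_fin]
    push_cast [Nat.cast_sub (by omega : 1 ≤ n)]
    ring
  have h2 : ∀ c : ℝ, ∑ _q' ∈ Finset.univ.erase q, c / ((n : ℝ) * (n - 1)) = c / n := fun c => by
    rw [Finset.sum_const, nsmul_eq_mul, hc]
    have : (n : ℝ) - 1 ≠ 0 := by linarith
    field_simp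
  rw [h1, ← h2, ← h2]
  constructor
  · exact Finset.sum_le_sum fun q' hq' => hν.lower _ _ _ _ hp'.symm (Finset.ne_of_mem_erase hq').symm
  · exact Finset.sum_le_sum fun q' hq' => hν.upper _ _ _ _ hp'.symm (Finset.ne_of_mem_erase hq').symm

/-- The number of points of `A` mapped into `A` by `x`. -/
def returnCount (A : Finset (Fin n)) (x : Perm (Fin n)) : ℝ :=
  ∑ α ∈ A, ∑ β ∈ A, if x α = β then 1 else 0

theorem returnCount_eq (A : Finset (Fin n)) (x : Perm (Fin n)) :
    returnCount A x = ((A ∩ A.map x.toEmbedding).card : ℝ) := by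
  have h : A ∩ A.map x.toEmbedding = (A.filter fun α => x α ∈ A).map x.toEmbedding := by
    ext y
    simp only [Finset.mem_inter, Finset.mem_map, Finset.mem_filter]
    constructor
    · rintro ⟨h1, z, h2, rfl⟩
      exact ⟨z, ⟨h2, h1⟩, rfl⟩
    · rintro ⟨z, ⟨h2, h1⟩, rfl⟩
      exact ⟨h1, z, h2, rfl⟩
  rw [h, Finset.card_map, returnCount, Finset.card_filter]
  push_cast
  exact Finset.sum_congr rfl fun α _ => by rw [Finset.sum_ite_eq]

theorem IsPairMixing.sum_returnCount (hν : IsPairMixing S L₀ ν) (hn : 2 ≤ n)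
    (A : Finset (Fin n)) :
    0.9 * ((A.card : ℝ) ^ 2 / n) ≤ ∑ x, ν x * returnCount A x ∧
      ∑ x, ν x * returnCount A x ≤ 1.1 * ((A.card : ℝ) ^ 2 / n) := by
  have h1 : ∑ x, ν x * returnCount A x =
      ∑ α ∈ A, ∑ β ∈ A, ∑ x, if x α = β then ν x else 0 := by
    simp only [returnCount, Finset.mul_sum, mul_ite, mul_one, mul_zero]
    rw [Finset.sum_comm]
    exact Finset.sum_congr rfl fun _ _ => Finset.sum_comm
  have h2 : ∀ c : ℝ, c * ((A.card : ℝ) ^ 2 / n) = ∑ _α ∈ A, ∑ _β ∈ A, c / n := fun c => by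
    rw [Finset.sum_const, Finset.sum_const, nsmul_eq_mul, nsmul_eq_mul]
    ring
  rw [h1, h2, h2]
  exact ⟨Finset.sum_le_sum fun α _ => Finset.sum_le_sum fun β _ => (hν.sum_apply hn α β).1,
    Finset.sum_le_sum fun α _ => Finset.sum_le_sum fun β _ => (hν.sum_apply hn α β).2⟩

theorem returnCount_sq_sub (A : Finset (Fin n)) (x : Perm (Fin n)) :
    returnCount A x ^ 2 - returnCount A x =
      ∑ p ∈ A.offDiag, ∑ q ∈ A.offDiag, if x p.1 = q.1 ∧ x p.2 = q.2 then 1 else 0 := by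
  have h1 : returnCount A x = ((A.filter fun α => x α ∈ A).card : ℝ) := by
    rw [returnCount, Finset.card_filter]
    push_cast
    exact Finset.sum_congr rfl fun α _ => by rw [Finset.sum_ite_eq]
  have h2 : ∀ p ∈ A.offDiag, (∑ q ∈ A.offDiag, if x p.1 = q.1 ∧ x p.2 = q.2 then (1 : ℝ) else 0) =
      if x p.1 ∈ A ∧ x p.2 ∈ A then 1 else 0 := by
    intro p hp
    have : ∀ q : Fin n × Fin n, (x p.1 = q.1 ∧ x p.2 = q.2) ↔ (x p.1, x p.2) = q := fun q => by
      rw [Prod.ext_iff]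
    simp only [this]
    rw [Finset.sum_ite_eq]
    refine if_congr ?_ rfl rfl
    rw [Finset.mem_offDiag] at hp ⊢
    have := x.injective.ne hp.2.2
    tauto
  rw [Finset.sum_congr rfl h2, ← Finset.sum_filter, Finset.sum_const, nsmul_eq_mul, mul_one, h1]
  have h3 : (A.offDiag.filter fun p => x p.1 ∈ A ∧ x p.2 ∈ A) =
      (A.filter fun α => x α ∈ A).offDiag := by
    ext p
    simp only [Finset.mem_filter, Finset.mem_offDiag]
    tauto
  rw [h3, Finset.offDiag_card, Nat.cast_sub (Nat.le_mul_self _)]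
  push_cast
  ring

theorem IsPairMixing.sum_returnCount_sq_le (hν : IsPairMixing S L₀ ν) (hn : 2 ≤ n)
    (A : Finset (Fin n)) :
    ∑ x, ν x * (returnCount A x ^ 2 - returnCount A x) ≤ 1.1 * ((A.card : ℝ) ^ 2 / n) ^ 2 := by
  have hn' : (2 : ℝ) ≤ n := by exact_mod_cast hn
  have h1 : ∑ x, ν x * (returnCount A x ^ 2 - returnCount A x) =
      ∑ p ∈ A.offDiag, ∑ q ∈ A.offDiag, ∑ x, if x p.1 = q.1 ∧ x p.2 = q.2 then ν x else 0 := by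
    simp only [returnCount_sq_sub, Finset.mul_sum, mul_ite, mul_one, mul_zero]
    rw [Finset.sum_comm]
    exact Finset.sum_congr rfl fun _ _ => Finset.sum_comm
  have h2 : ∑ p ∈ A.offDiag, ∑ q ∈ A.offDiag, (∑ x, if x p.1 = q.1 ∧ x p.2 = q.2 then ν x else 0)
      ≤ ∑ _p ∈ A.offDiag, ∑ _q ∈ A.offDiag, 1.1 / ((n : ℝ) * (n - 1)) :=
    Finset.sum_le_sum fun p hp => Finset.sum_le_sum fun q hq =>
      hν.upper _ _ _ _ (Finset.mem_offDiag.mp hp).2.2 (Finset.mem_offDiag.mp hq).2.2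
  rw [h1]
  refine h2.trans ?_
  have hs : (A.card : ℝ) ≤ n := by exact_mod_cast (Finset.card_le_univ A).trans_eq (by simp)
  rw [Finset.sum_const, Finset.sum_const, nsmul_eq_mul, nsmul_eq_mul, Finset.offDiag_card,
    Nat.cast_sub (Nat.le_mul_self _)]
  push_cast
  rcases Nat.eq_zero_or_pos A.card with h0 | h0
  · simp [h0]
  have hs1 : (1 : ℝ) ≤ A.card := by exact_mod_cast h0
  generalize (A.card : ℝ) = s at *
  generalize (n : ℝ) = m at *
  have h4 : (s - 1) / (m - 1) ≤ s / m := by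
    rw [div_le_div_iff₀ (by linarith) (by linarith)]
    nlinarith
  have h5 : (s * s - s) * ((s * s - s) * (1.1 / (m * (m - 1)))) =
      1.1 * (s ^ 2 / m) * ((s - 1) * ((s - 1) / (m - 1))) := by
    have : m - 1 ≠ 0 := by linarith
    field_simp
  rw [h5]
  have h6 : (s - 1) * ((s - 1) / (m - 1)) ≤ s * (s / m) :=
    mul_le_mul (by linarith) h4 (div_nonneg (by linarith) (by linarith)) (by linarith)
  calc _ ≤ 1.1 * (s ^ 2 / m) * (s * (s / m)) := by gcongr
    _ = _ := by ring

/-- The number of points of `supp w` returning to it under `x`, but whose `w`-image leaves it. -/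
def exitCount (w x : Perm (Fin n)) : ℝ :=
  ∑ α ∈ w.support, ∑ q ∈ w.support ×ˢ w.supportᶜ, if x α = q.1 ∧ x (w α) = q.2 then 1 else 0

theorem exitCount_eq (w x : Perm (Fin n)) : exitCount w x =
    ((w.support.filter fun α => x α ∈ w.support ∧ x (w α) ∉ w.support).card : ℝ) := by
  rw [exitCount, Finset.card_filter]
  push_cast
  refine Finset.sum_congr rfl fun α _ => ?_
  have : ∀ q : Fin n × Fin n, (x α = q.1 ∧ x (w α) = q.2) ↔ (x α, x (w α)) = q := fun q => by
    rw [Prod.ext_iff]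
  simp only [this]
  rw [Finset.sum_ite_eq]
  simp [Finset.mem_product]

theorem exitCount_le (w x : Perm (Fin n)) : exitCount w x ≤ returnCount w.support x := by
  have h1 : returnCount w.support x = ((w.support.filter fun α => x α ∈ w.support).card : ℝ) := by
    rw [returnCount, Finset.card_filter]
    push_cast
    exact Finset.sum_congr rfl fun α _ => by rw [Finset.sum_ite_eq]
  rw [exitCount_eq, h1]
  exact_mod_cast Finset.card_le_card fun y => by simp only [Finset.mem_filter]; tauto

theorem IsPairMixing.le_sum_exitCount (hν : IsPairMixing S L₀ ν) (hn : 2 ≤ n)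
    (w : Perm (Fin n)) (hw : 24 * w.support.card ≤ n) :
    0.8625 * ((w.support.card : ℝ) ^ 2 / n) ≤ ∑ x, ν x * exitCount w x := by
  have hn' : (2 : ℝ) ≤ n := by exact_mod_cast hn
  have h1 : ∑ x, ν x * exitCount w x = ∑ α ∈ w.support, ∑ q ∈ w.support ×ˢ w.supportᶜ,
      ∑ x, if x α = q.1 ∧ x (w α) = q.2 then ν x else 0 := by
    simp only [exitCount, Finset.mul_sum, mul_ite, mul_one, mul_zero]
    rw [Finset.sum_comm]
    exact Finset.sum_congr rfl fun _ _ => Finset.sum_comm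
  have h2 : ∑ _α ∈ w.support, ∑ _q ∈ w.support ×ˢ w.supportᶜ, 0.9 / ((n : ℝ) * (n - 1)) ≤
      ∑ α ∈ w.support, ∑ q ∈ w.support ×ˢ w.supportᶜ,
        ∑ x, if x α = q.1 ∧ x (w α) = q.2 then ν x else 0 := by
    refine Finset.sum_le_sum fun α hα => Finset.sum_le_sum fun q hq =>
      hν.lower _ _ _ _ (Perm.mem_support.mp hα).symm fun e => ?_
    rw [Finset.mem_product, Finset.mem_compl] at hq
    exact hq.2 (e ▸ hq.1)
  rw [h1]
  refine le_trans ?_ h2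
  have hs : 24 * (w.support.card : ℝ) ≤ n := by exact_mod_cast hw
  rw [Finset.sum_const, Finset.sum_const, nsmul_eq_mul, nsmul_eq_mul, Finset.card_product,
    Finset.card_compl, Fintype.card_fin, Nat.cast_mul, Nat.cast_sub (by omega)]
  have hs1 : (0 : ℝ) ≤ w.support.card := by positivity
  generalize (w.support.card : ℝ) = s at *
  generalize (n : ℝ) = m at *
  have h3 : 23 / 24 ≤ (m - s) / (m - 1) := by
    rw [div_le_div_iff₀ (by norm_num) (by linarith)]
    linarith
  have h5 : s * (s * (m - s) * (0.9 / (m * (m - 1)))) =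
      0.9 * (s ^ 2 / m) * ((m - s) / (m - 1)) := by
    have : m - 1 ≠ 0 := by linarith
    field_simp
  rw [h5]
  have h6 : 0 ≤ s ^ 2 / m := by positivity
  nlinarith

end PairMixing

section ThreeCycleSearch

variable {n : ℕ} {S : Set (Perm (Fin n))} {L₀ : ℕ} {ν : Perm (Fin n) → ℝ}

theorem returnCount_support_eq (w x : Perm (Fin n)) :
    returnCount w.support x = ((w.support ∩ (x * w * x⁻¹).support).card : ℝ) := by
  rw [returnCount_eq, Perm.support_conj]

/-- A permutation of small support has a conjugate by a short element such that the commutator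
is a `3`-cycle. -/
theorem IsPairMixing.exists_commutator_three_cycle (hν : IsPairMixing S L₀ ν) (hn : 2 ≤ n)
    {w : Perm (Fin n)} (hw : w ≠ 1) (hs : 2 * w.support.card ^ 2 < n) :
    ∃ x ∈ wordBall S L₀, ∃ y, w.support ∩ (x * w * x⁻¹).support = {y} := by
  have hs0 : 0 < w.support.card := by
    rw [Finset.card_pos, Finset.nonempty_iff_ne_empty, Ne, Perm.support_eq_empty_iff]
    exact hw
  have hn' : (0 : ℝ) < n := by exact_mod_cast (by omega : 0 < n)
  set r := (w.support.card : ℝ) ^ 2 / n with hr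
  have hr0 : 0 < r := by positivity
  have hr1 : r < 1 / 2 := by
    rw [hr, div_lt_div_iff₀ hn' (by norm_num)]
    have : (2 * w.support.card ^ 2 : ℝ) < n := by exact_mod_cast hs
    linarith
  have h1 := (hν.sum_returnCount hn w.support).1
  have h2 := hν.sum_returnCount_sq_le hn w.support
  obtain ⟨x, hx, h⟩ := hν.exists_of_pos
    (F := fun x => returnCount w.support x - (returnCount w.support x ^ 2 - returnCount w.support x))
    (by
      simp only [mul_sub (ν _) (returnCount _ _) (_ - _), Finset.sum_sub_distrib]
      rw [← hr] at h1 h2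
      nlinarith)
  refine ⟨x, hx, Finset.card_eq_one.mp ?_⟩
  rw [returnCount_support_eq] at h
  generalize (w.support ∩ (x * w * x⁻¹).support).card = m at h
  have h3 : (0 : ℝ) < m * (2 - m) := by linarith
  rcases Nat.lt_or_ge m 2 with hm | hm
  · interval_cases m
    · simp at h3
    · rfl
  · have : (2 : ℝ) ≤ m := by exact_mod_cast hm
    nlinarith

/-- A permutation whose support is not too large has a conjugate by a short element such that the
commutator is nontrivial with smaller support. -/
theorem IsPairMixing.exists_commutator_shrink (hν : IsPairMixing S L₀ ν) (hn : 2 ≤ n)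
    {w : Perm (Fin n)} (hw : 24 * w.support.card ≤ n) (hs : n ≤ 2 * w.support.card ^ 2) :
    ∃ x ∈ wordBall S L₀, w * (x * w * x⁻¹) * w⁻¹ * (x * w * x⁻¹)⁻¹ ≠ 1 ∧
      ((w * (x * w * x⁻¹) * w⁻¹ * (x * w * x⁻¹)⁻¹).support.card : ℝ) ≤
        12 * ((w.support.card : ℝ) ^ 2 / n) := by
  have hn' : (0 : ℝ) < n := by exact_mod_cast (by omega : 0 < n)
  set r := (w.support.card : ℝ) ^ 2 / n with hr
  have hr1 : 1 / 2 ≤ r := by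
    rw [hr, div_le_div_iff₀ (by norm_num) hn']
    have : (n : ℝ) ≤ (2 * w.support.card ^ 2 : ℝ) := by exact_mod_cast hs
    linarith
  have h1 := (hν.sum_returnCount hn w.support).2
  have h2 := hν.sum_returnCount_sq_le hn w.support
  have h3 := hν.le_sum_exitCount hn w hw
  rw [← hr] at h1 h2 h3
  have h4 : ∑ x, ν x * returnCount w.support x ^ 2 ≤ 3.3 * r ^ 2 := by
    have : ∑ x, ν x * returnCount w.support x ^ 2 = ∑ x, ν x * returnCount w.support x +
        ∑ x, ν x * (returnCount w.support x ^ 2 - returnCount w.support x) := by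
      rw [← Finset.sum_add_distrib]
      exact Finset.sum_congr rfl fun x _ => by ring
    rw [this]
    nlinarith
  obtain ⟨x, hx, h⟩ := hν.exists_of_pos
    (F := fun x => exitCount w x - returnCount w.support x ^ 2 / (4 * r)) (by
      have e : ∑ x, ν x * (exitCount w x - returnCount w.support x ^ 2 / (4 * r)) =
          ∑ x, ν x * exitCount w x - (∑ x, ν x * returnCount w.support x ^ 2) / (4 * r) := by
        rw [Finset.sum_div, ← Finset.sum_sub_distrib]
        exact Finset.sum_congr rfl fun x _ => by ring
      rw [e]
      have : (∑ x, ν x * returnCount w.support x ^ 2) / (4 * r) ≤ 0.825 * r := by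
        rw [div_le_iff₀ (by linarith)]
        nlinarith
      linarith)
  refine ⟨x, hx, ?_, ?_⟩
  · have h0 : 0 < exitCount w x := lt_of_le_of_lt (by positivity) (sub_pos.mp h)
    rw [exitCount_eq] at h0
    obtain ⟨α, hα⟩ := Finset.card_pos.mp (Nat.cast_pos.mp h0)
    simp only [Finset.mem_filter, Perm.mem_support, ne_eq, not_not] at hα
    intro e
    have e' : w * (x * w * x⁻¹) = (x * w * x⁻¹) * w := by
      rw [mul_inv_eq_one, mul_inv_eq_iff_eq_mul] at e
      exact e
    have e2 := congrArg (fun t : Perm (Fin n) => t (x α)) e'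
    simp only [Perm.mul_apply, perm_inv_apply_apply] at e2
    rw [hα.2.2] at e2
    have e3 := x.injective e2
    have e4 := w.injective e3
    rw [eq_comm, Perm.inv_eq_iff_eq] at e4
    exact hα.2.1 e4
  · have hI := card_support_commutator_le w (x * w * x⁻¹)
    have hI' : ((w * (x * w * x⁻¹) * w⁻¹ * (x * w * x⁻¹)⁻¹).support.card : ℝ) ≤
        3 * returnCount w.support x := by
      rw [returnCount_support_eq]
      exact_mod_cast hI
    have h5 := exitCount_le w x
    have h6 : returnCount w.support x ^ 2 / (4 * r) < returnCount w.support x := by linarith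
    rw [div_lt_iff₀ (by linarith)] at h6
    have h7 : 0 ≤ returnCount w.support x := by rw [returnCount_eq]; positivity
    have h8 : returnCount w.support x ≤ 4 * r := by
      by_contra! h9
      nlinarith
    linarith

theorem commutator_mem_wordBall (hS : ∀ s ∈ S, s⁻¹ ∈ S) {L : ℕ} {w x : Perm (Fin n)}
    (hw : w ∈ wordBall S L) (hx : x ∈ wordBall S L₀) :
    w * (x * w * x⁻¹) * w⁻¹ * (x * w * x⁻¹)⁻¹ ∈ wordBall S (4 * (L + L₀)) := by
  have hx' := mul_mem_wordBall (mul_mem_wordBall hx hw) (inv_mem_wordBall hS hx)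
  exact wordBall_mono (by omega) (mul_mem_wordBall (mul_mem_wordBall (mul_mem_wordBall hw hx')
    (inv_mem_wordBall hS hw)) (inv_mem_wordBall hS hx'))

theorem IsPairMixing.exists_three_cycle (hν : IsPairMixing S L₀ ν) (hS : ∀ s ∈ S, s⁻¹ ∈ S)
    (hn : 2 ≤ n) (J : ℕ) {L : ℕ} {w : Perm (Fin n)} (hw : w ≠ 1) (hwL : w ∈ wordBall S L)
    (hw24 : 24 * w.support.card ≤ n)
    (hJ : (12 * (w.support.card : ℝ) / n) ^ (2 ^ (J + 1)) < 72 / n) :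
    ∃ a b c : Fin n, a ≠ b ∧ b ≠ c ∧ a ≠ c ∧
      swap a b * swap b c ∈ wordBall S (4 ^ (J + 1) * (L + 2 * L₀)) := by
  have hn' : (0 : ℝ) < n := by exact_mod_cast (by omega : 0 < n)
  have base : ∀ (J L : ℕ) (w : Perm (Fin n)), w ≠ 1 → w ∈ wordBall S L →
      2 * w.support.card ^ 2 < n → ∃ a b c : Fin n, a ≠ b ∧ b ≠ c ∧ a ≠ c ∧
      swap a b * swap b c ∈ wordBall S (4 ^ (J + 1) * (L + 2 * L₀)) := by
    intro J L w hw hwL hs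
    obtain ⟨x, hx, y, hy⟩ := hν.exists_commutator_three_cycle hn hw hs
    obtain ⟨h1, h2, h3, h4⟩ := commutator_eq_swap_mul_swap hy
    refine ⟨_, _, _, h1, h2, h3, ?_⟩
    rw [← h4]
    refine wordBall_mono ?_ (commutator_mem_wordBall hS hwL hx)
    exact Nat.mul_le_mul (by rw [pow_succ]; have := Nat.one_le_pow J 4 (by norm_num); omega)
      (by omega)
  induction J generalizing L w with
  | zero =>
    refine base 0 L w hw hwL ?_
    have h : (12 * (w.support.card : ℝ) / n) ^ 2 < 72 / n := by simpa using hJ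
    rw [div_pow, div_lt_div_iff₀ (by positivity) hn'] at h
    have h2 : (2 * w.support.card ^ 2 : ℝ) < n := by
      by_contra! h3
      nlinarith [mul_le_mul_of_nonneg_left h3 hn'.le]
    exact_mod_cast h2
  | succ J ih =>
    rcases Nat.lt_or_ge (2 * w.support.card ^ 2) n with hs | hs
    · exact base _ L w hw hwL hs
    obtain ⟨x, hx, h1, h2⟩ := hν.exists_commutator_shrink hn hw24 hs
    have h24 : 24 * (w.support.card : ℝ) ≤ n := by exact_mod_cast hw24
    obtain ⟨a, b, c, hab, hbc, hac, h⟩ := ih (L := 4 * (L + L₀)) h1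
      (commutator_mem_wordBall hS hwL hx) (by
        have : (w.support.card : ℝ) ^ 2 / n ≤ w.support.card / 24 := by
          rw [div_le_div_iff₀ hn' (by norm_num)]
          nlinarith [Nat.cast_nonneg (α := ℝ) w.support.card]
        have h3 : 24 * ((w * (x * w * x⁻¹) * w⁻¹ * (x * w * x⁻¹)⁻¹).support.card : ℝ) ≤ n := by
          linarith
        exact_mod_cast h3) (by
        refine lt_of_le_of_lt ?_ hJ
        rw [pow_succ 2 (J + 1), mul_comm (2 ^ (J + 1)) 2, pow_mul _ 2]
        refine pow_le_pow_left₀ (by positivity) ?_ _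
        rw [div_pow, div_le_div_iff₀ hn' (by positivity)]
        have h4 := mul_le_mul_of_nonneg_right h2 (by positivity : 0 ≤ 12 * (n : ℝ) ^ 2)
        have h5 : 12 * ((w.support.card : ℝ) ^ 2 / n) * (12 * n ^ 2) =
            (12 * (w.support.card : ℝ)) ^ 2 * n := by
          field_simp
        linarith)
    refine ⟨a, b, c, hab, hbc, hac, wordBall_mono ?_ h⟩
    rw [pow_succ 4 (J + 1), mul_assoc]
    exact Nat.mul_le_mul_left _ (by omega)

/-- All `3`-cycles are short words, given a short word of small support and a pair mixing
measure. -/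
theorem IsPairMixing.all_three_cycles (hν : IsPairMixing S L₀ ν) (hS : ∀ s ∈ S, s⁻¹ ∈ S)
    (hn : 2 ≤ n) (J : ℕ) {L : ℕ} {w : Perm (Fin n)} (hw : w ≠ 1) (hwL : w ∈ wordBall S L)
    (hw24 : 24 * w.support.card ≤ n) (hJ : n < 2 ^ 2 ^ (J + 1)) {x y z : Fin n}
    (hxy : x ≠ y) (hyz : y ≠ z) (hxz : x ≠ z) :
    swap x y * swap y z ∈ wordBall S (12 * 4 ^ (J + 1) * (L + 2 * L₀)) := by
  have hn' : (0 : ℝ) < n := by exact_mod_cast (by omega : 0 < n)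
  obtain ⟨a, b, c, hab, hbc, hac, h⟩ := hν.exists_three_cycle hS hn J hw hwL hw24 (by
    have h24 : 24 * (w.support.card : ℝ) ≤ n := by exact_mod_cast hw24
    have h1 : 12 * (w.support.card : ℝ) / n ≤ 1 / 2 := by
      rw [div_le_div_iff₀ hn' (by norm_num)]
      linarith
    have h2 := pow_le_pow_left₀ (by positivity) h1 (2 ^ (J + 1))
    refine h2.trans_lt ?_
    have h3 : (n : ℝ) < 2 ^ 2 ^ (J + 1) := by exact_mod_cast hJ
    rw [one_div, inv_pow, ← one_div, div_lt_div_iff₀ (by positivity) hn']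
    have : (0 : ℝ) < 2 ^ 2 ^ (J + 1) := by positivity
    linarith)
  refine wordBall_mono ?_ (swap_mul_swap_mem_wordBall hS
    (fun p₁ p₂ q₁ q₂ hp hq => hν.exists_apply hn hp hq) hab hbc hac h hxy hyz hxz)
  have := Nat.one_le_pow (J + 1) 4 (by norm_num)
  nlinarith [Nat.zero_le (4 ^ (J + 1) * L), mul_le_mul_of_nonneg_right this (Nat.zero_le L₀)]

end ThreeCycleSearch

section Exposure

variable {n : ℕ}

/-- The pairs of permutations (indexed by `Bool`) agreeing with `f₀` on the edges in `E`. -/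
noncomputable def cylinder (f₀ : Bool → Perm (Fin n)) (E : Finset (Bool × Fin n)) :
    Finset (Bool → Perm (Fin n)) :=
  Finset.univ.filter fun f => ∀ e ∈ E, f e.1 e.2 = f₀ e.1 e.2

theorem mem_cylinder {f₀ f : Bool → Perm (Fin n)} {E : Finset (Bool × Fin n)} :
    f ∈ cylinder f₀ E ↔ ∀ e ∈ E, f e.1 e.2 = f₀ e.1 e.2 := by
  simp [cylinder]

theorem card_cylinder_filter_le (f₀ : Bool → Perm (Fin n)) {E : Finset (Bool × Fin n)}
    {c : Bool} {v : Fin n} (hcv : (c, v) ∉ E) (z : Fin n) :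
    ((cylinder f₀ E).filter fun f => f c v = z).card * (n - E.card) ≤ (cylinder f₀ E).card := by
  set Z := (E.image fun e => f₀ e.1 e.2)ᶜ
  have hZ : n - E.card ≤ Z.card := by
    rw [Finset.card_compl, Fintype.card_fin]
    exact Nat.sub_le_sub_left Finset.card_image_le _
  refine (Nat.mul_le_mul_left _ hZ).trans ?_
  rw [← Finset.card_product]
  have hupd : ∀ (f : Bool → Perm (Fin n)) (z' : Fin n), f c v = z →
      Function.update f c (swap z z' * f c) c v = z' := fun f z' h => by
    rw [Function.update_self, Perm.mul_apply, h, swap_apply_left]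
  refine Finset.card_le_card_of_injOn
    (fun p => Function.update p.1 c (swap z p.2 * p.1 c)) ?_ ?_
  · rintro ⟨f, z'⟩ hp
    simp only [Finset.coe_product, Set.mem_prod, Finset.mem_coe, Finset.mem_filter,
      mem_cylinder] at hp
    simp only [Finset.mem_coe, mem_cylinder]
    rintro ⟨d, u⟩ he
    have hz : f₀ d u ≠ z' := by
      have := hp.2
      simp only [Z, Finset.mem_compl, Finset.mem_image, not_exists, not_and] at this
      exact this _ he
    by_cases hdc : d = c
    · subst hdc
      have h1 := hp.1.1 _ he
      simp only at h1 ⊢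
      rw [Function.update_self, Perm.mul_apply, h1, swap_apply_of_ne_of_ne _ hz]
      rw [← h1, ← hp.1.2]
      exact (f d).injective.ne fun e => hcv (e ▸ he)
    · simp only [Function.update_of_ne hdc]
      exact hp.1.1 _ he
  · rintro ⟨f, z₁⟩ hp ⟨f', z₂⟩ hp' h
    simp only [Finset.coe_product, Set.mem_prod, Finset.mem_coe, Finset.mem_filter] at hp hp' h
    have hz : z₁ = z₂ := by
      rw [← hupd f z₁ hp.1.2, ← hupd f' z₂ hp'.1.2, h]
    subst hz
    refine Prod.ext (funext fun d => ?_) rfl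
    have hd := congrFun h d
    by_cases hdc : d = c
    · subst hdc
      simpa using hd
    · simpa [Function.update_of_ne hdc] using hd

/-- One step of an exploration: either follow a letter from the current vertex, recording the
edge used and the vertex reached, or jump to a given vertex. -/
def explore (f : Bool → Perm (Fin n)) (s : Finset (Bool × Fin n) × Finset (Fin n) × Fin n) :
    Bool ⊕ Fin n → Finset (Bool × Fin n) × Finset (Fin n) × Fin n
  | Sum.inl c => (insert (c, s.2.2) s.1, insert (f c s.2.2) s.2.1, f c s.2.2)
  | Sum.inr v => (s.1, s.2.1, v)

/-- The explored edges exceed the explored vertices by `m` more than initially. -/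
def ManyCollisions (l : List (Bool ⊕ Fin n)) (s : Finset (Bool × Fin n) × Finset (Fin n) × Fin n)
    (m : ℕ) (f : Bool → Perm (Fin n)) : Prop :=
  s.1.card + (l.foldl (explore f) s).2.1.card + m ≤ (l.foldl (explore f) s).1.card + s.2.1.card

theorem card_eq_sum_card_apply_eq (F : Finset (Bool → Perm (Fin n))) (c : Bool) (u : Fin n) :
    (F.card : ℝ) = ∑ z, ((F.filter fun f => f c u = z).card : ℝ) := by
  exact_mod_cast Finset.card_eq_sum_card_fiberwise (f := fun f : Bool → Perm (Fin n) => f c u)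
    (t := Finset.univ) (fun _ _ => Finset.mem_coe.mpr (Finset.mem_univ _))

theorem card_manyCollisions_le {B D : ℝ} (hD : 0 < D) (hB : 0 ≤ B) (l : List (Bool ⊕ Fin n)) :
    ∀ (s : Finset (Bool × Fin n) × Finset (Fin n) × Fin n) (m : ℕ) (f₀ : Bool → Perm (Fin n)),
      (s.2.1.card : ℝ) + l.length ≤ B → D ≤ n - s.1.card - l.length →
      (((cylinder f₀ s.1).filter (ManyCollisions l s m)).card : ℝ) ≤
        l.length.choose m * (B / D) ^ m * (cylinder f₀ s.1).card := by
  induction l with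
  | nil =>
    rintro s m f₀ - -
    rcases m with _ | m
    · simpa using Finset.card_filter_le _ _
    · rw [Finset.filter_false_of_mem]
      · simp
      · intro f _
        simp [ManyCollisions]
  | cons i l ih =>
    rintro ⟨E, V, u⟩ m f₀ hsB hsD
    simp only [List.length_cons, Nat.cast_add, Nat.cast_one] at hsB hsD ih ⊢
    have hchoose : ((l.length.choose m : ℕ) : ℝ) ≤ ((l.length + 1).choose m : ℕ) := by
      exact_mod_cast Nat.choose_le_choose m (Nat.le_succ _)
    have hmono : ((l.length.choose m : ℕ) : ℝ) * (B / D) ^ m * (cylinder f₀ E).card ≤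
        ((l.length + 1).choose m : ℕ) * (B / D) ^ m * (cylinder f₀ E).card := by gcongr
    rcases i with c | v
    swap
    · refine le_trans ?_ ((ih (E, V, v) m f₀ (by simp only; linarith) (by simp only; linarith)).trans
        hmono)
      exact le_of_eq rfl
    by_cases hcu : (c, u) ∈ E
    · set s' : Finset (Bool × Fin n) × Finset (Fin n) × Fin n := (E, insert (f₀ c u) V, f₀ c u)
      have hV : ((insert (f₀ c u) V).card : ℝ) ≤ V.card + 1 := by
        exact_mod_cast Finset.card_insert_le _ _
      refine le_trans ?_ ((ih s' m f₀ (by simp only [s']; linarith)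
        (by simp only [s']; linarith)).trans hmono)
      refine Nat.cast_le.mpr (Finset.card_le_card fun f hf => ?_)
      rw [Finset.mem_filter] at hf ⊢
      refine ⟨hf.1, ?_⟩
      have h1 : f c u = f₀ c u := mem_cylinder.mp hf.1 _ hcu
      have h2 := hf.2
      simp only [ManyCollisions, List.foldl_cons, explore, h1, Finset.insert_eq_of_mem hcu]
        at h2 ⊢
      have := Finset.card_le_card (Finset.subset_insert (f₀ c u) V)
      simp only [s']
      omega
    rcases m with _ | m
    · simpa using Finset.card_filter_le _ _
    set Cz : Fin n → Finset (Bool → Perm (Fin n)) :=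
      fun z => (cylinder f₀ E).filter fun f => f c u = z
    set b₁ : ℝ := (l.length.choose m : ℕ) * (B / D) ^ m
    set b₂ : ℝ := (l.length.choose (m + 1) : ℕ) * (B / D) ^ (m + 1)
    have hstep : ∀ z, ((((cylinder f₀ E).filter (ManyCollisions (Sum.inl c :: l) (E, V, u)
        (m + 1))).filter fun f => f c u = z).card : ℝ) ≤
          (if z ∈ V then b₁ else b₂) * (Cz z).card := by
      intro z
      rcases (Cz z).eq_empty_or_nonempty with he | ⟨f₁, hf₁⟩
      · have : ((cylinder f₀ E).filter (ManyCollisions (Sum.inl c :: l) (E, V, u)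
            (m + 1))).filter (fun f => f c u = z) = ∅ := by
          rw [Finset.filter_comm, show (cylinder f₀ E).filter (fun f => f c u = z) = ∅ from he,
            Finset.filter_empty]
        rw [this, he]
        simp
      have hf₁' := hf₁
      simp only [Cz, Finset.mem_filter, mem_cylinder] at hf₁'
      have hcyl : Cz z = cylinder f₁ (insert (c, u) E) := by
        ext f
        simp only [Cz, Finset.mem_filter, mem_cylinder, Finset.mem_insert, forall_eq_or_imp]
        constructor
        · rintro ⟨h1, h2⟩
          exact ⟨by rw [h2, hf₁'.2], fun e he => by rw [h1 e he, hf₁'.1 e he]⟩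
        · rintro ⟨h1, h2⟩
          exact ⟨fun e he => by rw [h2 e he, hf₁'.1 e he], by rw [h1, hf₁'.2]⟩
      have hE : (insert (c, u) E).card = E.card + 1 := Finset.card_insert_of_notMem hcu
      have hV : ((insert z V).card : ℝ) ≤ V.card + 1 := by
        exact_mod_cast Finset.card_insert_le _ _
      set s' : Finset (Bool × Fin n) × Finset (Fin n) × Fin n := (insert (c, u) E, insert z V, z)
      have hIH := fun m' => ih s' m' f₁ (by simp only [s']; linarith)
        (by simp only [s', hE]; push_cast; linarith)
      have hsub : ∀ m', (V.card + m' = (insert z V).card + m) →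
          ((cylinder f₀ E).filter (ManyCollisions (Sum.inl c :: l) (E, V, u)
            (m + 1))).filter (fun f => f c u = z) ⊆
            (cylinder f₁ (insert (c, u) E)).filter (ManyCollisions l s' m') := by
        intro m' hm' f hf
        simp only [Finset.mem_filter] at hf
        rw [← hcyl]
        simp only [Cz, Finset.mem_filter]
        refine ⟨⟨hf.1.1, hf.2⟩, ?_⟩
        have h2 := hf.1.2
        simp only [ManyCollisions, List.foldl_cons, explore, hf.2] at h2 ⊢
        simp only [s', hE]
        omega
      split_ifs with hz
      · have := Finset.card_le_card (hsub m (by rw [Finset.insert_eq_of_mem hz]))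
        rw [hcyl]
        exact (Nat.cast_le.mpr this).trans (hIH m)
      · have := Finset.card_le_card (hsub (m + 1) (by
          rw [Finset.card_insert_of_notMem hz]; omega))
        rw [hcyl]
        exact (Nat.cast_le.mpr this).trans (hIH (m + 1))
    have hb₁ : 0 ≤ b₁ := by positivity
    have hb₂ : 0 ≤ b₂ := by positivity
    have hswitch : ∀ z, ((Cz z).card : ℝ) ≤ (cylinder f₀ E).card / D := by
      intro z
      have h1 := card_cylinder_filter_le f₀ hcu z
      rw [le_div_iff₀ hD]
      have h2 : D ≤ ((n - E.card : ℕ) : ℝ) := by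
        have : (n : ℝ) - E.card ≤ ((n - E.card : ℕ) : ℝ) := by
          rw [sub_le_iff_le_add]
          exact_mod_cast le_tsub_add
        have : (0 : ℝ) ≤ l.length := by positivity
        linarith
      calc ((Cz z).card : ℝ) * D ≤ (Cz z).card * ((n - E.card : ℕ) : ℝ) := by gcongr
        _ ≤ _ := by exact_mod_cast h1
    rw [card_eq_sum_card_apply_eq _ c u]
    calc _ ≤ ∑ z, (if z ∈ V then b₁ else b₂) * ((Cz z).card : ℝ) :=
          Finset.sum_le_sum fun z _ => hstep z
      _ ≤ ∑ z, ((if z ∈ V then b₁ * ((cylinder f₀ E).card / D) else 0) + b₂ * (Cz z).card) := by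
          refine Finset.sum_le_sum fun z _ => ?_
          split_ifs
          · have := mul_le_mul_of_nonneg_left (hswitch z) hb₁
            have : 0 ≤ b₂ * (Cz z).card := by positivity
            linarith
          · simp
      _ = V.card * (b₁ * ((cylinder f₀ E).card / D)) + b₂ * (cylinder f₀ E).card := by
          rw [Finset.sum_add_distrib, ← Finset.mul_sum, ← card_eq_sum_card_apply_eq]
          simp
      _ ≤ B * (b₁ * ((cylinder f₀ E).card / D)) + b₂ * (cylinder f₀ E).card := by
          gcongr
          have : (0 : ℝ) ≤ l.length := by positivity
          linarith
      _ = _ := by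
          rw [Nat.choose_succ_succ]
          simp only [b₁, b₂]
          push_cast
          rw [pow_succ]
          field_simp

end Exposure

section Walks

variable {n : ℕ}

/-- The product of the first `i` letters of the word `x`, the letters being interpreted by `f`. -/
def walk (f : Bool → Perm (Fin n)) (x : ℕ → Bool) : ℕ → Perm (Fin n)
  | 0 => 1
  | i + 1 => f (x i) * walk f x i

theorem walk_zero_apply (f : Bool → Perm (Fin n)) (x : ℕ → Bool) (v : Fin n) :
    walk f x 0 v = v := rfl

theorem walk_succ_apply (f : Bool → Perm (Fin n)) (x : ℕ → Bool) (i : ℕ) (v : Fin n) :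
    walk f x (i + 1) v = f (x i) (walk f x i v) := rfl

theorem foldl_explore_map_range (f : Bool → Perm (Fin n)) (x : ℕ → Bool) (j : ℕ)
    (E : Finset (Bool × Fin n)) (V : Finset (Fin n)) (v : Fin n) :
    ((List.range j).map fun i => Sum.inl (x i)).foldl (explore f) (E, V, v) =
      (E ∪ (Finset.range j).image fun i => (x i, walk f x i v),
        V ∪ (Finset.range j).image fun i => walk f x (i + 1) v, walk f x j v) := by
  induction j with
  | zero => simp [walk]
  | succ j ih =>
    rw [List.range_succ, List.map_append, List.foldl_append, ih]
    simp only [List.map_cons, List.map_nil, List.foldl_cons, List.foldl_nil, explore,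
      Finset.range_add_one, Finset.image_insert, Finset.union_insert, walk_succ_apply]

variable (f : Bool → Perm (Fin n)) (x : Bool → ℕ → Bool) (r : Bool → Fin n) (j : ℕ)

/-- The instructions following both words from both roots. -/
def fourWalks : List (Bool ⊕ Fin n) :=
  (Sum.inr (r true) :: (List.range j).map fun i => Sum.inl (x true i)) ++
  ((Sum.inr (r false) :: (List.range j).map fun i => Sum.inl (x true i)) ++
  ((Sum.inr (r true) :: (List.range j).map fun i => Sum.inl (x false i)) ++
  (Sum.inr (r false) :: (List.range j).map fun i => Sum.inl (x false i))))

theorem length_fourWalks : (fourWalks x r j).length = 4 * j + 4 := by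
  simp [fourWalks]
  omega

theorem foldl_fourWalks : ∃ (E : Finset (Bool × Fin n)) (V : Finset (Fin n)) (u : Fin n),
    (fourWalks x r j).foldl (explore f) (∅, {r true, r false}, r true) = (E, V, u) ∧
    (∀ e, e ∈ E ↔ ∃ s t, ∃ i < j, e = (x s i, walk f (x s) i (r t))) ∧
    (∀ v, v ∈ V ↔ ∃ s t, ∃ i ≤ j, v = walk f (x s) i (r t)) := by
  refine ⟨_, _, _, by
    rw [fourWalks, List.foldl_append, List.foldl_append, List.foldl_append, List.foldl_cons,
      explore, foldl_explore_map_range, List.foldl_cons, explore, foldl_explore_map_range,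
      List.foldl_cons, explore, foldl_explore_map_range, List.foldl_cons, explore,
      foldl_explore_map_range], fun e => ?_, fun v => ?_⟩
  · simp only [Finset.mem_union, Finset.mem_image, Finset.mem_range, Bool.exists_bool,
      Finset.notMem_empty, false_or, eq_comm (a := e)]
    rw [iff_iff_eq]
    ac_rfl
  · simp only [Finset.mem_union, Finset.mem_image, Finset.mem_range, Bool.exists_bool,
      Finset.mem_insert, Finset.mem_singleton]
    have h : ∀ s t, (∃ i ≤ j, v = walk f (x s) i (r t)) ↔
        v = r t ∨ ∃ i < j, walk f (x s) (i + 1) (r t) = v := by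
      intro s t
      constructor
      · rintro ⟨i, hi, rfl⟩
        rcases i with _ | i
        · exact Or.inl rfl
        · exact Or.inr ⟨i, hi, rfl⟩
      · rintro (rfl | ⟨i, hi, rfl⟩)
        · exact ⟨0, Nat.zero_le _, rfl⟩
        · exact ⟨i + 1, hi, rfl⟩
    simp only [h]
    rw [iff_iff_eq]
    ac_rfl

variable {f x r j}

/-- If both words end at the same points from both roots and the walks have few collisions, the
endpoints are not visited earlier. -/
theorem walk_ne_of_card_le {E : Finset (Bool × Fin n)} {V : Finset (Fin n)}
    (hE : ∀ e, e ∈ E ↔ ∃ s t, ∃ i < j + 1, e = (x s i, walk f (x s) i (r t)))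
    (hV : ∀ v, v ∈ V ↔ ∃ s t, ∃ i ≤ j + 1, v = walk f (x s) i (r t))
    (hcard : E.card ≤ V.card) (hr : r true ≠ r false) (hx : x true j ≠ x false j)
    (hagree : ∀ s t, walk f (x s) (j + 1) (r t) = walk f (x true) (j + 1) (r t)) :
    ∀ i < j + 1, ∀ s t t', walk f (x s) i (r t) ≠ walk f (x true) (j + 1) (r t') := by
  set P : Bool → Fin n := fun t => walk f (x true) (j + 1) (r t) with hP
  have hrinj : Function.Injective r := by
    intro a b hab
    cases a <;> cases b <;> simp_all
  have hPinj : Function.Injective P := (walk f (x true) (j + 1)).injective.comp hrinj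
  set inE : Fin n → Finset (Bool × Fin n) := fun v => E.filter fun e => f e.1 e.2 = v with hinE
  set e₂ : Bool → Bool → Bool × Fin n := fun s t => (x s j, walk f (x s) j (r t)) with he₂
  have he₂mem : ∀ s t, e₂ s t ∈ inE (P t) := by
    intro s t
    simp only [hinE, Finset.mem_filter, hE]
    exact ⟨⟨s, t, j, Nat.lt_succ_self j, rfl⟩, hagree s t⟩
  have he₂ne : ∀ t, e₂ true t ≠ e₂ false t := fun t e => hx (congrArg Prod.fst e)
  have hpair : ∀ t, ({e₂ true t, e₂ false t} : Finset _) ⊆ inE (P t) := fun t => by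
    rw [Finset.insert_subset_iff, Finset.singleton_subset_iff]
    exact ⟨he₂mem _ _, he₂mem _ _⟩
  have htwo : ∀ t, 2 ≤ (inE (P t)).card := fun t => by
    rw [← Finset.card_pair (he₂ne t)]
    exact Finset.card_le_card (hpair t)
  have hsum : E.card = ∑ v ∈ V, (inE v).card := by
    refine Finset.card_eq_sum_card_fiberwise fun e he => ?_
    obtain ⟨s, t, i, hi, rfl⟩ := (hE e).mp he
    exact (hV _).mpr ⟨s, t, i + 1, hi, rfl⟩
  have hrV : ∀ t, r t ∈ V := fun t => (hV _).mpr ⟨true, t, 0, Nat.zero_le _, rfl⟩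
  have hPV : ∀ t, P t ∈ V := fun t => (hV _).mpr ⟨true, t, j + 1, le_rfl, rfl⟩
  have hcount : ∀ q : Bool → Fin n, Function.Injective q → (∀ t, q t ∈ V) →
      ∑ v ∈ V, (if ∃ t, v = q t then 1 else 0) = 2 := by
    intro q hq hqV
    rw [← Finset.card_filter]
    have : V.filter (fun v => ∃ t, v = q t) = Finset.univ.image q := by
      ext v
      simp only [Finset.mem_filter, Finset.mem_image, Finset.mem_univ, true_and]
      constructor
      · rintro ⟨-, t, rfl⟩
        exact ⟨t, rfl⟩
      · rintro ⟨t, rfl⟩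
        exact ⟨hqV t, t, rfl⟩
    rw [this, Finset.card_image_of_injective _ hq]
    rfl
  have hle : ∀ v ∈ V, 1 + (if ∃ t, v = P t then 1 else 0) ≤
      (inE v).card + (if ∃ t, v = r t then 1 else 0) := by
    intro v hv
    by_cases h1 : ∃ t, v = P t
    · rw [if_pos h1]
      obtain ⟨t, rfl⟩ := h1
      have := htwo t
      omega
    · rw [if_neg h1]
      by_cases h2 : ∃ t, v = r t
      · rw [if_pos h2]
        omega
      · rw [if_neg h2]
        obtain ⟨s, t, i, hi, rfl⟩ := (hV v).mp hv
        rcases i with _ | i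
        · exact absurd ⟨t, rfl⟩ h2
        · have : 0 < (inE (walk f (x s) (i + 1) (r t))).card := by
            refine Finset.card_pos.mpr ⟨(x s i, walk f (x s) i (r t)), ?_⟩
            simp only [hinE, Finset.mem_filter, hE]
            exact ⟨⟨s, t, i, hi, rfl⟩, rfl⟩
          omega
  have heq : ∀ v ∈ V, 1 + (if ∃ t, v = P t then 1 else 0) =
      (inE v).card + (if ∃ t, v = r t then 1 else 0) := by
    refine (Finset.sum_eq_sum_iff_of_le hle).mp (le_antisymm (Finset.sum_le_sum hle) ?_)
    rw [Finset.sum_add_distrib, Finset.sum_add_distrib, hcount P hPinj hPV, hcount r hrinj hrV,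
      ← hsum, Finset.sum_const, smul_eq_mul, mul_one]
    omega
  have hroot : ∀ t, inE (r t) = ∅ := by
    intro t
    have h1 := heq _ (hrV t)
    rw [if_pos (⟨t, rfl⟩ : ∃ t', r t = r t')] at h1
    by_cases h2 : ∃ t', r t = P t'
    · rw [if_pos h2] at h1
      obtain ⟨t', h2⟩ := h2
      have := htwo t'
      rw [← h2] at this
      omega
    · rw [if_neg h2] at h1
      exact Finset.card_eq_zero.mp (by omega)
  have hone : ∀ v ∈ V, (∀ t, v ≠ P t) → (inE v).card ≤ 1 := by
    intro v hv h
    have h1 := heq v hv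
    rw [if_neg (by simpa using h)] at h1
    omega
  have hinP : ∀ t, ∀ e ∈ inE (P t), ∃ s, e = e₂ s t := by
    intro t e he
    have h1 := heq _ (hPV t)
    rw [if_pos (⟨t, rfl⟩ : ∃ t', P t = P t')] at h1
    have h2 : (inE (P t)).card ≤ ({e₂ true t, e₂ false t} : Finset _).card := by
      rw [Finset.card_pair (he₂ne t)]
      omega
    rw [← Finset.eq_of_subset_of_card_le (hpair t) h2] at he
    simp only [Finset.mem_insert, Finset.mem_singleton] at he
    rcases he with h | h
    exacts [⟨_, h⟩, ⟨_, h⟩]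
  have hedge : ∀ s t, ∀ i < j + 1,
      (x s i, walk f (x s) i (r t)) ∈ inE (walk f (x s) (i + 1) (r t)) := by
    intro s t i hi
    simp only [hinE, Finset.mem_filter, hE]
    exact ⟨⟨s, t, i, hi, rfl⟩, rfl⟩
  intro i
  induction i using Nat.strong_induction_on with
  | _ i ih =>
    intro hi s t t' heqP
    rcases i with _ | i
    · have h1 := htwo t'
      have h2 : r t = P t' := heqP
      rw [← h2, hroot] at h1
      simp at h1
    have h1 := hedge s t i (by omega)
    rw [heqP] at h1
    obtain ⟨s', hs'⟩ := hinP t' _ h1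
    have hback : ∀ d ≤ i, walk f (x s) (i - d) (r t) = walk f (x s') (j - d) (r t') := by
      intro d
      induction d with
      | zero => exact fun _ => congrArg Prod.snd hs'
      | succ d ihd =>
        intro hd
        have h2 := ihd (by omega)
        obtain ⟨i', hi'⟩ : ∃ i', i - d = i' + 1 := ⟨i - d - 1, by omega⟩
        obtain ⟨j', hj'⟩ : ∃ j', j - d = j' + 1 := ⟨j - d - 1, by omega⟩
        have h3 := hedge s t i' (by omega)
        have h4 := hedge s' t' j' (by omega)
        rw [← hj', ← h2, hi'] at h4
        have h5 := hone _ ((hV _).mpr ⟨s, t, i' + 1, by omega, rfl⟩)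
          (fun t'' => ih (i' + 1) (by omega) (by omega) s t t'')
        have h6 := Finset.card_le_one.mp h5 _ h3 _ h4
        have e1 : i - (d + 1) = i' := by omega
        have e2 : j - (d + 1) = j' := by omega
        rw [e1, e2]
        exact congrArg Prod.snd h6
    have h2 := hback i le_rfl
    rw [Nat.sub_self, walk_zero_apply] at h2
    obtain ⟨j', hj'⟩ : ∃ j', j - i = j' + 1 := ⟨j - i - 1, by omega⟩
    have h3 := hedge s' t' j' (by omega)
    rw [← hj', ← h2, hroot] at h3
    simp at h3

end Walks

section Agreement

variable {n : ℕ}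

/-- The pairs of permutations for which both words end at the same points from both roots, these
points not being visited earlier. -/
def CleanAgreement (x : Bool → ℕ → Bool) (r : Bool → Fin n) (j : ℕ) (f : Bool → Perm (Fin n)) :
    Prop :=
  (∀ s t, walk f (x s) (j + 1) (r t) = walk f (x true) (j + 1) (r t)) ∧
    ∀ i < j + 1, ∀ s t t', walk f (x s) i (r t) ≠ walk f (x true) (j + 1) (r t')

theorem card_cleanAgreement_le {x : Bool → ℕ → Bool} {r : Bool → Fin n} {j : ℕ}
    (hr : r true ≠ r false) (hx : x true j ≠ x false j) :
    (Finset.univ.filter (CleanAgreement x r j)).card * (n - (4 * j + 9)) ^ 2 ≤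
      Fintype.card (Bool → Perm (Fin n)) := by
  set c := x false j with hc
  set P : (Bool → Perm (Fin n)) → Bool → Fin n := fun f t => walk f (x true) (j + 1) (r t) with hP
  have hPne : ∀ f, P f true ≠ P f false := fun f => (walk f (x true) (j + 1)).injective.ne hr
  set V : (Bool → Perm (Fin n)) → Finset (Fin n) := fun f =>
    ((Finset.univ : Finset (Bool × Bool)) ×ˢ Finset.range (j + 2)).image
      fun q => walk f (x q.1.1) q.2 (r q.1.2) with hV
  have hVmem : ∀ f s t i, i ≤ j + 1 → walk f (x s) i (r t) ∈ V f := by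
    intro f s t i hi
    simp only [hV, Finset.mem_image, Finset.mem_product, Finset.mem_univ, true_and,
      Finset.mem_range]
    exact ⟨((s, t), i), by simp only; omega, rfl⟩
  have hVcard : ∀ f, n - (4 * j + 8) ≤ (V f)ᶜ.card := by
    intro f
    rw [Finset.card_compl, Fintype.card_fin]
    refine Nat.sub_le_sub_left (Finset.card_image_le.trans ?_) _
    rw [Finset.card_product, Finset.card_range]
    simp
    omega
  have hK : ∀ f, (n - (4 * j + 9)) ^ 2 ≤ (V f)ᶜ.offDiag.card := by
    intro f
    have h1 := hVcard f
    rw [Finset.offDiag_card, ← Nat.mul_sub_one, sq]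
    exact Nat.mul_le_mul (by omega) (by omega)
  set M : (Bool → Perm (Fin n)) → Fin n × Fin n → Perm (Fin n) := fun f z =>
    swap (P f true) z.1 * swap (P f false) z.2 with hM
  set U : (Bool → Perm (Fin n)) → Fin n × Fin n → (Bool → Perm (Fin n)) := fun f z =>
    Function.update f c (M f z * f c) with hU
  have key : ∀ f, CleanAgreement x r j f → ∀ z ∈ (V f)ᶜ.offDiag,
      (∀ t, walk (U f z) (x true) (j + 1) (r t) = P f t) ∧
      walk (U f z) (x false) (j + 1) (r true) = z.1 ∧
      walk (U f z) (x false) (j + 1) (r false) = z.2 := by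
    rintro f hf ⟨z, z'⟩ hz
    simp only [Finset.mem_offDiag, Finset.mem_compl] at hz
    have hPV : ∀ t, P f t ∈ V f := fun t => hVmem f true t (j + 1) le_rfl
    have hneV : ∀ v ∈ V f, v ≠ z ∧ v ≠ z' := fun v hv =>
      ⟨fun e => hz.1 (e ▸ hv), fun e => hz.2.1 (e ▸ hv)⟩
    have hsame : ∀ i ≤ j, ∀ s t, walk (U f (z, z')) (x s) i (r t) = walk f (x s) i (r t) := by
      intro i
      induction i with
      | zero => exact fun _ _ _ => rfl
      | succ i ih =>
        intro hi s t
        rw [walk_succ_apply, ih (by omega)]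
        by_cases hxc : x s i = c
        · rw [hxc, hU]
          simp only [Function.update_self, hM, Perm.mul_apply]
          have e : f c (walk f (x s) i (r t)) = walk f (x s) (i + 1) (r t) := by
            rw [walk_succ_apply, hxc]
          rw [e]
          have h1 := hneV _ (hVmem f s t (i + 1) (by omega))
          rw [swap_apply_of_ne_of_ne (hf.2 (i + 1) (by omega) s t false) h1.2,
            swap_apply_of_ne_of_ne (hf.2 (i + 1) (by omega) s t true) h1.1]
        · rw [hU]
          simp only [Function.update_of_ne hxc]
          rfl
    refine ⟨fun t => ?_, ?_, ?_⟩
    · rw [walk_succ_apply, hsame j le_rfl, hU]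
      simp only [Function.update_of_ne hx]
      rfl
    · rw [walk_succ_apply, hsame j le_rfl, ← hc, hU]
      simp only [Function.update_self, hM, Perm.mul_apply]
      have e : f c (walk f (x false) j (r true)) = P f true := hf.1 false true
      rw [e, swap_apply_of_ne_of_ne (hPne f) (hneV _ (hPV true)).2, swap_apply_left]
    · rw [walk_succ_apply, hsame j le_rfl, ← hc, hU]
      simp only [Function.update_self, hM, Perm.mul_apply]
      have e : f c (walk f (x false) j (r false)) = P f false := hf.1 false false
      rw [e, swap_apply_left, swap_apply_of_ne_of_ne (hneV _ (hPV true)).2.symm hz.2.2.symm]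
  have hsig : ((Finset.univ.filter (CleanAgreement x r j)).sigma fun f => (V f)ᶜ.offDiag).card ≤
      (Finset.univ : Finset (Bool → Perm (Fin n))).card := by
    refine Finset.card_le_card_of_injOn (fun q => U q.1 q.2)
      (fun _ _ => Finset.mem_coe.mpr (Finset.mem_univ _)) ?_
    rintro ⟨f, z⟩ h1 ⟨f', z'⟩ h2 heq
    simp only [Finset.coe_sigma, Set.mem_sigma_iff, Finset.mem_coe, Finset.mem_filter,
      Finset.mem_univ, true_and] at h1 h2 heq
    obtain ⟨a1, a2, a3⟩ := key f h1.1 z h1.2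
    obtain ⟨b1, b2, b3⟩ := key f' h2.1 z' h2.2
    rw [heq] at a1 a2 a3
    have hz : z = z' := Prod.ext (a2.symm.trans b2) (a3.symm.trans b3)
    have hPP : P f = P f' := funext fun t => (a1 t).symm.trans (b1 t)
    subst hz
    have hMM : M f z = M f' z := by simp only [hM, hPP]
    have hff : f = f' := by
      funext d
      have hd := congrFun heq d
      simp only [hU, hMM] at hd
      by_cases hdc : d = c
      · subst hdc
        simpa using hd
      · simpa [Function.update_of_ne hdc] using hd
    subst hff
    rfl
  rw [Finset.card_sigma] at hsig
  calc _ = ∑ _f ∈ Finset.univ.filter (CleanAgreement x r j), (n - (4 * j + 9)) ^ 2 := by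
        rw [Finset.sum_const, smul_eq_mul]
    _ ≤ _ := (Finset.sum_le_sum fun f _ => hK f).trans hsig

theorem card_agree_le_of_ne {x : Bool → ℕ → Bool} {r : Bool → Fin n} {j k : ℕ} (hjk : j < k)
    (hk : 4 * k + 9 < n) (hr : r true ≠ r false) (hx : x true j ≠ x false j) :
    ((Finset.univ.filter fun f : Bool → Perm (Fin n) =>
      ∀ t, walk f (x true) (j + 1) (r t) = walk f (x false) (j + 1) (r t)).card : ℝ) ≤
      (1 / ((n : ℝ) - (4 * k + 9)) ^ 2 + ((4 * k + 9 : ℝ) ^ 2 / (n - (4 * k + 9))) ^ 3) *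
        Fintype.card (Bool → Perm (Fin n)) := by
  have hk' : (0 : ℝ) < n - (4 * k + 9) := by
    have : ((4 * k + 9 : ℕ) : ℝ) < n := by exact_mod_cast hk
    push_cast at this
    linarith
  have hjk' : (j : ℝ) + 1 ≤ k := by exact_mod_cast hjk
  set N : ℝ := ((Fintype.card (Bool → Perm (Fin n)) : ℕ) : ℝ)
  set s₀ : Finset (Bool × Fin n) × Finset (Fin n) × Fin n := (∅, {r true, r false}, r true)
  have h1 : ((Finset.univ.filter (CleanAgreement x r j)).card : ℝ) ≤
      1 / ((n : ℝ) - (4 * k + 9)) ^ 2 * N := by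
    have h := card_cleanAgreement_le hr hx
    rw [one_div_mul_eq_div, le_div_iff₀ (by positivity)]
    calc _ ≤ ((Finset.univ.filter (CleanAgreement x r j)).card : ℝ) *
          ((n - (4 * j + 9) : ℕ) : ℝ) ^ 2 := by
          gcongr
          rw [Nat.cast_sub (by omega)]
          push_cast
          linarith
      _ ≤ _ := by
          simp only [N]
          exact_mod_cast h
  have h2 : ((Finset.univ.filter (ManyCollisions (fourWalks x r (j + 1)) s₀ 3)).card : ℝ) ≤
      ((4 * k + 9 : ℝ) ^ 2 / (n - (4 * k + 9))) ^ 3 * N := by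
    have hl := length_fourWalks x r (j + 1)
    have h := card_manyCollisions_le (B := 4 * k + 9) (D := n - (4 * k + 9)) hk' (by positivity)
      (fourWalks x r (j + 1)) s₀ 3 (fun _ => 1) (by
        rw [hl]
        simp only [s₀, Finset.card_pair hr]
        push_cast
        linarith) (by
        rw [hl]
        simp only [s₀, Finset.card_empty]
        push_cast
        linarith)
    have hcyl : cylinder (fun _ => (1 : Perm (Fin n))) s₀.1 = Finset.univ := by
      ext f
      simp [mem_cylinder, s₀]
    rw [hcyl, hl] at h
    refine h.trans ?_
    rw [Finset.card_univ]
    gcongr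
    rw [div_pow, div_pow, ← pow_mul, mul_comm 2 3, pow_mul, sq, mul_div_assoc]
    gcongr
    have h3 := Nat.choose_le_pow (4 * (j + 1) + 4) 3
    calc (((4 * (j + 1) + 4).choose 3 : ℕ) : ℝ) ≤ ((4 * (j + 1) + 4 : ℕ) : ℝ) ^ 3 := by
          exact_mod_cast h3
      _ ≤ _ := by
          gcongr
          push_cast
          linarith
  rw [add_mul]
  refine le_trans ?_ (add_le_add h1 h2)
  norm_cast
  refine (Finset.card_le_card fun f hf => ?_).trans (Finset.card_union_le _ _)
  simp only [Finset.mem_union, Finset.mem_filter, Finset.mem_univ, true_and] at hf ⊢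
  by_contra! hc
  apply hc.1
  have hagree : ∀ s t, walk f (x s) (j + 1) (r t) = walk f (x true) (j + 1) (r t) := by
    intro s t
    cases s
    · exact (hf t).symm
    · rfl
  obtain ⟨E, V, u, h, hE, hV⟩ := foldl_fourWalks f x r (j + 1)
  refine ⟨hagree, walk_ne_of_card_le hE hV ?_ hr hx hagree⟩
  have := hc.2
  simp only [ManyCollisions, s₀, h, Finset.card_empty, Finset.card_pair hr] at this
  omega

/-- Two different words of the same length rarely agree at two given points. -/
theorem card_agree_le {x y : ℕ → Bool} {a b : Fin n} {k : ℕ}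
    (hk : 4 * k + 9 < n) (hab : a ≠ b) (hxy : ∃ i < k, x i ≠ y i) :
    ((Finset.univ.filter fun f : Bool → Perm (Fin n) =>
      walk f x k a = walk f y k a ∧ walk f x k b = walk f y k b).card : ℝ) ≤
      (1 / ((n : ℝ) - (4 * k + 9)) ^ 2 + ((4 * k + 9 : ℝ) ^ 2 / (n - (4 * k + 9))) ^ 3) *
        Fintype.card (Bool → Perm (Fin n)) := by
  obtain ⟨j, hj, hne, hlast⟩ : ∃ j < k, x j ≠ y j ∧ ∀ i < k, j < i → x i = y i := by
    obtain ⟨i, hi, hne⟩ := hxy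
    set F := (Finset.range k).filter fun i => x i ≠ y i
    have hF : F.Nonempty := ⟨i, by simp [F, hi, hne]⟩
    have h1 := Finset.max'_mem F hF
    simp only [F, Finset.mem_filter, Finset.mem_range] at h1
    refine ⟨F.max' hF, h1.1, h1.2, fun i hi h => ?_⟩
    by_contra hc
    exact absurd (Finset.le_max' F i (by simp [F, hi, hc])) (not_le.mpr h)
  have hstrip : ∀ (f : Bool → Perm (Fin n)) (v : Fin n), ∀ i ≤ k, j + 1 ≤ i →
      (walk f x i v = walk f y i v → walk f x (j + 1) v = walk f y (j + 1) v) := by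
    intro f v i hik hji
    induction i, hji using Nat.le_induction with
    | base => exact id
    | succ i hji ih =>
      intro h
      rw [walk_succ_apply, walk_succ_apply, hlast i (by omega) (by omega)] at h
      exact ih (by omega) ((f (y i)).injective h)
  refine le_trans (Nat.cast_le.mpr (Finset.card_le_card fun f hf => ?_))
    (card_agree_le_of_ne (x := fun s => if s then x else y) (r := fun t => if t then a else b)
      hj hk (by simpa using hab) (by simpa using hne))
  simp only [Finset.mem_filter, Finset.mem_univ, true_and] at hf ⊢
  intro t
  cases t
  · simpa using hstrip f b k le_rfl hj hf.2
  · simpa using hstrip f a k le_rfl hj hf.1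

end Agreement

section PairMatrix

variable {n : ℕ}

/-- The ordered pairs of distinct points. -/
abbrev DistinctPair (n : ℕ) : Type := {p : Fin n × Fin n // p.1 ≠ p.2}

/-- The image of an ordered pair of distinct points. -/
def pairApply (x : Perm (Fin n)) (p : DistinctPair n) : DistinctPair n :=
  ⟨(x p.1.1, x p.1.2), x.injective.ne p.2⟩

theorem pairApply_mul (x y : Perm (Fin n)) (p : DistinctPair n) :
    pairApply (x * y) p = pairApply x (pairApply y p) := rfl

theorem pairApply_inv_eq_iff (x : Perm (Fin n)) (p q : DistinctPair n) :
    pairApply x⁻¹ p = q ↔ pairApply x q = p := by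
  constructor
  · rintro rfl
    rw [← pairApply_mul, mul_inv_cancel]
    rfl
  · rintro rfl
    rw [← pairApply_mul, inv_mul_cancel]
    rfl

theorem pairApply_eq_iff (x : Perm (Fin n)) (p q : DistinctPair n) :
    pairApply x p = q ↔ x p.1.1 = q.1.1 ∧ x p.1.2 = q.1.2 := by
  rw [Subtype.ext_iff, Prod.ext_iff]
  rfl

theorem card_distinctPair (n : ℕ) : (Fintype.card (DistinctPair n) : ℝ) = n * (n - 1) := by
  have h : Fintype.card (DistinctPair n) = (Finset.univ : Finset (Fin n)).offDiag.card := by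
    rw [Fintype.card_subtype]
    congr 1
    ext p
    simp
  rw [h, Finset.offDiag_card, Finset.card_fin, Nat.cast_sub (Nat.le_mul_self _)]
  push_cast
  ring

/-- The transition matrix on ordered pairs of distinct points of a measure on permutations. -/
noncomputable def pairMatrix (ν : Perm (Fin n) → ℝ) :
    Matrix (DistinctPair n) (DistinctPair n) ℝ :=
  fun p q => ∑ x, if pairApply x p = q then ν x else 0

/-- `M` is the transition matrix of a probability measure on short words. -/
def IsWordMatrix (S : Set (Perm (Fin n))) (L : ℕ)
    (M : Matrix (DistinctPair n) (DistinctPair n) ℝ) : Prop :=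
  ∃ ν : Perm (Fin n) → ℝ, (∀ x, 0 ≤ ν x) ∧ ∑ x, ν x = 1 ∧ (∀ x, ν x ≠ 0 → x ∈ wordBall S L) ∧
    M = pairMatrix ν

variable {S : Set (Perm (Fin n))} {L L' : ℕ} {M M' : Matrix (DistinctPair n) (DistinctPair n) ℝ}

theorem IsWordMatrix.one (S : Set (Perm (Fin n))) : IsWordMatrix S 0 1 := by
  refine ⟨fun x => if x = 1 then 1 else 0, fun x => by positivity, by simp, fun x hx => ?_, ?_⟩
  · have : x = 1 := by simpa using hx
    exact this ▸ one_mem_wordBall S 0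
  · ext p q
    rw [pairMatrix, Finset.sum_eq_single 1 (fun x _ hx => by simp [hx]) (by simp), if_pos rfl]
    rfl

theorem IsWordMatrix.transpose (hS : ∀ s ∈ S, s⁻¹ ∈ S) (h : IsWordMatrix S L M) :
    IsWordMatrix S L M.transpose := by
  obtain ⟨ν, h0, h1, h2, rfl⟩ := h
  refine ⟨fun x => ν x⁻¹, fun x => h0 _, ?_, fun x hx => ?_, ?_⟩
  · rw [← h1]
    exact Equiv.sum_comp (Equiv.inv _) ν
  · exact inv_inv x ▸ inv_mem_wordBall hS (h2 _ hx)
  · ext p q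
    rw [Matrix.transpose_apply, pairMatrix, pairMatrix]
    refine (Equiv.sum_comp (Equiv.inv _) _).symm.trans (Finset.sum_congr rfl fun x _ => ?_)
    exact (if_congr (pairApply_inv_eq_iff x q p) rfl rfl)

theorem IsWordMatrix.mul (h : IsWordMatrix S L M) (h' : IsWordMatrix S L' M') :
    IsWordMatrix S (L + L') (M * M') := by
  obtain ⟨ν, h0, h1, h2, rfl⟩ := h
  obtain ⟨ν', h0', h1', h2', rfl⟩ := h'
  refine ⟨fun x => ∑ a, ∑ b, if b * a = x then ν a * ν' b else 0, fun x => ?_, ?_, fun x hx => ?_,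
    ?_⟩
  · exact Finset.sum_nonneg fun a _ => Finset.sum_nonneg fun b _ => by
      have := mul_nonneg (h0 a) (h0' b)
      split_ifs <;> simp [this]
  · rw [Finset.sum_comm]
    calc _ = ∑ a, ∑ b, ν a * ν' b := by
          refine Finset.sum_congr rfl fun a _ => ?_
          rw [Finset.sum_comm]
          exact Finset.sum_congr rfl fun b _ => by rw [Finset.sum_ite_eq, if_pos (Finset.mem_univ _)]
      _ = 1 := by rw [← Finset.sum_mul_sum, h1, h1', one_mul]
  · obtain ⟨a, -, ha⟩ := Finset.exists_ne_zero_of_sum_ne_zero hx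
    obtain ⟨b, -, hb⟩ := Finset.exists_ne_zero_of_sum_ne_zero ha
    obtain ⟨hba, hab⟩ : b * a = x ∧ ν a * ν' b ≠ 0 := by
      by_cases h : b * a = x
      · exact ⟨h, by simpa [h] using hb⟩
      · simp [h] at hb
    rw [← hba, add_comm]
    exact mul_mem_wordBall (h2' b (right_ne_zero_of_mul hab)) (h2 a (left_ne_zero_of_mul hab))
  · ext p q
    rw [Matrix.mul_apply]
    simp only [pairMatrix]
    have e1 : ∀ r : DistinctPair n, (∑ a, if pairApply a p = r then ν a else 0) *
        (∑ b, if pairApply b r = q then ν' b else 0) =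
        ∑ a, ∑ b, if pairApply a p = r then (if pairApply b r = q then ν a * ν' b else 0) else 0 := by
      intro r
      rw [Finset.sum_mul_sum]
      refine Finset.sum_congr rfl fun a _ => Finset.sum_congr rfl fun b _ => ?_
      split_ifs <;> simp
    have e2 : ∀ x : Perm (Fin n), (if pairApply x p = q then
        ∑ a, ∑ b, (if b * a = x then ν a * ν' b else 0) else 0) =
        ∑ a, ∑ b, if b * a = x then (if pairApply x p = q then ν a * ν' b else 0) else 0 := by
      intro x
      split_ifs
      · rfl
      · simp
    simp only [e1, e2]
    calc _ = ∑ a, ∑ b, (if pairApply b (pairApply a p) = q then ν a * ν' b else 0) := by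
          rw [Finset.sum_comm]
          refine Finset.sum_congr rfl fun a _ => ?_
          rw [Finset.sum_comm]
          refine Finset.sum_congr rfl fun b _ => ?_
          rw [Finset.sum_ite_eq, if_pos (Finset.mem_univ _)]
      _ = _ := by
          symm
          rw [Finset.sum_comm]
          refine Finset.sum_congr rfl fun a _ => ?_
          rw [Finset.sum_comm]
          refine Finset.sum_congr rfl fun b _ => ?_
          rw [Finset.sum_ite_eq, if_pos (Finset.mem_univ _), pairApply_mul]

theorem IsWordMatrix.pow (h : IsWordMatrix S L M) (j : ℕ) : IsWordMatrix S (j * L) (M ^ j) := by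
  induction j with
  | zero => simpa using IsWordMatrix.one S
  | succ j ih => rw [pow_succ, Nat.succ_mul]; exact ih.mul h

theorem IsWordMatrix.sum_row (h : IsWordMatrix S L M) (p : DistinctPair n) : ∑ q, M p q = 1 := by
  obtain ⟨ν, -, h1, -, rfl⟩ := h
  simp only [pairMatrix]
  rw [Finset.sum_comm, ← h1]
  exact Finset.sum_congr rfl fun x _ => by rw [Finset.sum_ite_eq, if_pos (Finset.mem_univ _)]

theorem IsWordMatrix.sum_col (hS : ∀ s ∈ S, s⁻¹ ∈ S) (h : IsWordMatrix S L M)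
    (q : DistinctPair n) : ∑ p, M p q = 1 := (h.transpose hS).sum_row q

end PairMatrix

section SquareSum

variable {Ω : Type*} [Fintype Ω]

/-- The sum of the squares of the entries of a matrix. -/
def squareSum (A : Matrix Ω Ω ℝ) : ℝ := ∑ p, ∑ q, A p q ^ 2

theorem squareSum_nonneg (A : Matrix Ω Ω ℝ) : 0 ≤ squareSum A :=
  Finset.sum_nonneg fun _ _ => Finset.sum_nonneg fun _ _ => sq_nonneg _

theorem squareSum_transpose (A : Matrix Ω Ω ℝ) : squareSum A.transpose = squareSum A :=
  Finset.sum_comm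

theorem squareSum_mul_le (A B : Matrix Ω Ω ℝ) :
    squareSum (A * B) ≤ squareSum A * squareSum B := by
  rw [← squareSum_transpose B]
  unfold squareSum
  rw [Finset.sum_mul_sum]
  refine Finset.sum_le_sum fun p _ => Finset.sum_le_sum fun q _ => ?_
  rw [Matrix.mul_apply]
  exact Finset.sum_mul_sq_le_sq_mul_sq _ _ _

theorem squareSum_pow_le [DecidableEq Ω] (A : Matrix Ω Ω ℝ) (j : ℕ) :
    squareSum (A ^ (j + 1)) ≤ squareSum A ^ (j + 1) := by
  induction j with
  | zero => simp
  | succ j ih =>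
    rw [pow_succ, pow_succ (squareSum A)]
    exact (squareSum_mul_le _ _).trans (mul_le_mul_of_nonneg_right ih (squareSum_nonneg _))

theorem sq_apply_le_squareSum (A : Matrix Ω Ω ℝ) (p q : Ω) : A p q ^ 2 ≤ squareSum A := by
  refine le_trans ?_ (Finset.single_le_sum (f := fun p => ∑ q, A p q ^ 2)
    (fun _ _ => Finset.sum_nonneg fun _ _ => sq_nonneg _) (Finset.mem_univ p))
  exact Finset.single_le_sum (f := fun q => A p q ^ 2) (fun _ _ => sq_nonneg _) (Finset.mem_univ q)

/-- Powers of a doubly stochastic matrix close to the uniform one. -/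
theorem exists_pow_eq_add [DecidableEq Ω] (T : Matrix Ω Ω ℝ) (hrow : ∀ p, ∑ q, T p q = 1)
    (hcol : ∀ q, ∑ p, T p q = 1) (j : ℕ) (p q : Ω) :
    |((T * T.transpose) ^ (j + 1)) p q - 1 / Fintype.card Ω| ≤
      (squareSum T - 1) ^ (j + 1) := by
  have hN : (Fintype.card Ω : ℝ) ≠ 0 := by
    have : Nonempty Ω := ⟨p⟩
    exact_mod_cast Fintype.card_ne_zero
  set U : Matrix Ω Ω ℝ := fun _ _ => 1 / Fintype.card Ω with hU
  set D := T - U with hD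
  have hDa : ∀ p q, D p q = T p q - 1 / Fintype.card Ω := fun _ _ => rfl
  have hUa : ∀ p q, U p q = 1 / Fintype.card Ω := fun _ _ => rfl
  have hUD : U * D = 0 := by
    ext p q
    rw [Matrix.mul_apply, Matrix.zero_apply]
    simp only [hDa, hUa]
    rw [← Finset.mul_sum, Finset.sum_sub_distrib, hcol]
    simp [hN]
  have hDU : D * U = 0 := by
    ext p q
    rw [Matrix.mul_apply, Matrix.zero_apply]
    simp only [hDa, hUa]
    rw [← Finset.sum_mul, Finset.sum_sub_distrib, hrow]
    simp [hN]
  have hUU : U * U = U := by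
    ext p q
    rw [Matrix.mul_apply]
    simp [hU, hN]
  have hUt : U.transpose = U := rfl
  have hDtU : D.transpose * U = 0 := by
    rw [← hUt, ← Matrix.transpose_mul, hUD, Matrix.transpose_zero]
  have hUDt : U * D.transpose = 0 := by
    rw [← hUt, ← Matrix.transpose_mul, hDU, Matrix.transpose_zero]
  have hT : T = U + D := by rw [hD]; abel
  have hTT : T * T.transpose = U + D * D.transpose := by
    rw [hT, Matrix.transpose_add, hUt, Matrix.add_mul, Matrix.mul_add, Matrix.mul_add, hUU, hUDt,
      hDU]
    simp
  have hpow : ∀ j, (T * T.transpose) ^ (j + 1) = U + (D * D.transpose) ^ (j + 1) := by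
    intro j
    induction j with
    | zero => simpa using hTT
    | succ j ih =>
      rw [pow_succ, ih, hTT, Matrix.add_mul, Matrix.mul_add, Matrix.mul_add, hUU, ← mul_assoc U,
        hUD, pow_succ (D * D.transpose) j, mul_assoc _ (D * D.transpose) U, mul_assoc D, hDtU]
      simp [pow_succ, mul_assoc]
  have hsq : squareSum D = squareSum T - 1 := by
    have e : squareSum D = ∑ p, ∑ q, (T p q ^ 2 - 2 / Fintype.card Ω * T p q +
        1 / (Fintype.card Ω : ℝ) ^ 2) := by
      refine Finset.sum_congr rfl fun p _ => Finset.sum_congr rfl fun q _ => ?_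
      simp only [hDa]
      field_simp
      ring
    rw [e]
    simp only [Finset.sum_add_distrib, Finset.sum_sub_distrib, ← Finset.mul_sum, hrow]
    simp only [Finset.sum_const, Finset.card_univ, nsmul_eq_mul, squareSum]
    field_simp
    ring
  rw [hpow, Matrix.add_apply, hU]
  simp only [add_sub_cancel_left]
  rw [← hsq]
  refine abs_le_of_sq_le_sq ?_ (pow_nonneg (squareSum_nonneg _) _)
  refine (sq_apply_le_squareSum _ p q).trans ((squareSum_pow_le _ _).trans ?_)
  rw [← pow_mul, mul_comm, pow_mul]
  refine pow_le_pow_left₀ (squareSum_nonneg _) ?_ _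
  have := squareSum_mul_le D D.transpose
  rw [squareSum_transpose] at this
  rw [sq]
  exact this

end SquareSum

section RandomWord

variable {n : ℕ}

/-- The infinite word starting with a given finite one. -/
def extendWord {k : ℕ} (w : Fin k → Bool) (i : ℕ) : Bool := if h : i < k then w ⟨i, h⟩ else false

/-- The distribution of a uniformly random positive word of length `k`. -/
noncomputable def wordMeasure (f : Bool → Perm (Fin n)) (k : ℕ) (x : Perm (Fin n)) : ℝ :=
  ∑ w : Fin k → Bool, if walk f (extendWord w) k = x then (1 / 2 : ℝ) ^ k else 0

theorem walk_mem_wordBall (f : Bool → Perm (Fin n)) (x : ℕ → Bool) (k : ℕ) :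
    walk f x k ∈ wordBall (genSet (f true) (f false)) k := by
  induction k with
  | zero => exact one_mem_wordBall _ _
  | succ k ih =>
    rw [walk, add_comm]
    refine mul_mem_wordBall (mem_wordBall_one ?_) ih
    cases x k <;> simp [genSet]

theorem isWordMatrix_wordMeasure (f : Bool → Perm (Fin n)) (k : ℕ) :
    IsWordMatrix (genSet (f true) (f false)) k (pairMatrix (wordMeasure f k)) := by
  refine ⟨_, fun x => ?_, ?_, fun x hx => ?_, rfl⟩
  · exact Finset.sum_nonneg fun w _ => by positivity
  · unfold wordMeasure
    rw [Finset.sum_comm]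
    simp
  · obtain ⟨w, -, hw⟩ := Finset.exists_ne_zero_of_sum_ne_zero hx
    have : walk f (extendWord w) k = x := by
      by_contra h
      simp [h] at hw
    exact this ▸ walk_mem_wordBall f _ k

theorem pairMatrix_wordMeasure (f : Bool → Perm (Fin n)) (k : ℕ) (p q : DistinctPair n) :
    pairMatrix (wordMeasure f k) p q =
      ∑ w : Fin k → Bool, if pairApply (walk f (extendWord w) k) p = q then (1 / 2 : ℝ) ^ k
        else 0 := by
  unfold pairMatrix wordMeasure
  have e : ∀ x : Perm (Fin n), (if pairApply x p = q then
      ∑ w : Fin k → Bool, (if walk f (extendWord w) k = x then (1 / 2 : ℝ) ^ k else 0) else 0) =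
      ∑ w : Fin k → Bool, if walk f (extendWord w) k = x then
        (if pairApply x p = q then (1 / 2 : ℝ) ^ k else 0) else 0 := by
    intro x
    split_ifs
    · rfl
    · simp
  simp only [e]
  rw [Finset.sum_comm]
  refine Finset.sum_congr rfl fun w _ => ?_
  rw [Finset.sum_ite_eq, if_pos (Finset.mem_univ _)]

theorem squareSum_wordMeasure (f : Bool → Perm (Fin n)) (k : ℕ) :
    squareSum (pairMatrix (wordMeasure f k)) =
      (1 / 4 : ℝ) ^ k * ∑ w : Fin k → Bool, ∑ w' : Fin k → Bool, ∑ p : DistinctPair n,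
        if pairApply (walk f (extendWord w) k) p = pairApply (walk f (extendWord w') k) p
          then 1 else 0 := by
  have h4 : (1 / 4 : ℝ) ^ k = (1 / 2) ^ k * (1 / 2) ^ k := by rw [← mul_pow]; norm_num
  have e : ∀ p q, pairMatrix (wordMeasure f k) p q ^ 2 =
      ∑ w : Fin k → Bool, ∑ w' : Fin k → Bool, if pairApply (walk f (extendWord w) k) p = q then
        (if pairApply (walk f (extendWord w) k) p = pairApply (walk f (extendWord w') k) p
          then (1 / 4 : ℝ) ^ k else 0) else 0 := by
    intro p q
    rw [pairMatrix_wordMeasure, sq, Finset.sum_mul_sum]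
    refine Finset.sum_congr rfl fun w _ => Finset.sum_congr rfl fun w' _ => ?_
    rw [h4]
    by_cases h1 : pairApply (walk f (extendWord w) k) p = q
    · rw [if_pos h1, if_pos h1, h1]
      by_cases h2 : pairApply (walk f (extendWord w') k) p = q
      · rw [if_pos h2, if_pos h2.symm]
      · rw [if_neg h2, if_neg (Ne.symm h2), mul_zero]
    · rw [if_neg h1, if_neg h1, zero_mul]
  unfold squareSum
  simp only [e]
  calc _ = ∑ p : DistinctPair n, ∑ w : Fin k → Bool, ∑ w' : Fin k → Bool,
        if pairApply (walk f (extendWord w) k) p = pairApply (walk f (extendWord w') k) p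
          then (1 / 4 : ℝ) ^ k else 0 := by
        refine Finset.sum_congr rfl fun p _ => ?_
        rw [Finset.sum_comm]
        refine Finset.sum_congr rfl fun w _ => ?_
        rw [Finset.sum_comm]
        refine Finset.sum_congr rfl fun w' _ => ?_
        rw [Finset.sum_ite_eq, if_pos (Finset.mem_univ _)]
    _ = _ := by
        rw [Finset.sum_comm, Finset.mul_sum]
        refine Finset.sum_congr rfl fun w _ => ?_
        rw [Finset.sum_comm, Finset.mul_sum]
        refine Finset.sum_congr rfl fun w' _ => ?_
        rw [Finset.mul_sum]
        refine Finset.sum_congr rfl fun p _ => ?_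
        rw [mul_ite, mul_one, mul_zero]

theorem one_le_squareSum {Ω : Type*} [Fintype Ω] [Nonempty Ω] (T : Matrix Ω Ω ℝ)
    (hrow : ∀ p, ∑ q, T p q = 1) : 1 ≤ squareSum T := by
  have hN : (0 : ℝ) < Fintype.card Ω := by exact_mod_cast Fintype.card_pos
  have h : ∀ p, 1 / (Fintype.card Ω : ℝ) ≤ ∑ q, T p q ^ 2 := by
    intro p
    have := sq_sum_le_card_mul_sum_sq (s := Finset.univ) (f := T p)
    rw [hrow, Finset.card_univ] at this
    rw [div_le_iff₀ hN]
    linarith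
  calc (1 : ℝ) = ∑ _p : Ω, 1 / (Fintype.card Ω : ℝ) := by simp [hN.ne']
    _ ≤ _ := Finset.sum_le_sum fun p _ => h p

theorem sum_squareSum_le {k : ℕ} (hk : 4 * k + 9 < n) :
    ∑ f : Bool → Perm (Fin n), squareSum (pairMatrix (wordMeasure f k)) ≤
      ((n : ℝ) * (n - 1) * (1 / 2) ^ k + n * (n - 1) *
        (1 / ((n : ℝ) - (4 * k + 9)) ^ 2 + ((4 * k + 9 : ℝ) ^ 2 / (n - (4 * k + 9))) ^ 3)) *
        (Fintype.card (Bool → Perm (Fin n)) : ℝ) := by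
  set κ : ℝ := 1 / ((n : ℝ) - (4 * k + 9)) ^ 2 + ((4 * k + 9 : ℝ) ^ 2 / (n - (4 * k + 9))) ^ 3
    with hκ
  set F : ℝ := (Fintype.card (Bool → Perm (Fin n)) : ℝ) with hF
  have hkn : (0 : ℝ) < n - (4 * k + 9) := by
    have : ((4 * k + 9 : ℕ) : ℝ) < n := by exact_mod_cast hk
    push_cast at this
    linarith
  have hκ0 : 0 ≤ κ := by positivity
  have hF0 : 0 ≤ F := by positivity
  have hone : ∀ (w w' : Fin k → Bool) (p : DistinctPair n),
      ∑ f : Bool → Perm (Fin n),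
        (if pairApply (walk f (extendWord w) k) p = pairApply (walk f (extendWord w') k) p
          then (1 : ℝ) else 0) ≤ (if w = w' then F else 0) + κ * F := by
    intro w w' p
    rw [Finset.sum_boole]
    by_cases h : w = w'
    · rw [if_pos h]
      have : (((Finset.univ : Finset (Bool → Perm (Fin n))).filter fun f =>
          pairApply (walk f (extendWord w) k) p = pairApply (walk f (extendWord w') k) p).card : ℝ)
          ≤ F := by
        rw [hF]
        exact_mod_cast Finset.card_le_univ _
      have := mul_nonneg hκ0 hF0
      linarith
    · rw [if_neg h, zero_add]
      obtain ⟨i, hi⟩ := Function.ne_iff.mp h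
      have h2 : ∃ i < k, extendWord w i ≠ extendWord w' i := by
        refine ⟨i, i.2, ?_⟩
        simpa [extendWord] using hi
      refine le_trans (le_of_eq ?_) (card_agree_le hk p.2 h2)
      congr 2
      ext f
      simp only [Finset.mem_filter, Finset.mem_univ, true_and]
      rw [pairApply_eq_iff]
      rfl
  simp only [squareSum_wordMeasure]
  rw [← Finset.mul_sum]
  have hsum : ∑ f : Bool → Perm (Fin n), ∑ w : Fin k → Bool, ∑ w' : Fin k → Bool,
      ∑ p : DistinctPair n,
        (if pairApply (walk f (extendWord w) k) p = pairApply (walk f (extendWord w') k) p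
          then (1 : ℝ) else 0) ≤
      ∑ w : Fin k → Bool, ∑ w' : Fin k → Bool, ∑ p : DistinctPair n,
        ((if w = w' then F else 0) + κ * F) := by
    rw [Finset.sum_comm]
    refine Finset.sum_le_sum fun w _ => ?_
    rw [Finset.sum_comm]
    refine Finset.sum_le_sum fun w' _ => ?_
    rw [Finset.sum_comm]
    exact Finset.sum_le_sum fun p _ => hone w w' p
  refine (mul_le_mul_of_nonneg_left hsum (by positivity)).trans (le_of_eq ?_)
  simp only [Finset.sum_const, Finset.card_univ, nsmul_eq_mul, card_distinctPair]
  simp only [← Finset.mul_sum, Finset.sum_add_distrib, Finset.sum_ite_eq, Finset.mem_univ,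
    if_true, Finset.sum_const, Finset.card_univ, nsmul_eq_mul]
  have hc : (Fintype.card (Fin k → Bool) : ℝ) = 2 ^ k := by simp
  rw [hc]
  have h4 : (1 / 4 : ℝ) ^ k = (1 / 2) ^ k * (1 / 2) ^ k := by rw [← mul_pow]; norm_num
  have h2 : (1 / 2 : ℝ) ^ k * 2 ^ k = 1 := by rw [← mul_pow]; norm_num
  rw [h4]
  linear_combination (n * (n - 1) * F * (1 / 2) ^ k + n * (n - 1) * (κ * F) *
    ((1 / 2 : ℝ) ^ k * 2 ^ k + 1)) * h2

end RandomWord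

section PairMixing

variable {n : ℕ}

theorem exists_isPairMixing (hn : 2 ≤ n) {f : Bool → Perm (Fin n)} {k : ℕ}
    (h : squareSum (pairMatrix (wordMeasure f k)) ≤ 5 / 4) :
    ∃ ν, IsPairMixing (genSet (f true) (f false)) (4 * Nat.clog 2 n * (k + k)) ν := by
  set T := pairMatrix (wordMeasure f k) with hT
  have hS := inv_mem_genSet (f true) (f false)
  have hTw : IsWordMatrix (genSet (f true) (f false)) k T := isWordMatrix_wordMeasure f k
  obtain ⟨ν, h0, h1, h2, h3⟩ := (hTw.mul (hTw.transpose hS)).pow (4 * Nat.clog 2 n)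
  have hn' : (2 : ℝ) ≤ n := by exact_mod_cast hn
  have hcl : 1 ≤ Nat.clog 2 n := Nat.clog_pos (by norm_num) hn
  have hne : Nonempty (DistinctPair n) :=
    ⟨⟨(⟨0, by omega⟩, ⟨1, by omega⟩), by simp [Fin.ext_iff]⟩⟩
  have hsmall : ∀ p q, |pairMatrix ν p q - 1 / (n * (n - 1))| ≤ 0.1 / ((n : ℝ) * (n - 1)) := by
    intro p q
    have h4 := exists_pow_eq_add T hTw.sum_row (hTw.sum_col hS) (4 * Nat.clog 2 n - 1) p q
    rw [Nat.sub_add_cancel (by omega), card_distinctPair] at h4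
    rw [← h3]
    refine h4.trans ?_
    have h5 := one_le_squareSum T hTw.sum_row
    have h6 : (squareSum T - 1) ^ (4 * Nat.clog 2 n) ≤ (1 / 4) ^ (4 * Nat.clog 2 n) :=
      pow_le_pow_left₀ (by linarith) (by linarith) _
    refine h6.trans ?_
    have h7 : (n : ℝ) ≤ 2 ^ Nat.clog 2 n := by
      exact_mod_cast Nat.le_pow_clog (by norm_num) n
    have h8 : ((1 : ℝ) / 4) ^ (4 * Nat.clog 2 n) = 1 / (2 ^ Nat.clog 2 n) ^ 8 := by
      rw [one_div_pow, ← pow_mul, show (4 : ℝ) = 2 ^ 2 by norm_num, ← pow_mul]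
      congr 2
      ring
    have h9 : (n : ℝ) ^ 8 ≤ (2 ^ Nat.clog 2 n) ^ 8 := pow_le_pow_left₀ (by positivity) h7 8
    have h10 : (2 : ℝ) ^ 6 ≤ (n : ℝ) ^ 6 := pow_le_pow_left₀ (by norm_num) hn' 6
    rw [h8, div_le_div_iff₀ (by positivity) (by nlinarith)]
    nlinarith [mul_le_mul_of_nonneg_left h10 (sq_nonneg (n : ℝ))]
  have hentry : ∀ p₁ p₂ q₁ q₂ : Fin n, ∀ (hp : p₁ ≠ p₂) (hq : q₁ ≠ q₂),
      (∑ x, if x p₁ = q₁ ∧ x p₂ = q₂ then ν x else 0) =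
        pairMatrix ν ⟨(p₁, p₂), hp⟩ ⟨(q₁, q₂), hq⟩ := by
    intro p₁ p₂ q₁ q₂ hp hq
    refine Finset.sum_congr rfl fun x _ => ?_
    exact if_congr (pairApply_eq_iff x ⟨(p₁, p₂), hp⟩ ⟨(q₁, q₂), hq⟩).symm rfl rfl
  refine ⟨ν, h0, h1, h2, fun p₁ p₂ q₁ q₂ hp hq => ?_, fun p₁ p₂ q₁ q₂ hp hq => ?_⟩
  · rw [hentry _ _ _ _ hp hq]
    have h4 := (abs_le.mp (hsmall ⟨(p₁, p₂), hp⟩ ⟨(q₁, q₂), hq⟩)).1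
    have h5 : 0.9 / ((n : ℝ) * (n - 1)) = 1 / (n * (n - 1)) - 0.1 / ((n : ℝ) * (n - 1)) := by
      rw [← sub_div]; norm_num
    linarith
  · rw [hentry _ _ _ _ hp hq]
    have h4 := (abs_le.mp (hsmall ⟨(p₁, p₂), hp⟩ ⟨(q₁, q₂), hq⟩)).2
    have h5 : 1.1 / ((n : ℝ) * (n - 1)) = 1 / (n * (n - 1)) + 0.1 / ((n : ℝ) * (n - 1)) := by
      rw [← add_div]; norm_num
    linarith

theorem card_not_isPairMixing_le {k : ℕ} (hn : 2 ≤ n) (hk : 4 * k + 9 < n) :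
    ((Finset.univ.filter fun f : Bool → Perm (Fin n) =>
      ¬ ∃ ν, IsPairMixing (genSet (f true) (f false)) (4 * Nat.clog 2 n * (k + k)) ν).card : ℝ) ≤
      4 * ((n : ℝ) * (n - 1) * (1 / 2) ^ k + n * (n - 1) *
        (1 / ((n : ℝ) - (4 * k + 9)) ^ 2 + ((4 * k + 9 : ℝ) ^ 2 / (n - (4 * k + 9))) ^ 3) - 1) *
        (Fintype.card (Bool → Perm (Fin n)) : ℝ) := by
  have hne : Nonempty (DistinctPair n) :=
    ⟨⟨(⟨0, by omega⟩, ⟨1, by omega⟩), by simp [Fin.ext_iff]⟩⟩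
  have h1 : ∀ f : Bool → Perm (Fin n),
      (if ¬ ∃ ν, IsPairMixing (genSet (f true) (f false)) (4 * Nat.clog 2 n * (k + k)) ν
        then (1 : ℝ) else 0) ≤ 4 * (squareSum (pairMatrix (wordMeasure f k)) - 1) := by
    intro f
    have h2 := one_le_squareSum _ (isWordMatrix_wordMeasure f k).sum_row
    by_cases h : ∃ ν, IsPairMixing (genSet (f true) (f false)) (4 * Nat.clog 2 n * (k + k)) ν
    · rw [if_neg (not_not.mpr h)]
      linarith
    · rw [if_pos h]
      by_contra! h3
      exact h (exists_isPairMixing hn (by linarith))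
  rw [← Finset.sum_boole]
  refine (Finset.sum_le_sum fun f _ => h1 f).trans ?_
  rw [← Finset.mul_sum, Finset.sum_sub_distrib, mul_assoc]
  refine mul_le_mul_of_nonneg_left ?_ (by norm_num)
  have := sum_squareSum_le hk
  rw [Finset.sum_const, Finset.card_univ, nsmul_eq_mul, mul_one, sub_mul, one_mul]
  linarith

theorem nat_clog_le {n : ℕ} (hn : 3 ≤ n) : (Nat.clog 2 n : ℝ) ≤ 3 * Real.log n := by
  have h1 : 1 ≤ Nat.clog 2 n := Nat.clog_pos (by norm_num) (by omega)
  have h2 : 2 ^ (Nat.clog 2 n - 1) < n := by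
    have := Nat.pow_pred_clog_lt_self (b := 2) (x := n) (by norm_num) (by omega)
    simpa using this
  have h3 : ((Nat.clog 2 n : ℝ) - 1) * Real.log 2 ≤ Real.log n := by
    have h4 : ((2 : ℝ)) ^ (Nat.clog 2 n - 1) ≤ n := by exact_mod_cast h2.le
    have h5 := Real.log_le_log (by positivity) h4
    rw [Real.log_pow, Nat.cast_sub h1] at h5
    simpa using h5
  have h4 : (1 : ℝ) ≤ Real.log n := by
    rw [Real.le_log_iff_exp_le (by positivity)]
    have h5 : (3 : ℝ) ≤ n := by exact_mod_cast hn
    linarith [Real.exp_one_lt_d9]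
  have h5 := Real.log_two_gt_d9
  have h6 : (1 : ℝ) ≤ Nat.clog 2 n := by exact_mod_cast h1
  nlinarith

theorem one_le_log {n : ℕ} (hn : 3 ≤ n) : (1 : ℝ) ≤ Real.log n := by
  rw [Real.le_log_iff_exp_le (by positivity)]
  have h5 : (3 : ℝ) ≤ n := by exact_mod_cast hn
  linarith [Real.exp_one_lt_d9]

theorem eventually_mul_log_pow_le (a : ℕ) {ε : ℝ} (hε : 0 < ε) :
    ∀ᶠ n : ℕ in Filter.atTop, Real.log n ^ a ≤ ε * n := by
  have h := (Real.isLittleO_pow_log_id_atTop (n := a)).bound hε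
  filter_upwards [tendsto_natCast_atTop_atTop.eventually h] with n hn
  have h2 := (le_abs_self _).trans hn
  simpa using h2

theorem eventually_isPairMixing {ε : ℝ} (hε : 0 < ε) :
    ∀ᶠ n : ℕ in Filter.atTop, ((Finset.univ.filter fun f : Bool → Perm (Fin n) =>
      ¬ ∃ ν, IsPairMixing (genSet (f true) (f false)) (24 * (Nat.clog 2 n) ^ 2) ν).card : ℝ) ≤
        ε * (Fintype.card (Bool → Perm (Fin n)) : ℝ) := by
  filter_upwards [Filter.eventually_ge_atTop 3,
    eventually_mul_log_pow_le 6 (show 0 < min ε 1 / (68 * 45 ^ 6) by positivity)] with n hn hlog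
  set k := 3 * Nat.clog 2 n with hk
  set K : ℝ := 4 * k + 9 with hK
  have hL := one_le_log hn
  have hK1 : 1 ≤ K := by
    have : (0 : ℝ) ≤ k := by positivity
    linarith
  have hKL : K ≤ 45 * Real.log n := by
    have := nat_clog_le hn
    rw [hK, hk]
    push_cast
    linarith
  have hK6 : 68 * K ^ 6 ≤ min ε 1 * n := by
    have h1 : K ^ 6 ≤ (45 * Real.log n) ^ 6 := pow_le_pow_left₀ (by linarith) hKL 6
    rw [mul_pow] at h1
    rw [div_mul_eq_mul_div, le_div_iff₀ (by positivity)] at hlog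
    linarith
  have hn0 : (0 : ℝ) < n := by positivity
  have hKK : K ≤ K ^ 6 := le_self_pow₀ hK1 (by norm_num)
  have hK2 : 2 * K ≤ n := by
    have h1 : min ε 1 * n ≤ 1 * n := mul_le_mul_of_nonneg_right (min_le_right _ _) hn0.le
    linarith
  have hkn : 4 * k + 9 < n := by
    have : ((4 * k + 9 : ℕ) : ℝ) < n := by push_cast; linarith
    exact_mod_cast this
  have hmain := card_not_isPairMixing_le (by omega) hkn
  rw [show 4 * Nat.clog 2 n * (k + k) = 24 * (Nat.clog 2 n) ^ 2 by rw [hk]; ring] at hmain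
  refine hmain.trans (mul_le_mul_of_nonneg_right ?_ (by positivity))
  rw [← hK]
  have hpow : (n : ℝ) * (n - 1) * (1 / 2) ^ k ≤ 1 / n := by
    have h7 : (n : ℝ) ≤ 2 ^ Nat.clog 2 n := by
      exact_mod_cast Nat.le_pow_clog (by norm_num) n
    have h9 : (n : ℝ) ^ 3 ≤ (2 ^ Nat.clog 2 n) ^ 3 := pow_le_pow_left₀ (by positivity) h7 3
    have h8 : ((1 : ℝ) / 2) ^ k = 1 / (2 ^ Nat.clog 2 n) ^ 3 := by
      rw [one_div_pow, ← pow_mul, hk, mul_comm]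
    rw [h8, mul_one_div, div_le_div_iff₀ (by positivity) hn0]
    nlinarith
  have hnK : (n : ℝ) / 2 ≤ n - K := by linarith
  have hnK0 : (0 : ℝ) < n - K := by linarith
  have h1 : (n : ℝ) * (n - 1) * (1 / (n - K) ^ 2) - 1 ≤ 8 * K / n := by
    rw [mul_one_div, div_sub_one (by positivity), div_le_div_iff₀ (by positivity) hn0]
    have h2 : ((n : ℝ) / 2) ^ 2 ≤ (n - K) ^ 2 := pow_le_pow_left₀ (by positivity) hnK 2
    have h3 : (n : ℝ) * (n - 1) - (n - K) ^ 2 ≤ 2 * n * K := by nlinarith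
    calc _ ≤ 2 * n * K * n := mul_le_mul_of_nonneg_right h3 hn0.le
      _ = 8 * K * (n / 2) ^ 2 := by ring
      _ ≤ _ := mul_le_mul_of_nonneg_left h2 (by linarith)
  have h2 : (n : ℝ) * (n - 1) * (K ^ 2 / (n - K)) ^ 3 ≤ 8 * K ^ 6 / n := by
    have h3 : ((n : ℝ) / 2) ^ 3 ≤ (n - K) ^ 3 := pow_le_pow_left₀ (by positivity) hnK 3
    rw [div_pow, mul_div_assoc', div_le_div_iff₀ (by positivity) hn0]
    calc (n : ℝ) * (n - 1) * (K ^ 2) ^ 3 * n ≤ n * n * (K ^ 2) ^ 3 * n := by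
          gcongr
          linarith
      _ = 8 * K ^ 6 * (n / 2) ^ 3 := by ring
      _ ≤ _ := mul_le_mul_of_nonneg_left h3 (by positivity)
  have h3 : 4 * (1 / n + 8 * K / n + 8 * K ^ 6 / n) ≤ min ε 1 := by
    rw [← add_div, ← add_div, mul_div_assoc', div_le_iff₀ hn0]
    linarith
  have h4 := min_le_left ε 1
  rw [mul_add ((n : ℝ) * (n - 1))]
  linarith

end PairMixing

section PermsOn

variable {n : ℕ}

/-- The permutations fixing every point outside `Z`. -/
noncomputable def permsOn (Z : Finset (Fin n)) : Finset (Perm (Fin n)) :=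
  Finset.univ.filter fun u => ∀ e ∉ Z, u e = e

theorem mem_permsOn {Z : Finset (Fin n)} {u : Perm (Fin n)} :
    u ∈ permsOn Z ↔ ∀ e ∉ Z, u e = e := by simp [permsOn]

theorem mul_mem_permsOn {Z : Finset (Fin n)} {u v : Perm (Fin n)} (hu : u ∈ permsOn Z)
    (hv : v ∈ permsOn Z) : u * v ∈ permsOn Z := by
  rw [mem_permsOn] at *
  intro e he
  rw [Perm.mul_apply, hv e he, hu e he]

theorem inv_mem_permsOn {Z : Finset (Fin n)} {u : Perm (Fin n)} (hu : u ∈ permsOn Z) :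
    u⁻¹ ∈ permsOn Z := by
  rw [mem_permsOn] at *
  intro e he
  rw [Perm.inv_eq_iff_eq, hu e he]

theorem permsOn_univ : permsOn (Finset.univ : Finset (Fin n)) = Finset.univ := by
  ext u
  simp [mem_permsOn]

theorem permsOn_empty : permsOn (∅ : Finset (Fin n)) = {1} := by
  ext u
  simp [mem_permsOn, Equiv.ext_iff]

theorem permsOn_singleton (a : Fin n) : permsOn {a} = {1} := by
  ext u
  simp only [mem_permsOn, Finset.mem_singleton]
  constructor
  · intro h
    have ha : u a = a := by
      by_contra hne
      exact hne (u.injective (h _ hne))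
    ext x
    by_cases hx : x = a
    · rw [hx, ha]
      rfl
    · rw [h x hx]
      rfl
  · rintro rfl e _
    rfl

theorem mul_swap_mem_permsOn {Z : Finset (Fin n)} {e : Fin n} {u : Perm (Fin n)}
    (hu : u ∈ permsOn (insert e Z)) : u * swap e (u⁻¹ e) ∈ permsOn Z := by
  rw [mem_permsOn] at *
  intro x hx
  by_cases hxe : x = e
  · rw [hxe, Perm.mul_apply, swap_apply_left, perm_apply_inv_apply]
  · have h1 := hu x (by simp [hx, hxe])
    have h2 : x ≠ u⁻¹ e := by
      intro h
      rw [h, perm_apply_inv_apply, ← h] at h1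
      exact hxe h1.symm
    rw [Perm.mul_apply, swap_apply_of_ne_of_ne hxe h2, h1]

theorem mul_swap_mem_permsOn_insert {Z : Finset (Fin n)} {e p : Fin n} {u : Perm (Fin n)}
    (hu : u ∈ permsOn Z) (hp : p ∈ insert e Z) : u * swap e p ∈ permsOn (insert e Z) := by
  rw [mem_permsOn] at *
  intro x hx
  have h1 : x ≠ p := fun h => hx (h ▸ hp)
  simp only [Finset.mem_insert, not_or] at hx
  rw [Perm.mul_apply, swap_apply_of_ne_of_ne hx.1 h1, hu x hx.2]

theorem sum_permsOn_insert {Z : Finset (Fin n)} {e : Fin n} (he : e ∉ Z)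
    (F : Perm (Fin n) → ℝ) :
    ∑ u ∈ permsOn (insert e Z), F u =
      ∑ p ∈ insert e Z, ∑ u ∈ permsOn Z, F (u * swap e p) := by
  rw [← Finset.sum_product']
  symm
  have hinv : ∀ u ∈ permsOn Z, ∀ p, (u * swap e p)⁻¹ e = p := by
    intro u hu p
    rw [Perm.inv_eq_iff_eq, Perm.mul_apply, swap_apply_right, mem_permsOn.mp hu e he]
  refine Finset.sum_bij' (fun q _ => q.2 * swap e q.1)
    (fun u _ => (u⁻¹ e, u * swap e (u⁻¹ e))) ?_ ?_ ?_ ?_ ?_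
  · intro q hq
    rw [Finset.mem_product] at hq
    exact mul_swap_mem_permsOn_insert hq.2 hq.1
  · intro u hu
    rw [Finset.mem_product]
    refine ⟨?_, mul_swap_mem_permsOn hu⟩
    by_contra h
    have := mem_permsOn.mp hu _ h
    rw [perm_apply_inv_apply] at this
    exact h (by rw [← this]; exact Finset.mem_insert_self _ _)
  · intro q hq
    rw [Finset.mem_product] at hq
    ext1
    · exact hinv _ hq.2 _
    · dsimp only
      rw [hinv _ hq.2, mul_assoc, swap_mul_self, mul_one]
  · intro u _
    dsimp only
    rw [mul_assoc, swap_mul_self, mul_one]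
  · intro q _
    rfl

theorem card_permsOn (Z : Finset (Fin n)) : ((permsOn Z).card : ℝ) = Z.card.factorial := by
  induction Z using Finset.induction_on with
  | empty => simp [permsOn_empty]
  | insert e Z he ih =>
    rw [Finset.card_eq_sum_ones, Nat.cast_sum, Finset.card_insert_of_notMem he,
      Nat.factorial_succ, Nat.cast_mul, ← ih, sum_permsOn_insert he (fun _ => ((1 : ℕ) : ℝ))]
    simp [he]

theorem sum_permsOn_of_mul_swap {X Z : Finset (Fin n)} (hXZ : Disjoint X Z)
    {F : Perm (Fin n) → ℝ}
    (hF : ∀ e ∉ X, ∀ u p, u e = e → F (u * swap e p) = F u) :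
    (X.card.factorial : ℝ) * ∑ u ∈ permsOn (X ∪ Z), F u =
      ((X ∪ Z).card.factorial : ℝ) * ∑ u ∈ permsOn X, F u := by
  induction Z using Finset.induction_on with
  | empty => simp
  | insert e Z he ih =>
    rw [Finset.disjoint_insert_right] at hXZ
    have he' : e ∉ X ∪ Z := by simp [he, hXZ.1]
    rw [Finset.union_insert, sum_permsOn_insert he']
    have h1 : ∀ p ∈ insert e (X ∪ Z), ∑ u ∈ permsOn (X ∪ Z), F (u * swap e p) =
        ∑ u ∈ permsOn (X ∪ Z), F u := fun p _ =>
      Finset.sum_congr rfl fun u hu => hF e hXZ.1 u p (mem_permsOn.mp hu e he')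
    rw [Finset.sum_congr rfl h1, Finset.sum_const, Finset.card_insert_of_notMem he',
      Nat.factorial_succ, nsmul_eq_mul, Nat.cast_mul, mul_assoc, ← ih hXZ.2]
    ring

theorem sameCycle_of_forall {α : Type*} {v w : Perm α} {r : α → α}
    (h : ∀ z, w.SameCycle (r z) (r (v z))) {x y : α} (hxy : v.SameCycle x y) :
    w.SameCycle (r x) (r y) := by
  obtain ⟨i, rfl⟩ := hxy
  induction i with
  | zero => exact Perm.SameCycle.refl _ _
  | succ i ih =>
    refine ih.trans ?_
    rw [add_comm, zpow_add, zpow_one, Perm.mul_apply]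
    exact h _
  | pred i ih =>
    refine ih.trans ?_
    have h1 := h ((v ^ (-(i : ℤ) - 1)) x)
    rw [← Perm.mul_apply, ← zpow_one_add, add_sub_cancel] at h1
    exact h1.symm

theorem sameCycle_mul_swap {α : Type*} [DecidableEq α] {w : Perm α} {e : α} (he : w e = e) (p : α)
    {x y : α} (hx : x ≠ e) (hy : y ≠ e) :
    (w * swap e p).SameCycle x y ↔ w.SameCycle x y := by
  have hwe : ∀ z, z ≠ e → w z ≠ e := fun z hz h => hz (w.injective (h.trans he.symm))
  by_cases hp : p = e
  · rw [hp, swap_self]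
    exact Iff.rfl
  constructor
  · intro h
    have h1 := sameCycle_of_forall (w := w) (r := fun z => if z = e then p else z) (fun z => ?_) h
    · rwa [if_neg hx, if_neg hy] at h1
    · by_cases hz : z = e
      · rw [hz, Perm.mul_apply, swap_apply_left, if_pos rfl, if_neg (hwe p hp)]
        exact Perm.sameCycle_apply_right.mpr (Perm.SameCycle.refl _ _)
      · by_cases hzp : z = p
        · rw [hzp, Perm.mul_apply, swap_apply_right, he, if_pos rfl, if_neg hp]
        · rw [Perm.mul_apply, swap_apply_of_ne_of_ne hz hzp, if_neg hz, if_neg (hwe z hz)]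
          exact Perm.sameCycle_apply_right.mpr (Perm.SameCycle.refl _ _)
  · intro h
    refine sameCycle_of_forall (w := w * swap e p) (r := id) (fun z => ?_) h
    dsimp only [id]
    by_cases hz : z = e
    · rw [hz, he]
    · by_cases hzp : z = p
      · have h1 : w p = (w * swap e p) ((w * swap e p) p) := by
          rw [Perm.mul_apply, Perm.mul_apply, swap_apply_right, he, swap_apply_left]
        rw [hzp, h1, Perm.sameCycle_apply_right, Perm.sameCycle_apply_right]
      · have h1 : w z = (w * swap e p) z := by
          rw [Perm.mul_apply, swap_apply_of_ne_of_ne hz hzp]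
        rw [h1, Perm.sameCycle_apply_right]

/-- All points of `A` lie in one cycle of `u`. -/
def AllSame (u : Perm (Fin n)) (A : Finset (Fin n)) : Prop := ∀ a ∈ A, ∀ b ∈ A, u.SameCycle a b

theorem allSame_mul_swap {w : Perm (Fin n)} {e : Fin n} (he : w e = e) (p : Fin n)
    {A : Finset (Fin n)} (hA : e ∉ A) : AllSame (w * swap e p) A ↔ AllSame w A := by
  have h : ∀ a ∈ A, a ≠ e := fun a ha h => hA (h ▸ ha)
  exact forall₂_congr fun a ha => forall₂_congr fun b hb => sameCycle_mul_swap he p (h a ha) (h b hb)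

theorem allSame_insert_mul_swap {w : Perm (Fin n)} {e p : Fin n} {A : Finset (Fin n)}
    (he : w e = e) (hA : e ∉ A) (hp : p ∈ A) :
    AllSame (w * swap e p) (insert e A) ↔ AllSame w A := by
  rw [← allSame_mul_swap he p hA]
  constructor
  · exact fun h a ha b hb => h a (Finset.mem_insert_of_mem ha) b (Finset.mem_insert_of_mem hb)
  · intro h
    have h1 : ∀ a ∈ insert e A, (w * swap e p).SameCycle a p := by
      intro a ha
      rcases Finset.mem_insert.mp ha with rfl | ha
      · have h2 : (w * swap a p) p = a := by rw [Perm.mul_apply, swap_apply_right, he]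
        conv =>
          arg 2
          rw [← h2]
        exact Perm.sameCycle_apply_left.mpr (Perm.SameCycle.refl _ _)
      · exact h a ha p hp
    exact fun a ha b hb => (h1 a ha).trans (h1 b hb).symm

/-- The sum of a multiplicative character over the permutations on `X` having all points of `A`
in one cycle. -/
noncomputable def charSum (χ : Perm (Fin n) →* ℤˣ) (X A : Finset (Fin n)) : ℝ :=
  ∑ u ∈ permsOn X, ((χ u : ℤ) : ℝ) * if AllSame u A then 1 else 0

variable {χ : Perm (Fin n) →* ℤˣ} {c : ℝ}

theorem charSum_insert (hχ : ∀ e p, e ≠ p → ((χ (swap e p) : ℤ) : ℝ) = c) {X A : Finset (Fin n)}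
    {e : Fin n} (he : e ∉ X) (hA : A ⊆ X) :
    charSum χ (insert e X) A = (1 + X.card * c) * charSum χ X A := by
  have h : ∀ p ∈ insert e X, ∑ u ∈ permsOn X, ((χ (u * swap e p) : ℤ) : ℝ) *
      (if AllSame (u * swap e p) A then 1 else 0) = ((χ (swap e p) : ℤ) : ℝ) * charSum χ X A := by
    intro p _
    rw [charSum, Finset.mul_sum]
    refine Finset.sum_congr rfl fun u hu => ?_
    rw [if_congr (allSame_mul_swap (mem_permsOn.mp hu e he) p (fun h => he (hA h))) rfl rfl,
      map_mul]
    push_cast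
    ring
  rw [charSum, sum_permsOn_insert he, Finset.sum_congr rfl h, Finset.sum_insert he, swap_self]
  have h2 : ∀ p ∈ X, ((χ (swap e p) : ℤ) : ℝ) * charSum χ X A = c * charSum χ X A :=
    fun p hp => by rw [hχ e p (fun h => he (h ▸ hp))]
  rw [Finset.sum_congr rfl h2, Finset.sum_const, nsmul_eq_mul]
  have h3 : χ (Equiv.refl (Fin n)) = 1 := map_one χ
  rw [h3]
  push_cast
  ring

theorem charSum_insert_insert (hχ : ∀ e p, e ≠ p → ((χ (swap e p) : ℤ) : ℝ) = c)
    {A : Finset (Fin n)} {e : Fin n} (he : e ∉ A) (hA : A.Nonempty) :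
    charSum χ (insert e A) (insert e A) = A.card * c * charSum χ A A := by
  have h : ∀ p ∈ A, ∑ u ∈ permsOn A, ((χ (u * swap e p) : ℤ) : ℝ) *
      (if AllSame (u * swap e p) (insert e A) then 1 else 0) = c * charSum χ A A := by
    intro p hp
    rw [charSum, Finset.mul_sum]
    refine Finset.sum_congr rfl fun u hu => ?_
    rw [if_congr (allSame_insert_mul_swap (mem_permsOn.mp hu e he) he hp) rfl rfl,
      map_mul, ← hχ e p (fun h => he (h ▸ hp))]
    push_cast
    ring
  rw [charSum, sum_permsOn_insert he, Finset.sum_insert he, Finset.sum_congr rfl h,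
    Finset.sum_const, nsmul_eq_mul, swap_self, Finset.sum_eq_zero, zero_add, mul_assoc]
  intro u hu
  rw [if_neg, mul_zero]
  intro h2
  obtain ⟨a, ha⟩ := hA
  have h3 := h2 e (Finset.mem_insert_self _ _) a (Finset.mem_insert_of_mem ha)
  exact he ((h3.eq_of_left (mem_permsOn.mp hu e he)) ▸ ha)

theorem charSum_self_one (hχ : ∀ e p, e ≠ p → ((χ (swap e p) : ℤ) : ℝ) = c) (hc : |c| = 1)
    {A : Finset (Fin n)} (hA : A.Nonempty) :
    |charSum χ A A| = (A.card - 1).factorial ∧ (c = 1 → 0 ≤ charSum χ A A) := by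
  induction hA using Finset.Nonempty.cons_induction with
  | singleton a => simp [charSum, permsOn_singleton, AllSame]
  | cons e A he hA ih =>
    rw [Finset.cons_eq_insert, charSum_insert_insert hχ he hA, Finset.card_insert_of_notMem he,
      Nat.add_sub_cancel, abs_mul, abs_mul, hc, ih.1]
    refine ⟨?_, fun h => ?_⟩
    · rw [← Nat.mul_factorial_pred (Finset.card_pos.mpr hA).ne']
      simp
    · have := ih.2 h
      rw [h]
      positivity

theorem charSum_one_eq {A B : Finset (Fin n)} (hA : A.Nonempty) (hAB : Disjoint A B) :
    (A.card : ℝ) * charSum 1 (A ∪ B) A = (A ∪ B).card.factorial := by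
  have hχ : ∀ e p : Fin n, e ≠ p → (((1 : Perm (Fin n) →* ℤˣ) (swap e p) : ℤ) : ℝ) = 1 := by simp
  induction B using Finset.induction_on with
  | empty =>
    obtain ⟨h1, h2⟩ := charSum_self_one hχ (by simp) hA
    rw [abs_of_nonneg (h2 rfl)] at h1
    rw [Finset.union_empty, h1, ← Nat.mul_factorial_pred (Finset.card_pos.mpr hA).ne']
    simp
  | insert e B he ih =>
    rw [Finset.disjoint_insert_right] at hAB
    have he' : e ∉ A ∪ B := by simp [he, hAB.1]
    rw [Finset.union_insert, charSum_insert hχ he' Finset.subset_union_left,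
      Finset.card_insert_of_notMem he', Nat.factorial_succ, Nat.cast_mul, ← ih hAB.2]
    push_cast
    ring

theorem abs_charSum_sign_eq {A B : Finset (Fin n)} (hA : A.Nonempty) (hAB : Disjoint A B) :
    ((A ∪ B).card : ℝ) * ((A ∪ B).card - 1) * |charSum Perm.sign (A ∪ B) A| =
      (A.card - 1) * (A ∪ B).card.factorial := by
  have hχ : ∀ e p : Fin n, e ≠ p → ((Perm.sign (swap e p) : ℤ) : ℝ) = -1 := by
    intro e p h
    rw [Perm.sign_swap h]
    simp
  have hApos := Finset.card_pos.mpr hA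
  induction B using Finset.induction_on with
  | empty =>
    rw [Finset.union_empty, (charSum_self_one hχ (by simp) hA).1,
      ← Nat.mul_factorial_pred hApos.ne']
    push_cast
    ring
  | insert e B he ih =>
    rw [Finset.disjoint_insert_right] at hAB
    have he' : e ∉ A ∪ B := by simp [he, hAB.1]
    have h1 : (1 : ℝ) ≤ (A ∪ B).card := by
      exact_mod_cast hApos.trans_le (Finset.card_le_card Finset.subset_union_left)
    rw [Finset.union_insert, charSum_insert hχ he' Finset.subset_union_left,
      Finset.card_insert_of_notMem he', Nat.factorial_succ, Nat.cast_mul, abs_mul,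
      abs_of_nonpos (by linarith : 1 + ((A ∪ B).card : ℝ) * -1 ≤ 0)]
    push_cast
    linear_combination ((A ∪ B).card + 1 : ℝ) * ih hAB.2

end PermsOn

section AlternatingAverage

variable {n : ℕ}

theorem sum_permsOn_mul_right {X : Finset (Fin n)} {v : Perm (Fin n)} (hv : v ∈ permsOn X)
    (F : Perm (Fin n) → ℝ) : ∑ σ ∈ permsOn X, F (σ * v) = ∑ σ ∈ permsOn X, F σ :=
  Finset.sum_bij' (fun σ _ => σ * v) (fun σ _ => σ * v⁻¹)
    (fun _ hσ => mul_mem_permsOn hσ hv) (fun _ hσ => mul_mem_permsOn hσ (inv_mem_permsOn hv))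
    (fun _ _ => mul_inv_cancel_right _ _) (fun _ _ => inv_mul_cancel_right _ _) (fun _ _ => rfl)

theorem swap_mem_permsOn {X : Finset (Fin n)} {a b : Fin n} (ha : a ∈ X) (hb : b ∈ X) :
    swap a b ∈ permsOn X :=
  mem_permsOn.mpr fun _ he =>
    swap_apply_of_ne_of_ne (fun h => he (h ▸ ha)) (fun h => he (h ▸ hb))

theorem sum_sign_permsOn {X : Finset (Fin n)} (hX : 2 ≤ X.card) :
    ∑ σ ∈ permsOn X, ((Perm.sign σ : ℤ) : ℝ) = 0 := by
  obtain ⟨a, ha, b, hb, hab⟩ := Finset.one_lt_card.mp hX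
  have h := sum_permsOn_mul_right (swap_mem_permsOn ha hb) fun σ => ((Perm.sign σ : ℤ) : ℝ)
  simp only [map_mul, Perm.sign_swap hab, Units.val_neg, mul_neg, mul_one,
    Int.cast_neg, Finset.sum_neg_distrib] at h
  linarith

theorem one_add_sign_nonneg (σ : Perm (Fin n)) : 0 ≤ 1 + ((Perm.sign σ : ℤ) : ℝ) := by
  rcases Int.units_eq_one_or (Perm.sign σ) with h | h <;> simp [h]

theorem sum_one_add_sign_permsOn {X : Finset (Fin n)} (hX : 2 ≤ X.card) :
    ∑ σ ∈ permsOn X, (1 + ((Perm.sign σ : ℤ) : ℝ)) = X.card.factorial := by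
  rw [Finset.sum_add_distrib, sum_sign_permsOn hX, ← card_permsOn]
  simp

/-- The deviation from `1 / A.card` of the proportion of even permutations `σ` on `X` for which
`A` lies in one cycle of `σ * u`, multiplied by the factorial of `X.card`. -/
noncomputable def altDev (X A : Finset (Fin n)) (u : Perm (Fin n)) : ℝ :=
  ∑ σ ∈ permsOn X, (1 + ((Perm.sign σ : ℤ) : ℝ)) *
    ((if AllSame (σ * u) A then 1 else 0) - 1 / (A.card : ℝ))

theorem abs_altDev_le {X A : Finset (Fin n)} (hX : 2 ≤ X.card) (u : Perm (Fin n)) :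
    |altDev X A u| ≤ X.card.factorial := by
  rw [← sum_one_add_sign_permsOn hX]
  refine (Finset.abs_sum_le_sum_abs _ _).trans (Finset.sum_le_sum fun σ _ => ?_)
  rw [abs_mul, abs_of_nonneg (one_add_sign_nonneg σ)]
  refine mul_le_of_le_one_right (one_add_sign_nonneg σ) ?_
  have h1 : 1 / (A.card : ℝ) ≤ 1 := by
    rw [one_div]
    exact Nat.cast_inv_le_one _
  have h2 : 0 ≤ 1 / (A.card : ℝ) := by positivity
  rw [abs_le]
  split_ifs <;> constructor <;> linarith

theorem abs_altDev_le_of_mem {X A : Finset (Fin n)} (hX : 2 ≤ X.card) (hA : A.Nonempty)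
    (hAX : A ⊆ X) {u : Perm (Fin n)} (hu : u ∈ permsOn X) :
    (X.card : ℝ) * (X.card - 1) * |altDev X A u| = (A.card - 1) * X.card.factorial := by
  have hdisj : Disjoint A (X \ A) := Finset.disjoint_sdiff
  have hun : A ∪ X \ A = X := Finset.union_sdiff_of_subset hAX
  have h1 := charSum_one_eq hA hdisj
  have h2 := abs_charSum_sign_eq hA hdisj
  rw [hun] at h1 h2
  rw [← h2]
  congr 1
  have hs : ((Perm.sign u : ℤ) : ℝ) * ((Perm.sign u : ℤ) : ℝ) = 1 := by
    exact_mod_cast Int.units_coe_mul_self _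
  have h3 : altDev X A u = ∑ σ ∈ permsOn X,
      (1 + ((Perm.sign u : ℤ) : ℝ) * ((Perm.sign σ : ℤ) : ℝ)) *
        ((if AllSame σ A then 1 else 0) - 1 / (A.card : ℝ)) := by
    rw [← sum_permsOn_mul_right hu, altDev]
    refine Finset.sum_congr rfl fun σ _ => ?_
    rw [map_mul]
    push_cast
    rw [mul_comm ((Perm.sign σ : ℤ) : ℝ), ← mul_assoc, hs, one_mul]
  have h4 : altDev X A u = charSum 1 X A - X.card.factorial * (1 / (A.card : ℝ)) +
      ((Perm.sign u : ℤ) : ℝ) * (charSum Perm.sign X A) := by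
    have h5 := sum_sign_permsOn hX
    rw [h3, charSum, charSum, ← card_permsOn, ← nsmul_eq_mul, ← Finset.sum_const,
      ← Finset.sum_sub_distrib, ← sub_zero (∑ u ∈ permsOn X, ((Perm.sign u : ℤ) : ℝ) * _),
      ← zero_mul (1 / (A.card : ℝ)), ← h5, Finset.sum_mul, ← Finset.sum_sub_distrib,
      Finset.mul_sum, ← Finset.sum_add_distrib]
    refine Finset.sum_congr rfl fun σ _ => ?_
    simp only [MonoidHom.one_apply, Units.val_one, Int.cast_one]
    ring
  have hk : (A.card : ℝ) ≠ 0 := by exact_mod_cast (Finset.card_pos.mpr hA).ne'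
  have h7 : charSum 1 X A - X.card.factorial * (1 / (A.card : ℝ)) = 0 := by
    rw [← h1]
    field_simp
    ring
  have h6 : |((Perm.sign u : ℤ) : ℝ)| = 1 := by
    rcases Int.units_eq_one_or (Perm.sign u) with h | h <;> simp [h]
  rw [h4, h7, zero_add, abs_mul, h6, one_mul]

theorem altDev_mul_swap {X A : Finset (Fin n)} {e : Fin n} (heX : e ∉ X) (heA : e ∉ A)
    {u : Perm (Fin n)} (hu : u e = e) (p : Fin n) :
    altDev X A (u * swap e p) = altDev X A u := by
  refine Finset.sum_congr rfl fun σ hσ => ?_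
  have h : (σ * u) e = e := by rw [Perm.mul_apply, hu, mem_permsOn.mp hσ e heX]
  rw [← mul_assoc, if_congr (allSame_mul_swap h p heA) rfl rfl]

theorem abs_altDev_le_of_subset {X A : Finset (Fin n)} (hX : 2 ≤ X.card) (hA : A.Nonempty)
    (hAX : A ⊆ X) (u : Perm (Fin n)) :
    (X.card : ℝ) * (X.card - 1) * |altDev X A u| = (A.card - 1) * X.card.factorial := by
  have key : ∀ Z : Finset (Fin n), Disjoint X Z → ∀ u ∈ permsOn (X ∪ Z),
      (X.card : ℝ) * (X.card - 1) * |altDev X A u| = (A.card - 1) * X.card.factorial := by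
    intro Z
    induction Z using Finset.induction_on with
    | empty =>
      intro _ u hu
      rw [Finset.union_empty] at hu
      exact abs_altDev_le_of_mem hX hA hAX hu
    | insert e Z he ih =>
      intro hd u hu
      rw [Finset.disjoint_insert_right] at hd
      rw [Finset.union_insert] at hu
      have h1 := mul_swap_mem_permsOn hu
      have h2 := ih hd.2 _ h1
      rwa [← altDev_mul_swap hd.1 (fun h => hd.1 (hAX h)) (mem_permsOn.mp h1 e (by
        simp [he, hd.1])) (u⁻¹ e), mul_assoc u, swap_mul_self, mul_one] at h2
  refine key Xᶜ disjoint_compl_right u ?_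
  rw [Finset.union_compl, permsOn_univ]
  exact Finset.mem_univ _

theorem allSame_image_inv {w : Perm (Fin n)} {A : Finset (Fin n)} {r : Fin n → Fin n}
    (h : ∀ a ∈ A, w (r a) = a) : AllSame w (A.image r) ↔ AllSame w A := by
  have h1 : ∀ a ∈ A, w.SameCycle (r a) a := by
    intro a ha
    have := (Perm.SameCycle.refl w (r a)).apply_right
    rwa [h a ha] at this
  constructor
  · intro H a ha b hb
    exact (h1 a ha).symm.trans ((H _ (Finset.mem_image_of_mem r ha) _
      (Finset.mem_image_of_mem r hb)).trans (h1 b hb))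
  · intro H a ha b hb
    obtain ⟨c, hc, rfl⟩ := Finset.mem_image.mp ha
    obtain ⟨d, hd, rfl⟩ := Finset.mem_image.mp hb
    exact (h1 c hc).trans ((H c hc d hd).trans (h1 d hd).symm)

theorem altDev_image_inv {X A : Finset (Fin n)} (hAX : Disjoint A X) (u : Perm (Fin n)) :
    altDev X (A.image fun a => u⁻¹ a) u = altDev X A u := by
  refine Finset.sum_congr rfl fun σ hσ => ?_
  rw [Finset.card_image_of_injective _ u⁻¹.injective]
  rw [if_congr (allSame_image_inv fun a ha => ?_) rfl rfl]
  rw [Perm.mul_apply, perm_apply_inv_apply]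
  exact mem_permsOn.mp hσ a (Finset.disjoint_left.mp hAX ha)

theorem card_permsOn_filter_inv_apply {W : Finset (Fin n)} {a b : Fin n} (ha : a ∈ W)
    (hb : b ∈ W) :
    ∑ u ∈ permsOn W, (if u⁻¹ a = b then (1 : ℝ) else 0) = (W.card - 1).factorial := by
  rw [← Finset.insert_erase ha, sum_permsOn_insert (Finset.notMem_erase a W),
    Finset.insert_erase ha, ← Finset.card_erase_of_mem ha, ← card_permsOn]
  have h : ∀ p ∈ W, ∑ u ∈ permsOn (W.erase a), (if (u * swap a p)⁻¹ a = b then (1 : ℝ) else 0) =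
      if p = b then ((permsOn (W.erase a)).card : ℝ) else 0 := by
    intro p _
    have h1 : ∀ u ∈ permsOn (W.erase a), (if (u * swap a p)⁻¹ a = b then (1 : ℝ) else 0) =
        if p = b then 1 else 0 := by
      intro u hu
      have : (u * swap a p)⁻¹ a = p := by
        rw [Perm.inv_eq_iff_eq, Perm.mul_apply, swap_apply_right,
          mem_permsOn.mp hu a (Finset.notMem_erase a W)]
      rw [this]
    rw [Finset.sum_congr rfl h1]
    split_ifs <;> simp
  rw [Finset.sum_congr rfl h, Finset.sum_ite_eq' W b, if_pos hb]

theorem sum_abs_altDev_le {X A : Finset (Fin n)} (hX : 2 ≤ X.card) (hA : A.Nonempty)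
    (hAX : Disjoint A X) :
    ∑ u : Perm (Fin n), |altDev X A u| ≤ (n.factorial : ℝ) * X.card.factorial *
      ((A.card - 1) / (X.card * (X.card - 1)) + (A.card : ℝ) ^ 2 / (X ∪ A).card) := by
  have hX2 : (2 : ℝ) ≤ X.card := by exact_mod_cast hX
  set W := X ∪ A with hW
  have hWpos : 0 < W.card := by
    have : X.card ≤ W.card := Finset.card_le_card Finset.subset_union_left
    omega
  set M : ℝ := (X.card : ℝ) with hM
  set B : ℝ := (A.card - 1) * X.card.factorial / (M * (M - 1)) with hB
  have h1 : ∀ u ∈ permsOn W, |altDev X A u| ≤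
      B + X.card.factorial * ∑ a ∈ A, ∑ b ∈ A, if u⁻¹ a = b then (1 : ℝ) else 0 := by
    intro u hu
    have hB0 : 0 ≤ B := by
      have : (1 : ℝ) ≤ A.card := by exact_mod_cast Finset.card_pos.mpr hA
      refine div_nonneg (mul_nonneg (by linarith) (by positivity)) ?_
      exact mul_nonneg (by linarith) (by linarith)
    have hS0 : ∀ a, 0 ≤ ∑ b ∈ A, if u⁻¹ a = b then (1 : ℝ) else 0 := fun a =>
      Finset.sum_nonneg fun b _ => by split_ifs <;> norm_num
    by_cases hbad : ∃ a ∈ A, u⁻¹ a ∈ A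
    · obtain ⟨a, ha, hb⟩ := hbad
      have h2 : (1 : ℝ) ≤ ∑ a ∈ A, ∑ b ∈ A, if u⁻¹ a = b then (1 : ℝ) else 0 := by
        refine le_trans ?_ (Finset.single_le_sum (fun a _ => hS0 a) ha)
        rw [Finset.sum_ite_eq, if_pos hb]
      have h3 := abs_altDev_le (A := A) hX u
      have h4 : (0 : ℝ) < X.card.factorial := by positivity
      nlinarith
    · push Not at hbad
      have hsub : (A.image fun a => u⁻¹ a) ⊆ X := by
        intro b hb
        obtain ⟨a, ha, rfl⟩ := Finset.mem_image.mp hb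
        have h2 : u⁻¹ a ∈ W := by
          by_contra h
          have h3 := mem_permsOn.mp hu _ h
          rw [perm_apply_inv_apply] at h3
          rw [← h3] at h
          exact h (Finset.mem_union_right _ ha)
        exact (Finset.mem_union.mp h2).resolve_right (hbad a ha)
      have h2 := abs_altDev_le_of_subset hX (hA.image _) hsub u
      rw [altDev_image_inv hAX, Finset.card_image_of_injective _ u⁻¹.injective, ← hM] at h2
      have h3 : |altDev X A u| = B := by
        rw [hB, ← h2]
        rw [mul_div_cancel_left₀ _ (mul_ne_zero (by linarith) (by linarith))]
      rw [h3]
      have := Finset.sum_nonneg fun a (_ : a ∈ A) => hS0 a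
      have : (0 : ℝ) ≤ X.card.factorial *
          ∑ a ∈ A, ∑ b ∈ A, if u⁻¹ a = b then (1 : ℝ) else 0 := by positivity
      linarith
  have h2 : ∑ u ∈ permsOn W, |altDev X A u| ≤
      W.card.factorial * B + X.card.factorial * (A.card ^ 2 * (W.card - 1).factorial) := by
    refine (Finset.sum_le_sum h1).trans (le_of_eq ?_)
    rw [Finset.sum_add_distrib, Finset.sum_const, nsmul_eq_mul, card_permsOn, ← Finset.mul_sum,
      Finset.sum_comm]
    congr 2
    have h3 : ∀ a ∈ A, ∑ u ∈ permsOn W, ∑ b ∈ A, (if u⁻¹ a = b then (1 : ℝ) else 0) =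
        A.card * (W.card - 1).factorial := by
      intro a ha
      rw [Finset.sum_comm, Finset.sum_congr rfl fun b hb => card_permsOn_filter_inv_apply
        (Finset.mem_union_right X ha) (Finset.mem_union_right X hb), ← hW, Finset.sum_const,
        nsmul_eq_mul]
    rw [Finset.sum_congr rfl h3, Finset.sum_const, nsmul_eq_mul]
    ring
  have h3 := sum_permsOn_of_mul_swap (X := W) (Z := Wᶜ) disjoint_compl_right
    (F := fun u => |altDev X A u|) (fun e he u p hu => by
      rw [hW, Finset.mem_union, not_or] at he
      rw [altDev_mul_swap he.1 he.2 hu])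
  rw [Finset.union_compl, permsOn_univ, Finset.card_univ, Fintype.card_fin] at h3
  have h4 : (W.card.factorial : ℝ) = W.card * (W.card - 1).factorial := by
    exact_mod_cast (Nat.mul_factorial_pred hWpos.ne').symm
  have h5 : (0 : ℝ) < (W.card - 1).factorial := by positivity
  have h6 : (0 : ℝ) < W.card := by exact_mod_cast hWpos
  have h7 : (0 : ℝ) < n.factorial := by positivity
  have h8 : (W.card.factorial : ℝ) * ∑ u : Perm (Fin n), |altDev X A u| ≤
      W.card.factorial * ((n.factorial : ℝ) * X.card.factorial *
      ((A.card - 1) / (M * (M - 1)) + (A.card : ℝ) ^ 2 / W.card)) := by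
    rw [h3]
    refine (mul_le_mul_of_nonneg_left h2 h7.le).trans (le_of_eq ?_)
    rw [hB, h4]
    have : M * (M - 1) ≠ 0 := mul_ne_zero (by linarith) (by linarith)
    field_simp
  exact le_of_mul_le_mul_left h8 (by rw [h4]; positivity)

end AlternatingAverage

section CycleDeviation

variable {n : ℕ}

/-- The probability that `k` independent uniform points lie in one cycle of `u`. -/
noncomputable def sameCycleProb (k : ℕ) (u : Perm (Fin n)) : ℝ :=
  (∑ a : Fin k → Fin n, if AllSame u (Finset.univ.image a) then (1 : ℝ) else 0) / (n : ℝ) ^ k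

theorem sameCycleProb_nonneg (k : ℕ) (u : Perm (Fin n)) : 0 ≤ sameCycleProb k u :=
  div_nonneg (Finset.sum_nonneg fun _ _ => by split_ifs <;> norm_num) (by positivity)

theorem sameCycleProb_le_one (k : ℕ) (u : Perm (Fin n)) : sameCycleProb k u ≤ 1 := by
  refine div_le_one_of_le₀ ?_ (by positivity)
  refine (Finset.sum_le_card_nsmul _ _ 1 fun _ _ => by split_ifs <;> norm_num).trans ?_
  simp

theorem allSame_conj {u : Perm (Fin n)} (y : Perm (Fin n)) (A : Finset (Fin n)) :
    AllSame (y * u * y⁻¹) (A.image y) ↔ AllSame u A := by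
  simp [AllSame, Perm.sameCycle_conj]

theorem sameCycleProb_conj (k : ℕ) (u y : Perm (Fin n)) :
    sameCycleProb k (y * u * y⁻¹) = sameCycleProb k u := by
  unfold sameCycleProb
  congr 1
  refine (Fintype.sum_equiv (Equiv.arrowCongr (Equiv.refl (Fin k)) y) _ _ fun a => ?_).symm
  have h : Finset.univ.image (Equiv.arrowCongr (Equiv.refl (Fin k)) y a) =
      (Finset.univ.image a).image y := by
    rw [Finset.image_image]
    rfl
  rw [h, if_congr (allSame_conj y _) rfl rfl]

/-- The class function `u ↦ sameCycleProb k u - 1 / k`. -/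
noncomputable def cycleDev (n k : ℕ) : EuclideanSpace ℝ (Perm (Fin n)) :=
  WithLp.toLp 2 fun u => sameCycleProb k u - 1 / k

theorem cycleDev_apply (k : ℕ) (u : Perm (Fin n)) :
    cycleDev n k u = sameCycleProb k u - 1 / k := rfl

theorem abs_cycleDev_le (k : ℕ) (u : Perm (Fin n)) : |cycleDev n k u| ≤ 1 := by
  have h1 := sameCycleProb_nonneg k u
  have h2 := sameCycleProb_le_one k u
  have h3 : 1 / (k : ℝ) ≤ 1 := by
    rw [one_div]
    exact Nat.cast_inv_le_one _
  have h4 : 0 ≤ 1 / (k : ℝ) := by positivity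
  rw [cycleDev_apply, abs_le]
  constructor <;> linarith

/-- The average over the even permutations on `X` of the left translations. -/
noncomputable def altAvg (X : Finset (Fin n)) :
    Module.End ℝ (EuclideanSpace ℝ (Perm (Fin n))) :=
  (1 / (X.card.factorial : ℝ)) •
    ∑ σ ∈ permsOn X, (1 + ((Perm.sign σ : ℤ) : ℝ)) • leftTrans σ⁻¹

theorem altAvg_apply (X : Finset (Fin n)) (f : EuclideanSpace ℝ (Perm (Fin n)))
    (u : Perm (Fin n)) : altAvg X f u =
      (1 / (X.card.factorial : ℝ)) *
        ∑ σ ∈ permsOn X, (1 + ((Perm.sign σ : ℤ) : ℝ)) * f (σ * u) := by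
  simp [altAvg, LinearMap.sum_apply, leftTrans_apply]

theorem altAvg_eq_sum (X : Finset (Fin n)) (f : EuclideanSpace ℝ (Perm (Fin n))) : altAvg X f =
      (1 / (X.card.factorial : ℝ)) •
        ∑ σ ∈ permsOn X, (1 + ((Perm.sign σ : ℤ) : ℝ)) • leftTrans σ⁻¹ f := by
  simp [altAvg, LinearMap.sum_apply]

theorem card_filter_apply_eq_mul_le {k : ℕ} (i : Fin k) (c : (Fin k → Fin n) → Fin n)
    (hc : ∀ a x, c (Function.update a i x) = c a) :
    (∑ a : Fin k → Fin n, if a i = c a then (1 : ℝ) else 0) * n ≤ (n : ℝ) ^ k := by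
  have h1 : (∑ a : Fin k → Fin n, if a i = c a then (1 : ℝ) else 0) * n =
      (((Finset.univ.filter fun a : Fin k → Fin n => a i = c a) ×ˢ
        (Finset.univ : Finset (Fin n))).card : ℝ) := by
    rw [Finset.card_product]
    simp
  have h2 : ((Finset.univ.filter fun a : Fin k → Fin n => a i = c a) ×ˢ
        (Finset.univ : Finset (Fin n))).card ≤ (Finset.univ : Finset (Fin k → Fin n)).card := by
    refine Finset.card_le_card_of_injOn (fun p => Function.update p.1 i p.2)
      (fun _ _ => Finset.mem_coe.mpr (Finset.mem_univ _)) ?_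
    rintro ⟨a, x⟩ ha ⟨b, y⟩ hb hab
    have ha' : a i = c a := by simpa using ha
    have hb' : b i = c b := by simpa using hb
    dsimp only at hab
    have hxy : x = y := by
      have := congrFun hab i
      rwa [Function.update_self, Function.update_self] at this
    have hcc : a i = b i := by
      rw [ha', hb', ← hc a x, ← hc b y, hab]
    refine Prod.ext ?_ hxy
    funext j
    by_cases hj : j = i
    · rw [hj]
      exact hcc
    · have := congrFun hab j
      rwa [Function.update_of_ne hj, Function.update_of_ne hj] at this
  rw [h1]
  calc _ ≤ ((Finset.univ : Finset (Fin k → Fin n)).card : ℝ) := by exact_mod_cast h2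
    _ = _ := by simp

theorem sum_abs_altAvg_tuple_le {X : Finset (Fin n)} (hX : 2 ≤ X.card) {k : ℕ} (hk : 1 ≤ k)
    (a : Fin k → Fin n) :
    ∑ u : Perm (Fin n), |∑ σ ∈ permsOn X, (1 + ((Perm.sign σ : ℤ) : ℝ)) *
      ((if AllSame (σ * u) (Finset.univ.image a) then 1 else 0) - 1 / (k : ℝ))| ≤
    (n.factorial : ℝ) * X.card.factorial *
      ((k - 1) / (X.card * (X.card - 1)) + (k : ℝ) ^ 2 / (X.card + k) +
        ((∑ i : Fin k, ∑ x ∈ X, if a i = x then (1 : ℝ) else 0) +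
          ∑ i : Fin k, ∑ j ∈ Finset.univ.erase i, if a i = a j then (1 : ℝ) else 0)) := by
  have hX2 : (2 : ℝ) ≤ X.card := by exact_mod_cast hX
  have hk1 : (1 : ℝ) ≤ k := by exact_mod_cast hk
  have hN : (0 : ℝ) < (n.factorial : ℝ) * X.card.factorial := by positivity
  have hκ : (0 : ℝ) ≤ (k - 1) / (X.card * (X.card - 1)) + (k : ℝ) ^ 2 / (X.card + k) := by
    refine add_nonneg (div_nonneg (by linarith) (mul_nonneg (by linarith) (by linarith))) ?_
    positivity
  have hpos1 : ∀ i : Fin k, 0 ≤ ∑ x ∈ X, if a i = x then (1 : ℝ) else 0 := fun i =>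
    Finset.sum_nonneg fun _ _ => by split_ifs <;> norm_num
  have hpos2 : ∀ i : Fin k, 0 ≤ ∑ j ∈ Finset.univ.erase i, if a i = a j then (1 : ℝ) else 0 :=
    fun i => Finset.sum_nonneg fun _ _ => by split_ifs <;> norm_num
  have hP1 := Finset.sum_nonneg fun i (_ : i ∈ Finset.univ) => hpos1 i
  have hP2 := Finset.sum_nonneg fun i (_ : i ∈ Finset.univ) => hpos2 i
  by_cases hgood : Function.Injective a ∧ ∀ i, a i ∉ X
  · obtain ⟨hinj, hdis⟩ := hgood
    have hcard : (Finset.univ.image a).card = k := by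
      rw [Finset.card_image_of_injective _ hinj, Finset.card_univ, Fintype.card_fin]
    have hd : Disjoint (Finset.univ.image a) X := by
      rw [Finset.disjoint_left]
      intro x hx
      obtain ⟨i, _, rfl⟩ := Finset.mem_image.mp hx
      exact hdis i
    have hne : (Finset.univ.image a).Nonempty := Finset.card_pos.mp (by omega)
    have h := sum_abs_altDev_le hX hne hd
    rw [Finset.card_union_of_disjoint hd.symm, hcard, Nat.cast_add] at h
    simp only [altDev, hcard] at h
    refine h.trans (mul_le_mul_of_nonneg_left ?_ hN.le)
    linarith
  · have h1 : (1 : ℝ) ≤ (∑ i : Fin k, ∑ x ∈ X, if a i = x then (1 : ℝ) else 0) +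
          ∑ i : Fin k, ∑ j ∈ Finset.univ.erase i, if a i = a j then (1 : ℝ) else 0 := by
      by_cases hinj : Function.Injective a
      · have : ∃ i, a i ∈ X := by
          by_contra h
          push Not at h
          exact hgood ⟨hinj, h⟩
        obtain ⟨i, hi⟩ := this
        have h2 := Finset.single_le_sum (fun i _ => hpos1 i) (Finset.mem_univ i)
        rw [Finset.sum_ite_eq, if_pos hi] at h2
        linarith
      · simp only [Function.Injective, not_forall] at hinj
        obtain ⟨i, j, hij, hne⟩ := hinj
        have h2 := Finset.single_le_sum (fun i _ => hpos2 i) (Finset.mem_univ i)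
        have h3 : (1 : ℝ) ≤ ∑ j ∈ Finset.univ.erase i, if a i = a j then (1 : ℝ) else 0 := by
          have h4 := Finset.single_le_sum (f := fun j => if a i = a j then (1 : ℝ) else 0)
            (s := Finset.univ.erase i) (fun _ _ => by split_ifs <;> norm_num)
            (Finset.mem_erase.mpr ⟨Ne.symm hne, Finset.mem_univ j⟩)
          rwa [if_pos hij] at h4
        linarith
    have h2 : ∀ u : Perm (Fin n), |∑ σ ∈ permsOn X, (1 + ((Perm.sign σ : ℤ) : ℝ)) *
        ((if AllSame (σ * u) (Finset.univ.image a) then 1 else 0) - 1 / (k : ℝ))| ≤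
        X.card.factorial := by
      intro u
      rw [← sum_one_add_sign_permsOn hX]
      refine (Finset.abs_sum_le_sum_abs _ _).trans (Finset.sum_le_sum fun σ _ => ?_)
      rw [abs_mul, abs_of_nonneg (one_add_sign_nonneg σ)]
      refine mul_le_of_le_one_right (one_add_sign_nonneg σ) ?_
      have h3 : 1 / (k : ℝ) ≤ 1 := by
        rw [one_div]
        exact Nat.cast_inv_le_one _
      have h4 : 0 ≤ 1 / (k : ℝ) := by positivity
      rw [abs_le]
      split_ifs <;> constructor <;> linarith
    refine (Finset.sum_le_sum fun u _ => h2 u).trans ?_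
    rw [Finset.sum_const, Finset.card_univ, Fintype.card_perm, Fintype.card_fin, nsmul_eq_mul]
    exact le_mul_of_one_le_right hN.le (by linarith)

theorem norm_altAvg_cycleDev_sq_le (hn : 1 ≤ n) {X : Finset (Fin n)} (hX : 2 ≤ X.card) {k : ℕ}
    (hk : 1 ≤ k) :
    ‖altAvg X (cycleDev n k)‖ ^ 2 ≤ (n.factorial : ℝ) *
      ((k - 1) / (X.card * (X.card - 1)) + (k : ℝ) ^ 2 / (X.card + k) +
        (k * X.card + k ^ 2) / n) := by
  have hn0 : (0 : ℝ) < n := by exact_mod_cast hn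
  have hX0 : (0 : ℝ) < X.card.factorial := by positivity
  have hk1 : (1 : ℝ) ≤ k := by exact_mod_cast hk
  have h1 : ∀ u, |altAvg X (cycleDev n k) u| ≤ 1 := by
    intro u
    rw [altAvg_apply, abs_mul, abs_of_pos (by positivity : 0 < 1 / (X.card.factorial : ℝ)),
      one_div_mul_eq_div, div_le_one hX0, ← sum_one_add_sign_permsOn hX]
    refine (Finset.abs_sum_le_sum_abs _ _).trans (Finset.sum_le_sum fun σ _ => ?_)
    rw [abs_mul, abs_of_nonneg (one_add_sign_nonneg σ)]
    exact mul_le_of_le_one_right (one_add_sign_nonneg σ) (abs_cycleDev_le _ _)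
  have hcast : (n : ℝ) ^ k ≠ 0 := by positivity
  have h2 : ∀ u, altAvg X (cycleDev n k) u = (1 / (X.card.factorial * (n : ℝ) ^ k)) *
      ∑ a : Fin k → Fin n, ∑ σ ∈ permsOn X, (1 + ((Perm.sign σ : ℤ) : ℝ)) *
        ((if AllSame (σ * u) (Finset.univ.image a) then 1 else 0) - 1 / (k : ℝ)) := by
    intro u
    rw [altAvg_apply, Finset.sum_comm, Finset.mul_sum, Finset.mul_sum]
    refine Finset.sum_congr rfl fun σ _ => ?_
    rw [← Finset.mul_sum, Finset.sum_sub_distrib, cycleDev_apply, sameCycleProb, Finset.sum_const,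
      Finset.card_univ, Fintype.card_fun, Fintype.card_fin, Fintype.card_fin, nsmul_eq_mul,
      Nat.cast_pow]
    field_simp
  rw [EuclideanSpace.real_norm_sq_eq]
  calc ∑ u, altAvg X (cycleDev n k) u ^ 2 ≤ ∑ u, |altAvg X (cycleDev n k) u| := by
        refine Finset.sum_le_sum fun u _ => ?_
        rw [← sq_abs]
        have := abs_nonneg (altAvg X (cycleDev n k) u)
        nlinarith [h1 u]
    _ ≤ ∑ u, (1 / (X.card.factorial * (n : ℝ) ^ k)) * ∑ a : Fin k → Fin n,
        |∑ σ ∈ permsOn X, (1 + ((Perm.sign σ : ℤ) : ℝ)) *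
        ((if AllSame (σ * u) (Finset.univ.image a) then 1 else 0) - 1 / (k : ℝ))| := by
        refine Finset.sum_le_sum fun u _ => ?_
        rw [h2, abs_mul, abs_of_nonneg (by positivity)]
        exact mul_le_mul_of_nonneg_left (Finset.abs_sum_le_sum_abs _ _) (by positivity)
    _ ≤ (1 / (X.card.factorial * (n : ℝ) ^ k)) * ∑ a : Fin k → Fin n,
        ((n.factorial : ℝ) * X.card.factorial *
      ((k - 1) / (X.card * (X.card - 1)) + (k : ℝ) ^ 2 / (X.card + k) +
        ((∑ i : Fin k, ∑ x ∈ X, if a i = x then (1 : ℝ) else 0) +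
          ∑ i : Fin k, ∑ j ∈ Finset.univ.erase i, if a i = a j then (1 : ℝ) else 0))) := by
        rw [← Finset.mul_sum, Finset.sum_comm]
        exact mul_le_mul_of_nonneg_left
          (Finset.sum_le_sum fun a _ => sum_abs_altAvg_tuple_le hX hk a) (by positivity)
    _ ≤ _ := by
        have h3 : ∑ a : Fin k → Fin n, ∑ i : Fin k, ∑ x ∈ X, (if a i = x then (1 : ℝ) else 0) ≤
            (n : ℝ) ^ k * (k * X.card / n) := by
          rw [Finset.sum_comm]
          have : ∀ i : Fin k, ∑ a : Fin k → Fin n, ∑ x ∈ X, (if a i = x then (1 : ℝ) else 0) ≤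
              X.card * ((n : ℝ) ^ k / n) := by
            intro i
            rw [Finset.sum_comm, ← nsmul_eq_mul]
            refine Finset.sum_le_card_nsmul _ _ _ fun x _ => ?_
            rw [le_div_iff₀ hn0]
            exact card_filter_apply_eq_mul_le i (fun _ => x) fun _ _ => rfl
          refine (Finset.sum_le_card_nsmul _ _ _ fun i _ => this i).trans (le_of_eq ?_)
          rw [Finset.card_univ, Fintype.card_fin, nsmul_eq_mul]
          ring
        have h4 : ∑ a : Fin k → Fin n, ∑ i : Fin k, ∑ j ∈ Finset.univ.erase i,
            (if a i = a j then (1 : ℝ) else 0) ≤ (n : ℝ) ^ k * (k ^ 2 / n) := by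
          rw [Finset.sum_comm]
          have : ∀ i : Fin k, ∑ a : Fin k → Fin n, ∑ j ∈ Finset.univ.erase i,
              (if a i = a j then (1 : ℝ) else 0) ≤ k * ((n : ℝ) ^ k / n) := by
            intro i
            rw [Finset.sum_comm]
            refine (Finset.sum_le_card_nsmul _ _ ((n : ℝ) ^ k / n) fun j hj => ?_).trans ?_
            · rw [le_div_iff₀ hn0]
              exact card_filter_apply_eq_mul_le i (fun a => a j) fun a x =>
                Function.update_of_ne (Finset.ne_of_mem_erase hj) _ _
            · rw [nsmul_eq_mul]
              refine mul_le_mul_of_nonneg_right ?_ (by positivity)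
              exact_mod_cast (Finset.card_le_univ _).trans (by simp)
          refine (Finset.sum_le_card_nsmul _ _ _ fun i _ => this i).trans (le_of_eq ?_)
          rw [Finset.card_univ, Fintype.card_fin, nsmul_eq_mul]
          ring
        generalize ((k : ℝ) - 1) / (X.card * (X.card - 1)) + (k : ℝ) ^ 2 / (X.card + k) = κ
        have h5 : (n.factorial : ℝ) * (κ + (k * X.card + k ^ 2) / n) =
            (1 / (X.card.factorial * (n : ℝ) ^ k)) * ((n.factorial : ℝ) * X.card.factorial *
            ((n : ℝ) ^ k * κ +
            ((n : ℝ) ^ k * (k * X.card / n) + (n : ℝ) ^ k * (k ^ 2 / n)))) := by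
          field_simp
        rw [h5, ← Finset.mul_sum, Finset.sum_add_distrib, Finset.sum_add_distrib,
          Finset.sum_const, Finset.card_univ, Fintype.card_fun, Fintype.card_fin,
          Fintype.card_fin, nsmul_eq_mul, Nat.cast_pow]
        gcongr

end CycleDeviation

section ConjInvariance

variable {G : Type*} [Group G]

/-- Invariance of `f` under conjugation by `y`. -/
def ConjInv (f : EuclideanSpace ℝ G) (y : G) : Prop := ∀ u, f (y * u * y⁻¹) = f u

theorem ConjInv.leftTrans {f : EuclideanSpace ℝ G} {y d : G} (hf : ConjInv f y)
    (hd : Commute y d) : ConjInv (leftTrans d f) y := by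
  intro u
  rw [leftTrans_apply, leftTrans_apply, ← hf (d⁻¹ * u), ← mul_assoc, ← mul_assoc, ← mul_assoc,
    hd.inv_right.eq]

variable [Fintype G]

theorem sum_conj (F : G → ℝ) (y : G) : ∑ u, F (y * u * y⁻¹) = ∑ u, F u :=
  Equiv.sum_comp (MulAut.conj y).toEquiv F

theorem ConjInv.norm_sub_leftTrans_conj {f : EuclideanSpace ℝ G} {y : G} (hf : ConjInv f y)
    (d : G) : ‖f - _root_.leftTrans (y * d * y⁻¹) f‖ = ‖f - _root_.leftTrans d f‖ := by
  rw [← sq_eq_sq₀ (norm_nonneg _) (norm_nonneg _), EuclideanSpace.real_norm_sq_eq,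
    EuclideanSpace.real_norm_sq_eq, ← sum_conj _ y]
  refine Finset.sum_congr rfl fun u _ => ?_
  rw [PiLp.sub_apply, PiLp.sub_apply, leftTrans_apply, leftTrans_apply, hf, ← hf (d⁻¹ * u)]
  congr 3
  group

theorem ConjInv.inner_leftTrans_conj {ψ f : EuclideanSpace ℝ G} {y : G} (hψ : ConjInv ψ y)
    (hf : ConjInv f y) (q : G) :
    inner ℝ ψ (_root_.leftTrans (y * q * y⁻¹) f) = inner ℝ ψ (_root_.leftTrans q f) := by
  rw [inner_eq_sum, inner_eq_sum, ← sum_conj _ y]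
  refine Finset.sum_congr rfl fun u _ => ?_
  rw [leftTrans_apply, leftTrans_apply, hψ, ← hf (q⁻¹ * u)]
  congr 2
  group

theorem norm_sub_leftTrans_mul_le (f : EuclideanSpace ℝ G) (σ τ : G) :
    ‖f - leftTrans (σ * τ) f‖ ≤ ‖f - leftTrans σ f‖ + ‖f - leftTrans τ f‖ := by
  have h : f - leftTrans (σ * τ) f = (f - leftTrans σ f) + leftTrans σ (f - leftTrans τ f) := by
    rw [map_mul, Module.End.mul_apply, map_sub]
    abel
  rw [h]
  refine (norm_add_le _ _).trans ?_
  rw [norm_leftTrans]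

/-- Successive averages of `f` with its left translates. -/
noncomputable def avgSeq (d : ℕ → G) (f : EuclideanSpace ℝ G) : ℕ → EuclideanSpace ℝ G
  | 0 => f
  | j + 1 => (1 / 2 : ℝ) • (avgSeq d f j + leftTrans (d j) (avgSeq d f j))

theorem ConjInv.avgSeq {d : ℕ → G} {f : EuclideanSpace ℝ G} {y : G} (hf : ConjInv f y) (j : ℕ)
    (hd : ∀ i < j, Commute y (d i)) : ConjInv (avgSeq d f j) y := by
  induction j with
  | zero => exact hf
  | succ j ih =>
    have h1 := ih fun i hi => hd i (hi.trans j.lt_succ_self)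
    have h2 := h1.leftTrans (hd j j.lt_succ_self)
    intro u
    simp only [_root_.avgSeq, PiLp.smul_apply, PiLp.add_apply, h1 u, h2 u]

theorem sum_norm_sub_avgSeq (d : ℕ → G) (f : EuclideanSpace ℝ G) (t : ℕ) :
    ∑ j ∈ Finset.range t, ‖avgSeq d f j - leftTrans (d j) (avgSeq d f j)‖ ^ 2 ≤ 4 * ‖f‖ ^ 2 := by
  have h : ∑ j ∈ Finset.range t, ‖avgSeq d f j - leftTrans (d j) (avgSeq d f j)‖ ^ 2 =
      4 * ‖f‖ ^ 2 - 4 * ‖avgSeq d f t‖ ^ 2 := by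
    induction t with
    | zero => simp [avgSeq]
    | succ t ih =>
      have h1 := parallelogram_law_with_norm ℝ (avgSeq d f t) (leftTrans (d t) (avgSeq d f t))
      rw [norm_leftTrans] at h1
      rw [Finset.sum_range_succ, ih, avgSeq, norm_smul, Real.norm_of_nonneg (by norm_num)]
      linarith
  have := sq_nonneg ‖avgSeq d f t‖
  linarith

theorem exists_norm_sub_avgSeq_le (d : ℕ → G) (f : EuclideanSpace ℝ G) {t : ℕ} (ht : 0 < t) :
    ∃ j < t, ‖avgSeq d f j - leftTrans (d j) (avgSeq d f j)‖ ≤ 2 * ‖f‖ / Real.sqrt t := by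
  have ht' : (0 : ℝ) < t := by exact_mod_cast ht
  obtain ⟨j, hj, h⟩ := Finset.exists_le_of_sum_le (s := Finset.range t)
    (f := fun j => ‖avgSeq d f j - leftTrans (d j) (avgSeq d f j)‖ ^ 2)
    (g := fun _ => 4 * ‖f‖ ^ 2 / t) (Finset.nonempty_range_iff.mpr ht.ne') (by
      rw [Finset.sum_const, Finset.card_range, nsmul_eq_mul, mul_div_cancel₀ _ ht'.ne']
      exact sum_norm_sub_avgSeq d f t)
  refine ⟨j, Finset.mem_range.mp hj, ?_⟩
  refine le_of_sq_le_sq (h.trans (le_of_eq ?_)) (by positivity)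
  rw [div_pow, Real.sq_sqrt ht'.le]
  ring

theorem inner_leftTrans_avgSeq {ψ : EuclideanSpace ℝ G} {q : G} {d y : ℕ → G} (t : ℕ)
    (hψ : ∀ j < t, ConjInv ψ (y j)) (hd : ∀ j < t, d j = q⁻¹ * (y j * q * (y j)⁻¹))
    (hc : ∀ j < t, ∀ i < j, Commute (y j) (d i)) :
    inner ℝ ψ (leftTrans q (avgSeq d ψ t)) = inner ℝ ψ (leftTrans q ψ) := by
  induction t with
  | zero => rfl
  | succ t ih =>
    have ih' := ih (fun j hj => hψ j (hj.trans t.lt_succ_self))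
      (fun j hj => hd j (hj.trans t.lt_succ_self)) (fun j hj => hc j (hj.trans t.lt_succ_self))
    have h1 := (hψ t t.lt_succ_self).inner_leftTrans_conj
      ((hψ t t.lt_succ_self).avgSeq t (hc t t.lt_succ_self)) q
    have h2 : leftTrans q (leftTrans (d t) (avgSeq d ψ t)) =
        leftTrans (y t * q * (y t)⁻¹) (avgSeq d ψ t) := by
      rw [← Module.End.mul_apply, ← map_mul, hd t t.lt_succ_self, mul_inv_cancel_left]
    rw [avgSeq, map_smul, map_add, h2, real_inner_smul_right, inner_add_right, h1, ih']
    ring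

end ConjInvariance

section EvenCost

variable {n : ℕ}

theorem commute_of_mem_permsOn {X Y : Finset (Fin n)} (h : Disjoint X Y) {u v : Perm (Fin n)}
    (hu : u ∈ permsOn X) (hv : v ∈ permsOn Y) : Commute u v := by
  refine Perm.Disjoint.commute fun x => ?_
  by_cases hx : x ∈ X
  · exact Or.inr (mem_permsOn.mp hv x (Finset.disjoint_left.mp h hx))
  · exact Or.inl (mem_permsOn.mp hu x hx)

theorem norm_sub_leftTrans_le_of_even {f : EuclideanSpace ℝ (Perm (Fin n))} {X : Finset (Fin n)}
    {δ : ℝ} (hδ : 0 ≤ δ) (h : ∀ x ∈ X, ∀ y ∈ X, ∀ z ∈ X, x ≠ y → y ≠ z → x ≠ z →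
      ‖f - leftTrans (swap x y * swap y z) f‖ ≤ δ) {Y : Finset (Fin n)} (hY : Y ⊆ X)
    {σ : Perm (Fin n)} (hσ : σ ∈ permsOn Y) (hs : Perm.sign σ = 1) :
    ‖f - leftTrans σ f‖ ≤ Y.card * δ := by
  induction Y using Finset.induction_on generalizing σ with
  | empty =>
    rw [permsOn_empty, Finset.mem_singleton] at hσ
    simp [hσ]
  | insert e Y he ih =>
    have hYX : Y ⊆ X := (Finset.subset_insert e Y).trans hY
    rw [Finset.card_insert_of_notMem he, Nat.cast_add, Nat.cast_one, add_mul, one_mul]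
    have h0 := mul_swap_mem_permsOn hσ
    by_cases hp : σ⁻¹ e = e
    · rw [hp, swap_self, ← Perm.one_def, mul_one] at h0
      have := ih hYX h0 hs
      linarith
    · have hpY : σ⁻¹ e ∈ Y := by
        by_contra hn
        have h1 := mem_permsOn.mp hσ (σ⁻¹ e) fun h' => (Finset.mem_insert.mp h').elim hp hn
        rw [perm_apply_inv_apply] at h1
        exact hp h1.symm
      set p := σ⁻¹ e with hpdef
      have hσp : σ p = e := perm_apply_inv_apply _ _
      by_cases hr : ∃ r ∈ Y, r ≠ p
      · obtain ⟨r, hrY, hrp⟩ := hr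
        have hre : r ≠ e := fun h' => he (h' ▸ hrY)
        set c := swap p r * swap r e with hc
        have hcm : c ∈ permsOn (insert e Y) := mul_mem_permsOn
          (swap_mem_permsOn (Finset.mem_insert_of_mem hpY) (Finset.mem_insert_of_mem hrY))
          (swap_mem_permsOn (Finset.mem_insert_of_mem hrY) (Finset.mem_insert_self e Y))
        have h1 : σ * c ∈ permsOn Y := by
          refine mem_permsOn.mpr fun x hx => ?_
          by_cases hxe : x = e
          · rw [hxe, hc, Perm.mul_apply, Perm.mul_apply, swap_apply_right, swap_apply_right, hσp]
          · exact mem_permsOn.mp (mul_mem_permsOn hσ hcm) x (by simp [hx, hxe])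
        have h2 := ih hYX h1 (by
          rw [map_mul, hs, hc, map_mul, Perm.sign_swap hrp.symm, Perm.sign_swap hre]
          simp)
        have h3 : σ = (σ * c) * (swap e r * swap r p) := by
          rw [hc, swap_comm e r, swap_comm r p]
          simp [mul_assoc]
        rw [h3]
        refine (norm_sub_leftTrans_mul_le _ _ _).trans (add_le_add h2 ?_)
        exact h e (hY (Finset.mem_insert_self e Y)) r (hYX hrY) p (hYX hpY) hre.symm hrp
          (Ne.symm hp)
      · push Not at hr
        have hY1 : Y = {p} := Finset.eq_singleton_iff_unique_mem.mpr ⟨hpY, hr⟩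
        rw [hY1, permsOn_singleton, Finset.mem_singleton, mul_eq_one_iff_eq_inv, swap_inv] at h0
        rw [h0, Perm.sign_swap (Ne.symm hp)] at hs
        exact absurd hs (by decide)

theorem norm_sub_altAvg_le {f : EuclideanSpace ℝ (Perm (Fin n))} {X : Finset (Fin n)}
    (hX : 2 ≤ X.card) {δ : ℝ}
    (h : ∀ σ ∈ permsOn X, Perm.sign σ = 1 → ‖f - leftTrans σ f‖ ≤ δ) :
    ‖f - altAvg X f‖ ≤ δ := by
  have hX0 : (0 : ℝ) < X.card.factorial := by positivity
  have h1 : f - altAvg X f = (1 / (X.card.factorial : ℝ)) •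
      ∑ σ ∈ permsOn X, (1 + ((Perm.sign σ : ℤ) : ℝ)) • (f - leftTrans σ⁻¹ f) := by
    simp only [smul_sub]
    rw [Finset.sum_sub_distrib, smul_sub, ← altAvg_eq_sum, ← Finset.sum_smul,
      sum_one_add_sign_permsOn hX, smul_smul, one_div_mul_cancel hX0.ne', one_smul]
  rw [h1, norm_smul, Real.norm_of_nonneg (by positivity), one_div_mul_eq_div, div_le_iff₀ hX0,
    mul_comm, ← sum_one_add_sign_permsOn hX, Finset.sum_mul]
  refine (norm_sum_le _ _).trans (Finset.sum_le_sum fun σ hσ => ?_)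
  rw [norm_smul, Real.norm_of_nonneg (one_add_sign_nonneg σ)]
  rcases Int.units_eq_one_or (Perm.sign σ) with hs | hs
  · exact mul_le_mul_of_nonneg_left (h _ (inv_mem_permsOn hσ) (by simp [hs]))
      (one_add_sign_nonneg σ)
  · simp [hs]

theorem altAvg_leftTrans {X : Finset (Fin n)} {d : Perm (Fin n)}
    (hd : ∀ σ ∈ permsOn X, Commute σ d) (f : EuclideanSpace ℝ (Perm (Fin n))) :
    altAvg X (leftTrans d f) = leftTrans d (altAvg X f) := by
  ext u
  rw [leftTrans_apply, altAvg_apply, altAvg_apply]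
  congr 1
  refine Finset.sum_congr rfl fun σ hσ => ?_
  rw [leftTrans_apply, ← mul_assoc, ← mul_assoc, (hd σ hσ).inv_right.eq]

theorem norm_altAvg_avgSeq_le {X : Finset (Fin n)} {d : ℕ → Perm (Fin n)} (j : ℕ)
    (hd : ∀ i < j, ∀ σ ∈ permsOn X, Commute σ (d i)) (f : EuclideanSpace ℝ (Perm (Fin n))) :
    ‖altAvg X (avgSeq d f j)‖ ≤ ‖altAvg X f‖ := by
  induction j with
  | zero => exact le_rfl
  | succ j ih =>
    have h1 := ih fun i hi => hd i (hi.trans j.lt_succ_self)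
    rw [avgSeq, map_smul, map_add, altAvg_leftTrans (hd j j.lt_succ_self), norm_smul,
      Real.norm_of_nonneg (by norm_num)]
    have h2 := norm_add_le (altAvg X (avgSeq d f j)) (leftTrans (d j) (altAvg X (avgSeq d f j)))
    rw [norm_leftTrans] at h2
    linarith

end EvenCost

section Decorrelation

variable {n : ℕ}

theorem exists_separated_sequence (hn : 0 < n) {q : Perm (Fin n)} {s : ℕ}
    (hs : 3 * s ≤ q.support.card) :
    ∃ e : ℕ → Fin n, (∀ i < s, ∀ j < s, i ≠ j → e i ≠ e j) ∧
      ∀ i < s, ∀ j < s, q⁻¹ (e i) ≠ e j := by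
  induction s with
  | zero => exact ⟨fun _ => ⟨0, hn⟩, by simp, by simp⟩
  | succ s ih =>
    obtain ⟨e, he1, he2⟩ := ih (by omega)
    set B := (Finset.range s).image e with hB
    have hBc : B.card ≤ s := Finset.card_image_le.trans (by simp)
    have hcard : (B ∪ (B.image q ∪ B.image fun x => q⁻¹ x)).card < q.support.card := by
      have h1 := Finset.card_union_le B (B.image q ∪ B.image fun x => q⁻¹ x)
      have h2 := Finset.card_union_le (B.image q) (B.image fun x => q⁻¹ x)
      have h3 : (B.image q).card ≤ B.card := Finset.card_image_le
      have h4 : (B.image fun x => q⁻¹ x).card ≤ B.card := Finset.card_image_le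
      omega
    obtain ⟨a, haq, ha⟩ := Finset.exists_mem_notMem_of_card_lt_card hcard
    simp only [Finset.mem_union, not_or] at ha
    obtain ⟨ha1, ha2, ha3⟩ := ha
    have hBm : ∀ i < s, e i ∈ B := fun i hi => Finset.mem_image_of_mem e (Finset.mem_range.mpr hi)
    have hupd : ∀ i < s, Function.update e s a i = e i := fun i hi =>
      Function.update_of_ne hi.ne _ _
    refine ⟨Function.update e s a, ?_, ?_⟩
    · intro i hi j hj hij
      rcases Nat.lt_succ_iff_lt_or_eq.mp hi with hi | rfl
      · rw [hupd i hi]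
        rcases Nat.lt_succ_iff_lt_or_eq.mp hj with hj | rfl
        · rw [hupd j hj]
          exact he1 i hi j hj hij
        · rw [Function.update_self]
          exact fun h => ha1 (h ▸ hBm i hi)
      · rw [Function.update_self]
        rcases Nat.lt_succ_iff_lt_or_eq.mp hj with hj | rfl
        · rw [hupd j hj]
          exact fun h => ha1 (h ▸ hBm j hj)
        · exact absurd rfl hij
    · intro i hi j hj
      rcases Nat.lt_succ_iff_lt_or_eq.mp hi with hi | rfl
      · rw [hupd i hi]
        rcases Nat.lt_succ_iff_lt_or_eq.mp hj with hj | rfl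
        · rw [hupd j hj]
          exact he2 i hi j hj
        · rw [Function.update_self]
          exact fun h => ha3 (h ▸ Finset.mem_image_of_mem _ (hBm i hi))
      · rw [Function.update_self]
        rcases Nat.lt_succ_iff_lt_or_eq.mp hj with hj | rfl
        · rw [hupd j hj]
          intro h
          rw [Perm.inv_eq_iff_eq] at h
          exact ha2 (h ▸ Finset.mem_image_of_mem _ (hBm j hj))
        · rw [Function.update_self]
          intro h
          rw [Perm.inv_eq_iff_eq] at h
          exact Perm.mem_support.mp haq h.symm

theorem norm_sub_leftTrans_swap_mul_swap {f : EuclideanSpace ℝ (Perm (Fin n))}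
    {X : Finset (Fin n)} {a b a' b' : Fin n} (ha : a ∉ X) (ha' : a' ∉ X)
    (hb' : b' ∉ X) (hab : a ≠ b) (haa' : a ≠ a') (hab' : a ≠ b') (hba' : b ≠ a') (hbb' : b ≠ b')
    (hab'' : a' ≠ b') (hf : ∀ y ∈ permsOn (X ∪ {a, b, a', b'}), ConjInv f y)
    {x y z w : Fin n} (hx : x ∈ X) (hy : y ∈ X) (hz : z ∈ X) (hw : w ∈ X) (hxy : x ≠ y)
    (hxz : x ≠ z) (hxw : x ≠ w) (hyz : y ≠ z) (hyw : y ≠ w) (hzw : z ≠ w) :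
    ‖f - leftTrans (swap x y * swap z w) f‖ =
      ‖f - leftTrans (swap a' b' * swap a b) f‖ := by
  have hne : ∀ {c d : Fin n}, c ∉ X → d ∈ X → c ≠ d := fun hc hd h => hc (h ▸ hd)
  set v := swap a' x * swap b' y * swap a z * swap b w with hv
  have hva' : v a' = x := by
    simp only [hv, Perm.mul_apply]
    rw [swap_apply_of_ne_of_ne hba'.symm (hne ha' hw), swap_apply_of_ne_of_ne haa'.symm
      (hne ha' hz), swap_apply_of_ne_of_ne hab'' (hne ha' hy), swap_apply_left]
  have hvb' : v b' = y := by
    simp only [hv, Perm.mul_apply]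
    rw [swap_apply_of_ne_of_ne hbb'.symm (hne hb' hw), swap_apply_of_ne_of_ne hab'.symm
      (hne hb' hz), swap_apply_left, swap_apply_of_ne_of_ne (hne ha' hy).symm hxy.symm]
  have hva : v a = z := by
    simp only [hv, Perm.mul_apply]
    rw [swap_apply_of_ne_of_ne hab (hne ha hw), swap_apply_left,
      swap_apply_of_ne_of_ne (hne hb' hz).symm hyz.symm,
      swap_apply_of_ne_of_ne (hne ha' hz).symm hxz.symm]
  have hvb : v b = w := by
    simp only [hv, Perm.mul_apply]
    rw [swap_apply_left, swap_apply_of_ne_of_ne (hne ha hw).symm hzw.symm,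
      swap_apply_of_ne_of_ne (hne hb' hw).symm hyw.symm,
      swap_apply_of_ne_of_ne (hne ha' hw).symm hxw.symm]
  have h1 : v * (swap a' b' * swap a b) * v⁻¹ = swap x y * swap z w := by
    rw [← hva', ← hvb', ← hva, ← hvb, swap_apply_apply, swap_apply_apply]
    group
  rw [← h1]
  have hXs : ∀ {c}, c ∈ X → c ∈ X ∪ {a, b, a', b'} := fun h => Finset.mem_union_left _ h
  refine (hf v ?_).norm_sub_leftTrans_conj _
  refine mul_mem_permsOn (mul_mem_permsOn (mul_mem_permsOn ?_ ?_) ?_) ?_ <;>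
    refine swap_mem_permsOn ?_ (hXs (by assumption)) <;> simp

theorem norm_sub_leftTrans_three_cycle_le {f : EuclideanSpace ℝ (Perm (Fin n))}
    {X : Finset (Fin n)} (hX : 5 ≤ X.card) {δ : ℝ}
    (h : ∀ x ∈ X, ∀ y ∈ X, ∀ z ∈ X, ∀ w ∈ X, x ≠ y → x ≠ z → x ≠ w → y ≠ z → y ≠ w → z ≠ w →
      ‖f - leftTrans (swap x y * swap z w) f‖ ≤ δ)
    {x y z : Fin n} (hx : x ∈ X) (hy : y ∈ X) (hz : z ∈ X) (hxy : x ≠ y) (hyz : y ≠ z)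
    (hxz : x ≠ z) : ‖f - leftTrans (swap x y * swap y z) f‖ ≤ 2 * δ := by
  have hc : ((({x, y, z} : Finset (Fin n)))).card < X.card :=
    Finset.card_le_three.trans_lt (by omega)
  have hs : (({x, y, z} : Finset (Fin n))) ⊆ X := by
    intro c hc
    simp only [Finset.mem_insert, Finset.mem_singleton] at hc
    rcases hc with rfl | rfl | rfl <;> assumption
  have h2 : 1 < (X \ {x, y, z}).card := by
    rw [Finset.card_sdiff_of_subset hs]
    have : (({x, y, z} : Finset (Fin n))).card ≤ 3 := Finset.card_le_three
    omega
  obtain ⟨v, hv, w, hw, hvw⟩ := Finset.one_lt_card.mp h2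
  simp only [Finset.mem_sdiff, Finset.mem_insert, Finset.mem_singleton, not_or] at hv hw
  have h3 : swap x y * swap y z = (swap x y * swap v w) * (swap v w * swap y z) := by
    rw [mul_assoc, swap_mul_self_mul]
  rw [h3, two_mul]
  refine (norm_sub_leftTrans_mul_le _ _ _).trans (add_le_add ?_ ?_)
  · exact h x hx y hy v hv.1 w hw.1 hxy (Ne.symm hv.2.1) (Ne.symm hw.2.1) (Ne.symm hv.2.2.1)
      (Ne.symm hw.2.2.1) hvw
  · exact h v hv.1 w hw.1 y hy z hz hvw hv.2.2.1 hv.2.2.2 hw.2.2.1 hw.2.2.2 hyz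

theorem norm_cycleDev_sq_le (k : ℕ) : ‖cycleDev n k‖ ^ 2 ≤ n.factorial := by
  rw [EuclideanSpace.real_norm_sq_eq]
  refine (Finset.sum_le_card_nsmul _ _ 1 fun u _ => ?_).trans ?_
  · rw [← sq_abs]
    exact pow_le_one₀ (abs_nonneg _) (abs_cycleDev_le k u)
  · rw [Finset.card_univ, Fintype.card_perm, Fintype.card_fin]
    simp

theorem conjInv_cycleDev (k : ℕ) (y : Perm (Fin n)) : ConjInv (cycleDev n k) y := fun u => by
  rw [cycleDev_apply, cycleDev_apply, sameCycleProb_conj]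

theorem abs_inner_cycleDev_leftTrans_le {k M t : ℕ} (hk : 1 ≤ k) (hM : 5 ≤ M) (ht : 0 < t)
    (hMt : M + 4 * t ≤ n) {q : Perm (Fin n)} (hq : 6 * t ≤ q.support.card) :
    |inner ℝ (cycleDev n k) (leftTrans q (cycleDev n k))| ≤ (n.factorial : ℝ) *
      (Real.sqrt ((k - 1) / (M * (M - 1)) + (k : ℝ) ^ 2 / (M + k) + (k * M + k ^ 2) / n) +
        4 * M / Real.sqrt t) := by
  have hn : 0 < n := by omega
  obtain ⟨e, he1, he2⟩ := exists_separated_sequence hn (q := q) (s := 2 * t) (by omega)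
  set ψ := cycleDev n k with hψ
  set P := ((Finset.range (2 * t)).image e) ∪ ((Finset.range (2 * t)).image fun i => q⁻¹ (e i))
    with hP
  have hPc : P.card ≤ 4 * t := by
    refine (Finset.card_union_le _ _).trans ?_
    have h1 : ((Finset.range (2 * t)).image e).card ≤ 2 * t :=
      Finset.card_image_le.trans (by simp)
    have h2 : ((Finset.range (2 * t)).image fun i => q⁻¹ (e i)).card ≤ 2 * t :=
      Finset.card_image_le.trans (by simp)
    omega
  obtain ⟨X, hXP, hXc⟩ := Finset.exists_subset_card_eq (s := Pᶜ) (n := M) (by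
    rw [Finset.card_compl, Fintype.card_fin]
    omega)
  have heX : ∀ i < 2 * t, e i ∉ X := fun i hi hx =>
    Finset.mem_compl.mp (hXP hx) (Finset.mem_union_left _
      (Finset.mem_image_of_mem e (Finset.mem_range.mpr hi)))
  have heX' : ∀ i < 2 * t, q⁻¹ (e i) ∉ X := fun i hi hx =>
    Finset.mem_compl.mp (hXP hx) (Finset.mem_union_right _
      (Finset.mem_image_of_mem (fun i => q⁻¹ (e i)) (Finset.mem_range.mpr hi)))
  set y : ℕ → Perm (Fin n) := fun j => swap (e (2 * j)) (e (2 * j + 1)) with hy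
  set d : ℕ → Perm (Fin n) := fun j =>
    swap (q⁻¹ (e (2 * j))) (q⁻¹ (e (2 * j + 1))) * swap (e (2 * j)) (e (2 * j + 1)) with hd
  set D : ℕ → Finset (Fin n) := fun j =>
    {e (2 * j), e (2 * j + 1), q⁻¹ (e (2 * j)), q⁻¹ (e (2 * j + 1))} with hD
  have hdD : ∀ j, d j ∈ permsOn (D j) := fun j => by
    refine mul_mem_permsOn (swap_mem_permsOn ?_ ?_) (swap_mem_permsOn ?_ ?_) <;> simp [hD]
  have hinj : ∀ i < 2 * t, ∀ j < 2 * t, i ≠ j → q⁻¹ (e i) ≠ q⁻¹ (e j) := fun i hi j hj hij h =>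
    he1 i hi j hj hij (q⁻¹.injective h)
  have hDX : ∀ i < t, Disjoint X (D i) := by
    intro i hi
    simp only [hD, Finset.disjoint_insert_right, Finset.disjoint_singleton_right]
    exact ⟨heX _ (by omega), heX _ (by omega), heX' _ (by omega), heX' _ (by omega)⟩
  have hDD : ∀ j < t, ∀ i < j, Disjoint (D j) (D i) := by
    intro j hj i hi
    have h1 := he1 (2 * j) (by omega) (2 * i) (by omega) (by omega)
    have h2 := he1 (2 * j) (by omega) (2 * i + 1) (by omega) (by omega)
    have h3 := he1 (2 * j + 1) (by omega) (2 * i) (by omega) (by omega)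
    have h4 := he1 (2 * j + 1) (by omega) (2 * i + 1) (by omega) (by omega)
    have g1 := he2 (2 * j) (by omega) (2 * i) (by omega)
    have g2 := he2 (2 * j) (by omega) (2 * i + 1) (by omega)
    have g3 := he2 (2 * j + 1) (by omega) (2 * i) (by omega)
    have g4 := he2 (2 * j + 1) (by omega) (2 * i + 1) (by omega)
    have f1 := he2 (2 * i) (by omega) (2 * j) (by omega)
    have f2 := he2 (2 * i + 1) (by omega) (2 * j) (by omega)
    have f3 := he2 (2 * i) (by omega) (2 * j + 1) (by omega)
    have f4 := he2 (2 * i + 1) (by omega) (2 * j + 1) (by omega)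
    simp only [hD, Finset.disjoint_insert_right, Finset.disjoint_singleton_right,
      Finset.mem_insert, Finset.mem_singleton, not_or, (q⁻¹).injective.eq_iff]
    exact ⟨⟨h1.symm, h3.symm, g1.symm, g3.symm⟩, ⟨h2.symm, h4.symm, g2.symm, g4.symm⟩,
      ⟨f1, f3, h1.symm, h3.symm⟩, f2, f4, h2.symm, h4.symm⟩
  have hcomm : ∀ j < t, ∀ i < j, ∀ v ∈ permsOn (X ∪ D j), Commute v (d i) := by
    intro j hj i hi v hv
    exact commute_of_mem_permsOn (Finset.disjoint_union_left.mpr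
      ⟨hDX i (hi.trans hj), hDD j hj i hi⟩) hv (hdD i)
  obtain ⟨j, hj, hjδ⟩ := exists_norm_sub_avgSeq_le d ψ ht
  set f := avgSeq d ψ j with hf
  have hfc : ∀ v ∈ permsOn (X ∪ D j), ConjInv f v := fun v hv =>
    (conjInv_cycleDev k v).avgSeq j fun i hi => hcomm j hj i hi v hv
  have hinner : inner ℝ ψ (leftTrans q f) = inner ℝ ψ (leftTrans q ψ) := by
    refine inner_leftTrans_avgSeq (y := y) j (fun i _ => conjInv_cycleDev k _) (fun i _ => ?_)
      fun i hi l hl => ?_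
    · simp only [hd, hy]
      rw [swap_apply_apply q⁻¹, swap_inv]
      group
    · refine hcomm i (hi.trans hj) l hl _ (swap_mem_permsOn ?_ ?_) <;> simp [hD]
  have hn0 : (0 : ℝ) < n.factorial := by positivity
  have hψn : ‖ψ‖ ≤ Real.sqrt n.factorial := Real.le_sqrt_of_sq_le (norm_cycleDev_sq_le k)
  have h4 : ∀ x ∈ X, ∀ y ∈ X, ∀ z ∈ X, ∀ w ∈ X, x ≠ y → x ≠ z → x ≠ w → y ≠ z → y ≠ w → z ≠ w →
      ‖f - leftTrans (swap x y * swap z w) f‖ ≤ 2 * ‖ψ‖ / Real.sqrt t := by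
    intro x hx y hy z hz w hw hxy hxz hxw hyz hyw hzw
    refine (norm_sub_leftTrans_swap_mul_swap (heX (2 * j) (by omega))
      (heX' (2 * j) (by omega)) (heX' (2 * j + 1) (by omega))
      (he1 _ (by omega) _ (by omega) (by omega)) (he2 _ (by omega) _ (by omega)).symm
      (he2 _ (by omega) _ (by omega)).symm (he2 _ (by omega) _ (by omega)).symm
      (he2 _ (by omega) _ (by omega)).symm (hinj _ (by omega) _ (by omega) (by omega)) hfc
      hx hy hz hw hxy hxz hxw hyz hyw hzw).trans_le hjδ
  have h3 : ‖f - altAvg X f‖ ≤ M * (2 * (2 * ‖ψ‖ / Real.sqrt t)) := by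
    refine norm_sub_altAvg_le (by omega) fun σ hσ hs => ?_
    rw [← hXc]
    exact norm_sub_leftTrans_le_of_even (by positivity) (fun x hx y hy z hz hxy hyz hxz =>
      norm_sub_leftTrans_three_cycle_le (by omega) h4 hx hy hz hxy hyz hxz) subset_rfl hσ hs
  have h2 : ‖altAvg X f‖ ≤ Real.sqrt n.factorial *
      Real.sqrt ((k - 1) / (M * (M - 1)) + (k : ℝ) ^ 2 / (M + k) + (k * M + k ^ 2) / n) := by
    rw [← Real.sqrt_mul hn0.le]
    refine (norm_altAvg_avgSeq_le j (fun i hi σ hσ => ?_) ψ).trans (Real.le_sqrt_of_sq_le ?_)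
    · exact commute_of_mem_permsOn (hDX i (hi.trans hj)) hσ (hdD i)
    · have := norm_altAvg_cycleDev_sq_le hn (X := X) (by omega) hk
      rwa [hXc] at this
  have h1 : ‖f‖ ≤ Real.sqrt n.factorial *
      (Real.sqrt ((k - 1) / (M * (M - 1)) + (k : ℝ) ^ 2 / (M + k) + (k * M + k ^ 2) / n) +
        4 * M / Real.sqrt t) := by
    have h5 : ‖f‖ ≤ ‖altAvg X f‖ + ‖f - altAvg X f‖ := by
      have := norm_add_le (altAvg X f) (f - altAvg X f)
      rwa [add_sub_cancel] at this
    have h6 : M * (2 * (2 * ‖ψ‖ / Real.sqrt t)) ≤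
        Real.sqrt n.factorial * (4 * M / Real.sqrt t) := by
      rw [show (M : ℝ) * (2 * (2 * ‖ψ‖ / Real.sqrt t)) = ‖ψ‖ * (4 * M / Real.sqrt t) by ring]
      gcongr
    rw [mul_add]
    linarith
  rw [← hinner]
  refine (abs_real_inner_le_norm _ _).trans ?_
  rw [norm_leftTrans, ← Real.mul_self_sqrt hn0.le, mul_assoc]
  gcongr

end Decorrelation

section CycleLength

variable {n : ℕ}

/-- The cycle of `u` through `x`. -/
noncomputable def cyc (u : Perm (Fin n)) (x : Fin n) : Finset (Fin n) :=
  Finset.univ.filter fun z => u.SameCycle x z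

theorem mem_cyc {u : Perm (Fin n)} {x z : Fin n} : z ∈ cyc u x ↔ u.SameCycle x z := by
  simp [cyc]

theorem self_mem_cyc (u : Perm (Fin n)) (x : Fin n) : x ∈ cyc u x :=
  mem_cyc.mpr (Perm.SameCycle.refl u x)

theorem cyc_eq_of_mem {u : Perm (Fin n)} {x z : Fin n} (h : z ∈ cyc u x) : cyc u z = cyc u x := by
  ext y
  rw [mem_cyc, mem_cyc]
  exact ⟨fun h' => (mem_cyc.mp h).trans h', fun h' => (mem_cyc.mp h).symm.trans h'⟩

theorem card_cyc_pos (u : Perm (Fin n)) (x : Fin n) : 0 < (cyc u x).card :=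
  Finset.card_pos.mpr ⟨x, self_mem_cyc u x⟩

theorem card_cyc_eq_minimalPeriod (u : Perm (Fin n)) (x : Fin n) :
    (cyc u x).card = Function.minimalPeriod u x := by
  have h := MulAction.minimalPeriod_eq_card (a := u) (b := x)
  have h1 : (fun y : Fin n => u • y) = u := rfl
  rw [h1] at h
  rw [h, ← Set.toFinset_card]
  congr 1
  ext z
  rw [mem_cyc, Set.mem_toFinset, MulAction.mem_orbit_iff]
  constructor
  · rintro ⟨i, rfl⟩
    exact ⟨⟨u ^ i, i, rfl⟩, rfl⟩
  · rintro ⟨⟨_, i, rfl⟩, rfl⟩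
    exact ⟨i, rfl⟩

theorem card_cyc_dvd {u : Perm (Fin n)} {x : Fin n} {m : ℕ} (h : (u ^ m) x = x) :
    (cyc u x).card ∣ m := by
  rw [card_cyc_eq_minimalPeriod]
  refine Function.IsPeriodicPt.minimalPeriod_dvd ?_
  rwa [Function.IsPeriodicPt, Function.IsFixedPt, ← Perm.coe_pow]

theorem pow_card_cyc_apply (u : Perm (Fin n)) (x : Fin n) : (u ^ (cyc u x).card) x = x := by
  rw [card_cyc_eq_minimalPeriod, Perm.coe_pow]
  exact Function.iterate_minimalPeriod

theorem pow_card_cyc_apply_of_mem {u : Perm (Fin n)} {x z : Fin n} (h : z ∈ cyc u x) :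
    (u ^ (cyc u x).card) z = z := by
  rw [← cyc_eq_of_mem h]
  exact pow_card_cyc_apply u z

theorem cyc_mul_swap_self {w : Perm (Fin n)} {e p : Fin n} (he : w e = e) (hp : p ≠ e) :
    cyc (w * swap e p) e = insert e (cyc w p) := by
  have h1 : (w * swap e p) p = e := by rw [Perm.mul_apply, swap_apply_right, he]
  have h2 : (w * swap e p).SameCycle p e := by
    have := (Perm.SameCycle.refl (w * swap e p) p).apply_right
    rwa [h1] at this
  ext z
  rw [mem_cyc, Finset.mem_insert, mem_cyc]
  by_cases hz : z = e
  · simp [hz, Perm.SameCycle.refl]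
  · rw [← sameCycle_mul_swap he p hp hz]
    constructor
    · exact fun h => Or.inr (h2.trans h)
    · exact fun h => h2.symm.trans (h.resolve_left hz)

theorem notMem_cyc_of_fixed {w : Perm (Fin n)} {e p : Fin n} (he : w e = e) (hp : p ≠ e) :
    e ∉ cyc w p := by
  rw [mem_cyc]
  exact fun h => hp (h.symm.eq_of_left he).symm

theorem card_cyc_mul_swap_self {w : Perm (Fin n)} {e p : Fin n} (he : w e = e) (hp : p ≠ e) :
    (cyc (w * swap e p) e).card = (cyc w p).card + 1 := by
  rw [cyc_mul_swap_self he hp, Finset.card_insert_of_notMem (notMem_cyc_of_fixed he hp)]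

theorem cyc_of_fixed {w : Perm (Fin n)} {e : Fin n} (he : w e = e) : cyc w e = {e} := by
  ext z
  rw [mem_cyc, Finset.mem_singleton]
  constructor
  · exact fun h => (h.eq_of_left he).symm
  · rintro rfl
    exact Perm.SameCycle.refl _ _

theorem cyc_mul_swap_of_notMem {w : Perm (Fin n)} {e p y : Fin n} (he : w e = e) (hy : y ≠ e)
    (h : y ∉ cyc (w * swap e p) e) : cyc (w * swap e p) y = cyc w y := by
  ext z
  rw [mem_cyc, mem_cyc]
  by_cases hz : z = e
  · rw [hz]
    constructor
    · exact fun h' => absurd (mem_cyc.mpr h'.symm) h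
    · exact fun h' => absurd (mem_cyc.mpr h') (notMem_cyc_of_fixed he hy)
  · exact sameCycle_mul_swap he p hy hz

theorem sum_card_cyc_eq_le (Z : Finset (Fin n)) (d : ℕ) :
    ∑ x ∈ Z, ∑ u ∈ permsOn Z, (if (cyc u x).card = d then (1 : ℝ) else 0) ≤
      Z.card.factorial := by
  induction d generalizing Z with
  | zero =>
    rw [Finset.sum_eq_zero]
    · positivity
    · exact fun x _ => Finset.sum_eq_zero fun u _ => if_neg (card_cyc_pos u x).ne'
  | succ d ih =>
    have key : ∀ e ∈ Z, ∑ u ∈ permsOn Z, (if (cyc u e).card = d + 1 then (1 : ℝ) else 0) ≤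
        (Z.card - 1).factorial := by
      intro e he
      rw [← Finset.insert_erase he, sum_permsOn_insert (Finset.notMem_erase e Z),
        Finset.insert_erase he, ← Finset.card_erase_of_mem he, ← Finset.add_sum_erase _ _ he]
      have hfix : ∀ u ∈ permsOn (Z.erase e), u e = e := fun u hu =>
        mem_permsOn.mp hu e (Finset.notMem_erase e Z)
      have h1 : ∑ u ∈ permsOn (Z.erase e),
          (if (cyc (u * swap e e) e).card = d + 1 then (1 : ℝ) else 0) =
          if d = 0 then ((Z.erase e).card.factorial : ℝ) else 0 := by
        have : ∀ u ∈ permsOn (Z.erase e),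
            (if (cyc (u * swap e e) e).card = d + 1 then (1 : ℝ) else 0) =
            if d = 0 then 1 else 0 := by
          intro u hu
          rw [swap_self, ← Perm.one_def, mul_one, cyc_of_fixed (hfix u hu),
            Finset.card_singleton]
          exact if_congr (by omega) rfl rfl
        rw [Finset.sum_congr rfl this, Finset.sum_const, nsmul_eq_mul, card_permsOn]
        simp
      have h2 : ∑ p ∈ Z.erase e, ∑ u ∈ permsOn (Z.erase e),
          (if (cyc (u * swap e p) e).card = d + 1 then (1 : ℝ) else 0) =
          ∑ p ∈ Z.erase e, ∑ u ∈ permsOn (Z.erase e),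
            if (cyc u p).card = d then (1 : ℝ) else 0 := by
        refine Finset.sum_congr rfl fun p hp => Finset.sum_congr rfl fun u hu => ?_
        rw [card_cyc_mul_swap_self (hfix u hu) (Finset.ne_of_mem_erase hp)]
        exact if_congr (by omega) rfl rfl
      rw [h1, h2]
      by_cases hd : d = 0
      · rw [if_pos hd, Finset.sum_eq_zero, add_zero]
        exact fun x _ => Finset.sum_eq_zero fun u _ =>
          if_neg (by rw [hd]; exact (card_cyc_pos u x).ne')
      · rw [if_neg hd, zero_add]
        exact ih _
    refine (Finset.sum_le_card_nsmul _ _ _ key).trans ?_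
    rw [nsmul_eq_mul]
    rcases Finset.eq_empty_or_nonempty Z with rfl | hZ
    · simp
    · exact_mod_cast (Nat.mul_factorial_pred (Finset.card_pos.mpr hZ).ne').le

theorem sum_card_cyc_eq_eq_le (Z : Finset (Fin n)) (d d' : ℕ) :
    ∑ x ∈ Z, ∑ u ∈ permsOn Z, ∑ y ∈ Z,
      (if (cyc u x).card = d ∧ (cyc u y).card = d' ∧ y ∉ cyc u x then (1 : ℝ) else 0) ≤
      Z.card.factorial := by
  induction d generalizing Z with
  | zero =>
    rw [Finset.sum_eq_zero]
    · positivity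
    · exact fun x _ => Finset.sum_eq_zero fun u _ => Finset.sum_eq_zero fun y _ =>
        if_neg fun h => (card_cyc_pos u x).ne' h.1
  | succ d ih =>
    have key : ∀ e ∈ Z, ∑ u ∈ permsOn Z, ∑ y ∈ Z,
        (if (cyc u e).card = d + 1 ∧ (cyc u y).card = d' ∧ y ∉ cyc u e then (1 : ℝ) else 0) ≤
        (Z.card - 1).factorial := by
      intro e he
      rw [← Finset.insert_erase he, sum_permsOn_insert (Finset.notMem_erase e Z),
        Finset.insert_erase he, ← Finset.card_erase_of_mem he, ← Finset.add_sum_erase _ _ he]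
      have hfix : ∀ u ∈ permsOn (Z.erase e), u e = e := fun u hu =>
        mem_permsOn.mp hu e (Finset.notMem_erase e Z)
      have h1 : ∑ u ∈ permsOn (Z.erase e), ∑ y ∈ Z,
          (if (cyc (u * swap e e) e).card = d + 1 ∧ (cyc (u * swap e e) y).card = d' ∧
            y ∉ cyc (u * swap e e) e then (1 : ℝ) else 0) ≤
          if d = 0 then ((Z.erase e).card.factorial : ℝ) else 0 := by
        by_cases hd : d = 0
        · rw [if_pos hd]
          refine le_trans ?_ (sum_card_cyc_eq_le (Z.erase e) d')
          rw [Finset.sum_comm (s := Z.erase e)]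
          refine Finset.sum_le_sum fun u hu => ?_
          rw [swap_self, ← Perm.one_def, mul_one, ← Finset.add_sum_erase _ _ he, if_neg, zero_add]
          · refine Finset.sum_le_sum fun y _ => ?_
            split_ifs with h3 h4 <;> first | tauto | norm_num
          · exact fun h => h.2.2 (self_mem_cyc u e)
        · rw [if_neg hd]
          refine Finset.sum_nonpos fun u hu => Finset.sum_nonpos fun y _ => ?_
          rw [if_neg]
          rw [swap_self, ← Perm.one_def, mul_one, cyc_of_fixed (hfix u hu),
            Finset.card_singleton]
          omega
      have h2 : ∑ p ∈ Z.erase e, ∑ u ∈ permsOn (Z.erase e), ∑ y ∈ Z,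
          (if (cyc (u * swap e p) e).card = d + 1 ∧ (cyc (u * swap e p) y).card = d' ∧
            y ∉ cyc (u * swap e p) e then (1 : ℝ) else 0) ≤
          ∑ p ∈ Z.erase e, ∑ u ∈ permsOn (Z.erase e), ∑ y ∈ Z.erase e,
            if (cyc u p).card = d ∧ (cyc u y).card = d' ∧ y ∉ cyc u p then (1 : ℝ) else 0 := by
        refine Finset.sum_le_sum fun p hp => Finset.sum_le_sum fun u hu => ?_
        have hpe := Finset.ne_of_mem_erase hp
        rw [← Finset.add_sum_erase _ _ he, if_neg fun h => h.2.2 (self_mem_cyc _ e), zero_add]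
        refine Finset.sum_le_sum fun y hy => ?_
        by_cases h3 : (cyc (u * swap e p) e).card = d + 1 ∧ (cyc (u * swap e p) y).card = d' ∧
            y ∉ cyc (u * swap e p) e
        · rw [if_pos h3, if_pos]
          obtain ⟨h4, h5, h6⟩ := h3
          rw [cyc_mul_swap_of_notMem (hfix u hu) (Finset.ne_of_mem_erase hy) h6] at h5
          rw [card_cyc_mul_swap_self (hfix u hu) hpe] at h4
          rw [cyc_mul_swap_self (hfix u hu) hpe, Finset.mem_insert, not_or] at h6
          exact ⟨by omega, h5, h6.2⟩
        · rw [if_neg h3]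
          split_ifs <;> norm_num
      refine (add_le_add h1 h2).trans ?_
      by_cases hd : d = 0
      · rw [if_pos hd, Finset.sum_eq_zero, add_zero]
        exact fun x _ => Finset.sum_eq_zero fun u _ => Finset.sum_eq_zero fun y _ =>
          if_neg fun h => (card_cyc_pos u x).ne' (h.1.trans hd)
      · rw [if_neg hd, zero_add]
        exact ih _
    refine (Finset.sum_le_card_nsmul _ _ _ key).trans ?_
    rw [nsmul_eq_mul]
    rcases Finset.eq_empty_or_nonempty Z with rfl | hZ
    · simp
    · exact_mod_cast (Nat.mul_factorial_pred (Finset.card_pos.mpr hZ).ne').le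

end CycleLength

section SecondMoment

variable {n : ℕ}

theorem sum_mul_cycleDev_words (k : ℕ) (h : Perm (Fin n)) {i j : ℕ} (hij : i ≤ j) :
    ∑ g, cycleDev n k (h ^ (i + 1) * g) * cycleDev n k (h ^ (j + 1) * g) =
      inner ℝ (cycleDev n k) (leftTrans (h ^ (j - i)) (cycleDev n k)) := by
  rw [inner_eq_sum]
  refine Fintype.sum_equiv (Equiv.mulLeft (h ^ (j + 1))) _ _ fun g => ?_
  rw [leftTrans_apply, Equiv.coe_mulLeft, mul_comm]
  have e : (h ^ (j - i))⁻¹ * (h ^ (j + 1) * g) = h ^ (i + 1) * g := by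
    rw [inv_mul_eq_iff_eq_mul, ← mul_assoc (h ^ (j - i)), ← pow_add]
    congr 2
    omega
  rw [e]

theorem sum_sq_cycleDev_words_le (k r : ℕ) (h : Perm (Fin n)) {K : ℝ} (hK : 0 ≤ K)
    (H : ∀ d, 1 ≤ d → d < r →
      |inner ℝ (cycleDev n k) (leftTrans (h ^ d) (cycleDev n k))| ≤ K) :
    ∑ g, (∑ i ∈ Finset.range r, cycleDev n k (h ^ (i + 1) * g)) ^ 2 ≤
      r * n.factorial + (r : ℝ) ^ 2 * K := by
  have h1 : ∀ i ∈ Finset.range r, ∀ j ∈ Finset.range r,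
      ∑ g, cycleDev n k (h ^ (i + 1) * g) * cycleDev n k (h ^ (j + 1) * g) ≤
        (if i = j then (n.factorial : ℝ) else 0) + K := by
    intro i hi j hj
    rw [Finset.mem_range] at hi hj
    rcases lt_trichotomy i j with hij | rfl | hij
    · rw [sum_mul_cycleDev_words k h hij.le, if_neg hij.ne, zero_add]
      exact (le_abs_self _).trans (H _ (by omega) (by omega))
    · rw [sum_mul_cycleDev_words k h le_rfl, if_pos rfl, Nat.sub_self, pow_zero, map_one,
        Module.End.one_apply, real_inner_self_eq_norm_sq]
      linarith [norm_cycleDev_sq_le (n := n) k]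
    · have : ∑ g, cycleDev n k (h ^ (i + 1) * g) * cycleDev n k (h ^ (j + 1) * g) =
          ∑ g, cycleDev n k (h ^ (j + 1) * g) * cycleDev n k (h ^ (i + 1) * g) :=
        Finset.sum_congr rfl fun g _ => mul_comm _ _
      rw [this, sum_mul_cycleDev_words k h hij.le, if_neg hij.ne', zero_add]
      exact (le_abs_self _).trans (H _ (by omega) (by omega))
  calc ∑ g, (∑ i ∈ Finset.range r, cycleDev n k (h ^ (i + 1) * g)) ^ 2
      = ∑ i ∈ Finset.range r, ∑ j ∈ Finset.range r,
          ∑ g, cycleDev n k (h ^ (i + 1) * g) * cycleDev n k (h ^ (j + 1) * g) := by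
        simp_rw [pow_two, Finset.sum_mul_sum]
        rw [Finset.sum_comm]
        refine Finset.sum_congr rfl fun i _ => ?_
        rw [Finset.sum_comm]
    _ ≤ ∑ i ∈ Finset.range r, ∑ j ∈ Finset.range r,
          ((if i = j then (n.factorial : ℝ) else 0) + K) :=
        Finset.sum_le_sum fun i hi => Finset.sum_le_sum fun j hj => h1 i hi j hj
    _ = r * n.factorial + (r : ℝ) ^ 2 * K := by
        simp_rw [Finset.sum_add_distrib, Finset.sum_ite_eq]
        rw [Finset.sum_congr rfl fun i hi => if_pos hi]
        simp
        ring

theorem card_small_sameCycleProb_le {k r : ℕ} (hk : 1 ≤ k) (hr : 1 ≤ r) (h : Perm (Fin n)) {K : ℝ}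
    (hK : 0 ≤ K) (H : ∀ d, 1 ≤ d → d < r →
      |inner ℝ (cycleDev n k) (leftTrans (h ^ d) (cycleDev n k))| ≤ K) :
    ((Finset.univ.filter fun g : Perm (Fin n) =>
      ∀ i < r, sameCycleProb k (h ^ (i + 1) * g) ≤ 1 / (2 * k)).card : ℝ) ≤
      4 * (k : ℝ) ^ 2 * (n.factorial / r + K) := by
  have hk' : (0 : ℝ) < k := by exact_mod_cast hk
  have hr' : (0 : ℝ) < r := by exact_mod_cast hr
  set A := Finset.univ.filter fun g : Perm (Fin n) =>
      ∀ i < r, sameCycleProb k (h ^ (i + 1) * g) ≤ 1 / (2 * k) with hA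
  have h1 : ∀ g ∈ A, (r / (2 * k) : ℝ) ^ 2 ≤
      (∑ i ∈ Finset.range r, cycleDev n k (h ^ (i + 1) * g)) ^ 2 := by
    intro g hg
    have h2 : ∑ i ∈ Finset.range r, cycleDev n k (h ^ (i + 1) * g) ≤ -(r / (2 * k)) := by
      have : ∀ i ∈ Finset.range r, cycleDev n k (h ^ (i + 1) * g) ≤ -(1 / (2 * k)) := by
        intro i hi
        have := (Finset.mem_filter.mp hg).2 i (Finset.mem_range.mp hi)
        rw [cycleDev_apply]
        have e : (1 : ℝ) / k = 1 / (2 * k) + 1 / (2 * k) := by field_simp; norm_num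
        linarith
      refine (Finset.sum_le_card_nsmul _ _ _ this).trans_eq ?_
      rw [Finset.card_range, nsmul_eq_mul]
      ring
    have h3 : (0 : ℝ) ≤ r / (2 * k) := by positivity
    nlinarith
  have h2 := (Finset.card_nsmul_le_sum A _ _ h1).trans
    ((Finset.sum_le_univ_sum_of_nonneg fun g => sq_nonneg _).trans
      (sum_sq_cycleDev_words_le k r h hK H))
  rw [nsmul_eq_mul] at h2
  have h3 : (A.card : ℝ) = (A.card * (r / (2 * k) : ℝ) ^ 2) * (4 * k ^ 2 / r ^ 2) := by
    field_simp; norm_num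
  have h4 : 4 * (k : ℝ) ^ 2 * (n.factorial / r + K) =
      (r * n.factorial + (r : ℝ) ^ 2 * K) * (4 * k ^ 2 / r ^ 2) := by
    field_simp
  rw [h3, h4]
  exact mul_le_mul_of_nonneg_right h2 (by positivity)

theorem sum_card_fixed_pow_le {d : ℕ} (hd : 1 ≤ d) :
    ∑ h : Perm (Fin n), ((Finset.univ.filter fun x => (h ^ d) x = x).card : ℝ) ≤
      d * n.factorial := by
  calc ∑ h : Perm (Fin n), ((Finset.univ.filter fun x => (h ^ d) x = x).card : ℝ)
      ≤ ∑ h : Perm (Fin n), ∑ x, ∑ l ∈ Finset.Icc 1 d,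
          (if (cyc h x).card = l then (1 : ℝ) else 0) := by
        refine Finset.sum_le_sum fun h _ => ?_
        rw [Finset.card_filter, Nat.cast_sum]
        refine Finset.sum_le_sum fun x _ => ?_
        rw [Finset.sum_ite_eq, Nat.cast_ite, Nat.cast_one, Nat.cast_zero]
        by_cases hx : (h ^ d) x = x
        · rw [if_pos hx, if_pos]
          exact Finset.mem_Icc.mpr ⟨card_cyc_pos h x, Nat.le_of_dvd hd (card_cyc_dvd hx)⟩
        · rw [if_neg hx]
          split_ifs <;> norm_num
    _ = ∑ l ∈ Finset.Icc 1 d, ∑ x ∈ (Finset.univ : Finset (Fin n)),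
          ∑ h ∈ permsOn (Finset.univ : Finset (Fin n)),
            (if (cyc h x).card = l then (1 : ℝ) else 0) := by
        rw [permsOn_univ, Finset.sum_comm, Finset.sum_comm (s := Finset.Icc 1 d)]
        exact Finset.sum_congr rfl fun x _ => Finset.sum_comm
    _ ≤ ∑ l ∈ Finset.Icc 1 d, (n.factorial : ℝ) := by
        refine Finset.sum_le_sum fun l _ => ?_
        have := sum_card_cyc_eq_le (Finset.univ : Finset (Fin n)) l
        rwa [Finset.card_univ, Fintype.card_fin] at this
    _ = d * n.factorial := by simp

theorem card_small_support_pow_le {d s : ℕ} (hd : 1 ≤ d) (hs : s < n) :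
    ((Finset.univ.filter fun h : Perm (Fin n) => (h ^ d).support.card < s).card : ℝ) ≤
      d * n.factorial / (n - s) := by
  have hs' : (0 : ℝ) < n - s := by
    have : (s : ℝ) < n := by exact_mod_cast hs
    linarith
  rw [le_div_iff₀ hs']
  refine le_trans ?_ (sum_card_fixed_pow_le hd)
  rw [← nsmul_eq_mul]
  refine le_trans (Finset.card_nsmul_le_sum _
    (fun h : Perm (Fin n) => ((Finset.univ.filter fun x => (h ^ d) x = x).card : ℝ)) _ ?_)
    (Finset.sum_le_univ_sum_of_nonneg fun h => Nat.cast_nonneg _)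
  intro h hh
  have h1 := (Finset.mem_filter.mp hh).2
  have h2 : (Finset.univ.filter fun x => (h ^ d) x = x).card + (h ^ d).support.card = n := by
    have h3 : (h ^ d).support = Finset.univ.filter fun x => ¬ (h ^ d) x = x := by
      ext x
      simp [Perm.mem_support]
    rw [h3, Finset.card_filter_add_card_filter_not]
    simp
  have h4 : (n : ℝ) = (Finset.univ.filter fun x => (h ^ d) x = x).card +
    ((h ^ d).support.card : ℝ) := by exact_mod_cast h2.symm
  have h5 : ((h ^ d).support.card : ℝ) < s := by exact_mod_cast h1
  linarith

theorem card_exists_small_support_pow_le {s : ℕ} (r : ℕ) (hs : s < n) :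
    ((Finset.univ.filter fun h : Perm (Fin n) =>
      ∃ d, 1 ≤ d ∧ d < r ∧ (h ^ d).support.card < s).card : ℝ) ≤
      (r : ℝ) ^ 2 * n.factorial / (n - s) := by
  have hs' : (0 : ℝ) < n - s := by
    have : (s : ℝ) < n := by exact_mod_cast hs
    linarith
  have h1 : (Finset.univ.filter fun h : Perm (Fin n) =>
      ∃ d, 1 ≤ d ∧ d < r ∧ (h ^ d).support.card < s) ⊆
      (Finset.Ico 1 r).biUnion fun d =>
        Finset.univ.filter fun h : Perm (Fin n) => (h ^ d).support.card < s := by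
    intro h hh
    obtain ⟨d, hd1, hd2, hd3⟩ := (Finset.mem_filter.mp hh).2
    exact Finset.mem_biUnion.mpr ⟨d, Finset.mem_Ico.mpr ⟨hd1, hd2⟩,
      Finset.mem_filter.mpr ⟨Finset.mem_univ _, hd3⟩⟩
  have h2 := (Finset.card_le_card h1).trans Finset.card_biUnion_le
  calc _ ≤ ∑ d ∈ Finset.Ico 1 r, ((Finset.univ.filter fun h : Perm (Fin n) =>
        (h ^ d).support.card < s).card : ℝ) := by exact_mod_cast h2
    _ ≤ ∑ d ∈ Finset.Ico 1 r, (r * n.factorial / (n - s) : ℝ) := by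
        refine Finset.sum_le_sum fun d hd => ?_
        rw [Finset.mem_Ico] at hd
        refine (card_small_support_pow_le hd.1 hs).trans ?_
        have : (d : ℝ) ≤ r := by exact_mod_cast hd.2.le
        gcongr
    _ ≤ (r : ℝ) * (r * n.factorial / (n - s)) := by
        rw [Finset.sum_const, Nat.card_Ico, nsmul_eq_mul]
        have : ((r - 1 : ℕ) : ℝ) ≤ r := by exact_mod_cast Nat.sub_le r 1
        exact mul_le_mul_of_nonneg_right this (by positivity)
    _ = _ := by ring

theorem card_filter_prod_le {α β : Type*} [Fintype α] [Fintype β] (P : α → β → Prop)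
    [DecidablePred fun p : α × β => P p.1 p.2] [∀ b, DecidablePred fun a => P a b] (B : Finset β) {K : ℝ} (hK : 0 ≤ K)
    (H : ∀ b ∉ B, ((Finset.univ.filter fun a => P a b).card : ℝ) ≤ K) :
    ((Finset.univ.filter fun p : α × β => P p.1 p.2).card : ℝ) ≤
      B.card * Fintype.card α + Fintype.card β * K := by
  have h1 : ((Finset.univ.filter fun p : α × β => P p.1 p.2).card : ℝ) =
      ∑ b : β, ((Finset.univ.filter fun a => P a b).card : ℝ) := by
    rw [Finset.card_filter, Fintype.sum_prod_type_right]
    push_cast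
    refine Finset.sum_congr rfl fun b _ => ?_
    rw [Finset.card_filter]
    push_cast
    rfl
  rw [h1]
  calc ∑ b : β, ((Finset.univ.filter fun a => P a b).card : ℝ)
      ≤ ∑ b : β, ((if b ∈ B then (Fintype.card α : ℝ) else 0) + K) := by
        refine Finset.sum_le_sum fun b _ => ?_
        by_cases hb : b ∈ B
        · rw [if_pos hb]
          have : ((Finset.univ.filter fun a => P a b).card : ℝ) ≤ Fintype.card α := by
            exact_mod_cast Finset.card_le_univ _
          linarith
        · rw [if_neg hb, zero_add]
          exact H b hb
    _ = _ := by
        rw [Finset.sum_add_distrib, Finset.sum_const, Finset.card_univ, nsmul_eq_mul]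
        simp

theorem card_pairs_small_sameCycleProb_le {k r M t : ℕ} (hk : 1 ≤ k) (hr : 1 ≤ r) (hM : 5 ≤ M)
    (ht : 0 < t) (hMt : M + 4 * t ≤ n) (htn : 6 * t < n) :
    ((Finset.univ.filter fun p : Perm (Fin n) × Perm (Fin n) =>
      ∀ i < r, sameCycleProb k (p.2 ^ (i + 1) * p.1) ≤ 1 / (2 * k)).card : ℝ) ≤
      ((r : ℝ) ^ 2 / (n - (6 * t : ℕ)) + 4 * (k : ℝ) ^ 2 * (1 / r +
        (Real.sqrt ((k - 1) / (M * (M - 1)) + (k : ℝ) ^ 2 / (M + k) + (k * M + k ^ 2) / n) +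
          4 * M / Real.sqrt t))) * (n.factorial : ℝ) ^ 2 := by
  set ρ : ℝ := Real.sqrt ((k - 1) / (M * (M - 1)) + (k : ℝ) ^ 2 / (M + k) +
    (k * M + k ^ 2) / n) + 4 * M / Real.sqrt t with hρ
  have hρ0 : 0 ≤ ρ := by positivity
  refine (card_filter_prod_le (α := Perm (Fin n)) (β := Perm (Fin n))
    (fun g h => ∀ i < r, sameCycleProb k (h ^ (i + 1) * g) ≤ 1 / (2 * k))
    (Finset.univ.filter fun h : Perm (Fin n) =>
      ∃ d, 1 ≤ d ∧ d < r ∧ (h ^ d).support.card < 6 * t)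
    (K := 4 * (k : ℝ) ^ 2 * (n.factorial / r + n.factorial * ρ)) (by positivity) ?_).trans ?_
  · intro h hh
    refine card_small_sameCycleProb_le hk hr h (by positivity) fun d hd1 hd2 => ?_
    refine abs_inner_cycleDev_leftTrans_le hk hM ht hMt ?_
    by_contra! hc
    exact hh (Finset.mem_filter.mpr ⟨Finset.mem_univ _, d, hd1, hd2, hc⟩)
  · rw [Fintype.card_perm, Fintype.card_fin]
    have h1 := card_exists_small_support_pow_le r htn
    calc _ ≤ (r : ℝ) ^ 2 * n.factorial / (n - (6 * t : ℕ)) * n.factorial +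
          n.factorial * (4 * (k : ℝ) ^ 2 * (n.factorial / r + n.factorial * ρ)) := by
          gcongr
      _ = _ := by ring

end SecondMoment

section LongCycle

variable {n : ℕ}

theorem sameCycleProb_le_of_card_cyc_le (hn : 0 < n) (m : ℕ) {u : Perm (Fin n)} {θ : ℝ}
    (hu : ∀ x, ((cyc u x).card : ℝ) ≤ θ * n) : sameCycleProb (m + 1) u ≤ θ ^ m := by
  have hn' : (0 : ℝ) < n := by exact_mod_cast hn
  rw [sameCycleProb, div_le_iff₀ (by positivity)]
  calc ∑ a : Fin (m + 1) → Fin n,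
        (if AllSame u (Finset.univ.image a) then (1 : ℝ) else 0)
      = ∑ p : Fin n × (Fin m → Fin n),
          (if AllSame u (Finset.univ.image (Fin.consEquiv (fun _ => Fin n) p))
            then (1 : ℝ) else 0) :=
        (Equiv.sum_comp (Fin.consEquiv fun _ : Fin (m + 1) => Fin n)
          fun a => if AllSame u (Finset.univ.image a) then (1 : ℝ) else 0).symm
    _ ≤ ∑ p : Fin n × (Fin m → Fin n),
          (if p.2 ∈ Fintype.piFinset (fun _ : Fin m => cyc u p.1) then (1 : ℝ) else 0) := by
        refine Finset.sum_le_sum fun p _ => ?_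
        by_cases h : AllSame u (Finset.univ.image (Fin.consEquiv (fun _ => Fin n) p))
        · rw [if_pos h, if_pos]
          rw [Fintype.mem_piFinset]
          intro i
          rw [mem_cyc]
          exact h _ (Finset.mem_image.mpr ⟨0, Finset.mem_univ _, rfl⟩) _
            (Finset.mem_image.mpr ⟨i.succ, Finset.mem_univ _, rfl⟩)
        · rw [if_neg h]
          split_ifs <;> norm_num
    _ = ∑ x : Fin n, ((cyc u x).card : ℝ) ^ m := by
        rw [Fintype.sum_prod_type]
        refine Finset.sum_congr rfl fun x _ => ?_
        dsimp only
        rw [Finset.sum_ite_mem, Finset.univ_inter, Finset.sum_const, Fintype.card_piFinset]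
        simp
    _ ≤ ∑ x : Fin n, (θ * n) ^ m :=
        Finset.sum_le_sum fun x _ => pow_le_pow_left₀ (Nat.cast_nonneg _) (hu x) m
    _ = θ ^ m * (n : ℝ) ^ (m + 1) := by
        rw [Finset.sum_const, Finset.card_univ, Fintype.card_fin, nsmul_eq_mul, mul_pow]
        ring

theorem eventually_exists_long_cycle {ε : ℝ} (hε : 0 < ε) : ∃ r : ℕ, ∀ᶠ n : ℕ in Filter.atTop,
    ((Finset.univ.filter fun p : Perm (Fin n) × Perm (Fin n) =>
      ∀ i < r, ∀ x, 24 * (cyc (p.2 ^ (i + 1) * p.1) x).card ≤ 23 * n).card : ℝ) ≤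
      ε * (n.factorial : ℝ) ^ 2 := by
  set δ : ℝ := ε / (4 * (4 * (256 : ℝ) ^ 2)) with hδ
  have hδ0 : 0 < δ := by positivity
  obtain ⟨r, hr⟩ := exists_nat_ge (1 + 1 / δ)
  obtain ⟨M, hM⟩ := exists_nat_ge (5 + 131582 / δ ^ 2)
  obtain ⟨t, ht⟩ := exists_nat_ge (1 + (4 * M / δ) ^ 2)
  have h1δ : 0 < 1 / δ := by positivity
  have hr1 : (1 : ℝ) < r := by linarith
  have hM5 : (5 : ℝ) < M := by
    have : 0 < 131582 / δ ^ 2 := by positivity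
    linarith
  have ht1 : (0 : ℝ) < t := by linarith [sq_nonneg (4 * M / δ)]
  refine ⟨r, ?_⟩
  obtain ⟨N, hN⟩ := exists_nat_ge (M + 10 * t + (256 * M + 65536) / (δ ^ 2 / 2) +
    (r : ℝ) ^ 2 / (ε / 4))
  filter_upwards [Filter.eventually_ge_atTop N] with n hn
  have hn' : (N : ℝ) ≤ n := by exact_mod_cast hn
  have p1 : (0 : ℝ) ≤ (256 * M + 65536) / (δ ^ 2 / 2) := by positivity
  have p2 : (0 : ℝ) ≤ (r : ℝ) ^ 2 / (ε / 4) := by positivity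
  have hn0 : (0 : ℝ) < n := by linarith
  have hn0' : 0 < n := by exact_mod_cast hn0
  have hMt : M + 4 * t ≤ n := by
    have : (M : ℝ) + 4 * t ≤ n := by linarith
    exact_mod_cast this
  have htn : 6 * t < n := by
    have : 6 * (t : ℝ) < n := by linarith
    exact_mod_cast this
  have main := card_pairs_small_sameCycleProb_le (n := n) (k := 256) (r := r) (M := M) (t := t)
    (by norm_num) (by exact_mod_cast hr1.le) (by exact_mod_cast hM5.le) (by exact_mod_cast ht1)
    hMt htn
  refine le_trans ?_ (main.trans ?_)
  · refine Nat.cast_le.mpr (Finset.card_le_card fun p hp => ?_)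
    rw [Finset.mem_filter] at hp ⊢
    refine ⟨hp.1, fun i hi => ?_⟩
    refine (sameCycleProb_le_of_card_cyc_le hn0' 255 (θ := 23 / 24) fun x => ?_).trans ?_
    · have : (24 : ℝ) * (cyc (p.2 ^ (i + 1) * p.1) x).card ≤ 23 * n := by
        exact_mod_cast hp.2 i hi x
      linarith
    · norm_num
  · refine mul_le_mul_of_nonneg_right ?_ (by positivity)
    have b1 : (r : ℝ) ^ 2 / (n - (6 * t : ℕ)) ≤ ε / 4 := by
      have h1 : (r : ℝ) ^ 2 / (ε / 4) ≤ n - (6 * t : ℕ) := by push_cast; linarith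
      have h2 : (0 : ℝ) < n - (6 * t : ℕ) := by push_cast; linarith
      rw [div_le_iff₀ (by positivity)] at h1
      rw [div_le_iff₀ h2]
      linarith
    have b2 : 1 / (r : ℝ) ≤ δ := by
      rw [div_le_iff₀ (by linarith)]
      have h1 : 1 / δ ≤ r := by linarith
      rw [div_le_iff₀ hδ0] at h1
      linarith
    have b3 : ((256 : ℕ) - 1 : ℝ) / (M * (M - 1)) + ((256 : ℕ) : ℝ) ^ 2 / (M + (256 : ℕ)) ≤
        δ ^ 2 / 2 := by
      have h1 : ((256 : ℕ) - 1 : ℝ) / (M * (M - 1)) ≤ 255 / M := by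
        push_cast
        norm_num
        refine div_le_div_of_nonneg_left (by norm_num) (by linarith) ?_
        nlinarith
      have h2 : ((256 : ℕ) : ℝ) ^ 2 / (M + (256 : ℕ)) ≤ 65536 / M := by
        push_cast
        norm_num
        exact div_le_div_of_nonneg_left (by norm_num) (by linarith) (by linarith)
      have h3 : (65791 : ℝ) / M ≤ δ ^ 2 / 2 := by
        have h4 : 131582 / δ ^ 2 ≤ M := by linarith
        rw [div_le_iff₀ (by positivity)] at h4
        rw [div_le_iff₀ (by linarith)]
        linarith
      have h4 : (65791 : ℝ) / M = 255 / M + 65536 / M := by ring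
      linarith
    have b4 : (((256 : ℕ) : ℝ) * M + ((256 : ℕ) : ℝ) ^ 2) / n ≤ δ ^ 2 / 2 := by
      have h1 : (256 * M + 65536) / (δ ^ 2 / 2) ≤ n := by linarith
      rw [div_le_iff₀ (by positivity)] at h1
      rw [div_le_iff₀ hn0]
      push_cast
      linarith
    have b5 : Real.sqrt (((256 : ℕ) - 1 : ℝ) / (M * (M - 1)) +
        ((256 : ℕ) : ℝ) ^ 2 / (M + (256 : ℕ)) +
        (((256 : ℕ) : ℝ) * M + ((256 : ℕ) : ℝ) ^ 2) / n) ≤ δ := by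
      refine Real.sqrt_le_iff.mpr ⟨hδ0.le, ?_⟩
      linarith
    have b6 : 4 * M / Real.sqrt t ≤ δ := by
      have h1 : 4 * M / δ ≤ Real.sqrt t := by
        refine Real.le_sqrt_of_sq_le ?_
        linarith
      rw [div_le_iff₀ hδ0] at h1
      rw [div_le_iff₀ (Real.sqrt_pos.mpr ht1)]
      linarith
    have b7 : 4 * ((256 : ℕ) : ℝ) ^ 2 * δ = ε / 4 := by
      rw [hδ]
      push_cast
      field_simp
    have b8 : 4 * ((256 : ℕ) : ℝ) ^ 2 * (1 / r +
        (Real.sqrt (((256 : ℕ) - 1 : ℝ) / (M * (M - 1)) +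
        ((256 : ℕ) : ℝ) ^ 2 / (M + (256 : ℕ)) +
        (((256 : ℕ) : ℝ) * M + ((256 : ℕ) : ℝ) ^ 2) / n) + 4 * M / Real.sqrt t)) ≤
        4 * ((256 : ℕ) : ℝ) ^ 2 * (3 * δ) :=
      mul_le_mul_of_nonneg_left (by linarith) (by positivity)
    linarith

end LongCycle

section DividingCycles

variable {n : ℕ}

theorem sum_card_divisors_le (n : ℕ) :
    ∑ d ∈ Finset.Icc 1 n, (d.divisors.card : ℝ) ≤ n * (1 + Real.log n) := by
  have h1 : ∀ d ∈ Finset.Icc 1 n, (d.divisors.card : ℝ) =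
      ∑ e ∈ Finset.Icc 1 n, if e ∣ d then (1 : ℝ) else 0 := by
    intro d hd
    rw [Finset.mem_Icc] at hd
    rw [← Finset.sum_filter, Finset.sum_const, nsmul_eq_mul, mul_one]
    congr 2
    ext e
    rw [Nat.mem_divisors, Finset.mem_filter, Finset.mem_Icc]
    constructor
    · exact fun h => ⟨⟨Nat.pos_of_dvd_of_pos h.1 hd.1, (Nat.le_of_dvd hd.1 h.1).trans hd.2⟩, h.1⟩
    · exact fun h => ⟨h.2, by omega⟩
  rw [Finset.sum_congr rfl h1, Finset.sum_comm]
  have h2 : ∀ e ∈ Finset.Icc 1 n, ∑ d ∈ Finset.Icc 1 n, (if e ∣ d then (1 : ℝ) else 0) ≤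
      n * (e : ℝ)⁻¹ := by
    intro e _
    rw [← Finset.sum_filter, Finset.sum_const, nsmul_eq_mul, mul_one, ← div_eq_mul_inv]
    have h3 : Finset.filter (fun d => e ∣ d) (Finset.Icc 1 n) =
        Finset.filter (fun d => e ∣ d) (Finset.Ioc 0 n) := by
      ext d
      simp only [Finset.mem_filter, Finset.mem_Icc, Finset.mem_Ioc]
      omega
    rw [h3, Nat.Ioc_filter_dvd_card_eq_div]
    exact Nat.cast_div_le
  refine (Finset.sum_le_sum h2).trans ?_
  rw [← Finset.mul_sum]
  have h4 := harmonic_le_one_add_log n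
  rw [harmonic_eq_sum_Icc] at h4
  push_cast at h4
  exact mul_le_mul_of_nonneg_left h4 (Nat.cast_nonneg n)

theorem sum_card_lt_card_cyc_le (m : ℕ) :
    ∑ u : Perm (Fin n), ((Finset.univ.filter fun x => n < (cyc u x).card + m).card : ℝ) ≤
      m * n.factorial := by
  calc ∑ u : Perm (Fin n), ((Finset.univ.filter fun x => n < (cyc u x).card + m).card : ℝ)
      ≤ ∑ u : Perm (Fin n), ∑ x, ∑ l ∈ Finset.Ioc (n - m) n,
          (if (cyc u x).card = l then (1 : ℝ) else 0) := by
        refine Finset.sum_le_sum fun u _ => ?_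
        rw [Finset.card_filter, Nat.cast_sum]
        refine Finset.sum_le_sum fun x _ => ?_
        rw [Finset.sum_ite_eq, Nat.cast_ite, Nat.cast_one, Nat.cast_zero]
        have hle : (cyc u x).card ≤ n := (Finset.card_le_univ _).trans_eq (Fintype.card_fin n)
        by_cases hx : n < (cyc u x).card + m
        · rw [if_pos hx, if_pos]
          rw [Finset.mem_Ioc]
          have := card_cyc_pos u x
          omega
        · rw [if_neg hx]
          split_ifs <;> norm_num
    _ = ∑ l ∈ Finset.Ioc (n - m) n, ∑ x ∈ (Finset.univ : Finset (Fin n)),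
          ∑ u ∈ permsOn (Finset.univ : Finset (Fin n)),
            (if (cyc u x).card = l then (1 : ℝ) else 0) := by
        rw [permsOn_univ, Finset.sum_comm, Finset.sum_comm (s := Finset.Ioc (n - m) n)]
        exact Finset.sum_congr rfl fun x _ => Finset.sum_comm
    _ ≤ ∑ l ∈ Finset.Ioc (n - m) n, (n.factorial : ℝ) := by
        refine Finset.sum_le_sum fun l _ => ?_
        have := sum_card_cyc_eq_le (Finset.univ : Finset (Fin n)) l
        rwa [Finset.card_univ, Fintype.card_fin] at this
    _ ≤ m * n.factorial := by
        rw [Finset.sum_const, Nat.card_Ioc, nsmul_eq_mul]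
        have : ((n - (n - m) : ℕ) : ℝ) ≤ m := by
          have : n - (n - m) ≤ m := by omega
          exact_mod_cast this
        exact mul_le_mul_of_nonneg_right this (Nat.cast_nonneg _)

theorem sum_card_cyc_dvd_le :
    ∑ u : Perm (Fin n), ((Finset.univ.filter fun p : Fin n × Fin n =>
      (cyc u p.2).card ∣ (cyc u p.1).card ∧ p.2 ∉ cyc u p.1).card : ℝ) ≤
      n * (1 + Real.log n) * n.factorial := by
  calc ∑ u : Perm (Fin n), ((Finset.univ.filter fun p : Fin n × Fin n =>
        (cyc u p.2).card ∣ (cyc u p.1).card ∧ p.2 ∉ cyc u p.1).card : ℝ)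
      ≤ ∑ u : Perm (Fin n), ∑ x, ∑ y, ∑ d ∈ Finset.Icc 1 n, ∑ d' ∈ d.divisors,
          (if (cyc u x).card = d ∧ (cyc u y).card = d' ∧ y ∉ cyc u x then (1 : ℝ) else 0) := by
        refine Finset.sum_le_sum fun u _ => ?_
        rw [Finset.card_filter, Nat.cast_sum, Fintype.sum_prod_type]
        refine Finset.sum_le_sum fun x _ => Finset.sum_le_sum fun y _ => ?_
        rw [Nat.cast_ite, Nat.cast_one, Nat.cast_zero]
        have hle : (cyc u x).card ≤ n := (Finset.card_le_univ _).trans_eq (Fintype.card_fin n)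
        split_ifs with h
        · refine le_trans ?_ (Finset.single_le_sum (fun d _ => Finset.sum_nonneg fun d' _ => ?_)
            (Finset.mem_Icc.mpr ⟨card_cyc_pos u x, hle⟩))
          · refine le_trans ?_ (Finset.single_le_sum (fun d' _ => ?_)
              (Nat.mem_divisors.mpr ⟨h.1, (card_cyc_pos u x).ne'⟩))
            · rw [if_pos ⟨rfl, rfl, h.2⟩]
            · split_ifs <;> norm_num
          · split_ifs <;> norm_num
        · exact Finset.sum_nonneg fun d _ => Finset.sum_nonneg fun d' _ => by
            split_ifs <;> norm_num
    _ = ∑ d ∈ Finset.Icc 1 n, ∑ d' ∈ d.divisors, ∑ x ∈ (Finset.univ : Finset (Fin n)),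
          ∑ u ∈ permsOn (Finset.univ : Finset (Fin n)), ∑ y ∈ (Finset.univ : Finset (Fin n)),
          (if (cyc u x).card = d ∧ (cyc u y).card = d' ∧ y ∉ cyc u x then (1 : ℝ) else 0) := by
        rw [permsOn_univ]
        have e1 : ∀ (u : Perm (Fin n)) (x : Fin n), ∑ y, ∑ d ∈ Finset.Icc 1 n,
            ∑ d' ∈ d.divisors, (if (cyc u x).card = d ∧ (cyc u y).card = d' ∧ y ∉ cyc u x
              then (1 : ℝ) else 0) = ∑ d ∈ Finset.Icc 1 n, ∑ d' ∈ d.divisors, ∑ y,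
              (if (cyc u x).card = d ∧ (cyc u y).card = d' ∧ y ∉ cyc u x
                then (1 : ℝ) else 0) := fun u x => by
          rw [Finset.sum_comm]
          exact Finset.sum_congr rfl fun d _ => Finset.sum_comm
        simp_rw [e1]
        rw [Finset.sum_comm]
        have e2 : ∀ (x : Fin n) (F : Perm (Fin n) → ℕ → ℕ → ℝ),
            ∑ u, ∑ d ∈ Finset.Icc 1 n, ∑ d' ∈ d.divisors, F u d d' =
            ∑ d ∈ Finset.Icc 1 n, ∑ d' ∈ d.divisors, ∑ u, F u d d' := fun x F => by
          rw [Finset.sum_comm]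
          exact Finset.sum_congr rfl fun d _ => Finset.sum_comm
        rw [Finset.sum_congr rfl fun x _ => e2 x _, Finset.sum_comm]
        exact Finset.sum_congr rfl fun d _ => Finset.sum_comm
    _ ≤ ∑ d ∈ Finset.Icc 1 n, ∑ d' ∈ d.divisors, (n.factorial : ℝ) := by
        refine Finset.sum_le_sum fun d _ => Finset.sum_le_sum fun d' _ => ?_
        have := sum_card_cyc_eq_eq_le (Finset.univ : Finset (Fin n)) d d'
        rwa [Finset.card_univ, Fintype.card_fin] at this
    _ = (∑ d ∈ Finset.Icc 1 n, (d.divisors.card : ℝ)) * n.factorial := by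
        rw [Finset.sum_mul]
        exact Finset.sum_congr rfl fun d _ => by rw [Finset.sum_const, nsmul_eq_mul]
    _ ≤ _ := mul_le_mul_of_nonneg_right (sum_card_divisors_le n) (Nat.cast_nonneg _)

theorem card_filter_mul_le_sum {α : Type*} [Fintype α] (P : α → Prop) [DecidablePred P] {K : ℝ}
    {F : α → ℝ} (hF : ∀ a, 0 ≤ F a) (H : ∀ a, P a → K ≤ F a) :
    ((Finset.univ.filter P).card : ℝ) * K ≤ ∑ a, F a := by
  rw [← nsmul_eq_mul]
  exact (Finset.card_nsmul_le_sum _ F _ fun a ha => H a (Finset.mem_filter.mp ha).2).trans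
    (Finset.sum_le_univ_sum_of_nonneg hF)

/-- Some cycle of `u` contains at least half of the points and its length annihilates `u`. -/
def HasDividingLongCycle (u : Perm (Fin n)) : Prop :=
  ∃ x, n ≤ 2 * (cyc u x).card ∧ u ^ (cyc u x).card = 1

theorem card_hasDividingLongCycle_le (hn : 0 < n) {m : ℕ} (hm : 0 < m) :
    ((Finset.univ.filter fun u : Perm (Fin n) => HasDividingLongCycle u).card : ℝ) ≤
      (2 * m / n + 2 * (1 + Real.log n) / m) * n.factorial := by
  have hn' : (0 : ℝ) < n := by exact_mod_cast hn
  have hm' : (0 : ℝ) < m := by exact_mod_cast hm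
  have hA := card_filter_mul_le_sum
    (fun u : Perm (Fin n) => ∃ x, n ≤ 2 * (cyc u x).card ∧ n < (cyc u x).card + m)
    (K := (n : ℝ) / 2)
    (F := fun u => ((Finset.univ.filter fun x => n < (cyc u x).card + m).card : ℝ))
    (fun u => Nat.cast_nonneg _) (by
      rintro u ⟨x, h1, h2⟩
      have h3 : cyc u x ⊆ Finset.univ.filter fun x => n < (cyc u x).card + m := fun z hz => by
        rw [Finset.mem_filter, cyc_eq_of_mem hz]
        exact ⟨Finset.mem_univ _, h2⟩
      have h4 : (n : ℝ) ≤ 2 * (cyc u x).card := by exact_mod_cast h1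
      have h5 : ((cyc u x).card : ℝ) ≤
        ((Finset.univ.filter fun x => n < (cyc u x).card + m).card : ℝ) := by
          exact_mod_cast Finset.card_le_card h3
      linarith)
  have hB := card_filter_mul_le_sum
    (fun u : Perm (Fin n) => ∃ x, n ≤ 2 * (cyc u x).card ∧ (cyc u x).card + m ≤ n ∧
      u ^ (cyc u x).card = 1)
    (K := (n : ℝ) / 2 * m)
    (F := fun u => ((Finset.univ.filter fun p : Fin n × Fin n =>
      (cyc u p.2).card ∣ (cyc u p.1).card ∧ p.2 ∉ cyc u p.1).card : ℝ))
    (fun u => Nat.cast_nonneg _) (by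
      rintro u ⟨x, h1, h2, h3⟩
      have h4 : cyc u x ×ˢ (cyc u x)ᶜ ⊆ Finset.univ.filter fun p : Fin n × Fin n =>
          (cyc u p.2).card ∣ (cyc u p.1).card ∧ p.2 ∉ cyc u p.1 := fun p hp => by
        rw [Finset.mem_product, Finset.mem_compl] at hp
        rw [Finset.mem_filter, cyc_eq_of_mem hp.1]
        refine ⟨Finset.mem_univ _, card_cyc_dvd ?_, hp.2⟩
        rw [h3, Perm.one_apply]
      have h5 := Finset.card_le_card h4
      rw [Finset.card_product, Finset.card_compl, Fintype.card_fin] at h5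
      have h6 : (n : ℝ) / 2 ≤ (cyc u x).card := by
        have : (n : ℝ) ≤ 2 * (cyc u x).card := by exact_mod_cast h1
        linarith
      have h7 : (m : ℝ) ≤ ((n - (cyc u x).card : ℕ) : ℝ) := by
        have : m ≤ n - (cyc u x).card := by omega
        exact_mod_cast this
      calc (n : ℝ) / 2 * m ≤ (cyc u x).card * ((n - (cyc u x).card : ℕ) : ℝ) :=
            mul_le_mul h6 h7 hm'.le (Nat.cast_nonneg _)
        _ ≤ _ := by exact_mod_cast h5)
  have hA' := hA.trans (sum_card_lt_card_cyc_le m)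
  have hB' := hB.trans sum_card_cyc_dvd_le
  rw [← le_div_iff₀ (by positivity)] at hA' hB'
  have hU : (Finset.univ.filter fun u : Perm (Fin n) => HasDividingLongCycle u) ⊆
      (Finset.univ.filter fun u : Perm (Fin n) =>
        ∃ x, n ≤ 2 * (cyc u x).card ∧ n < (cyc u x).card + m) ∪
      (Finset.univ.filter fun u : Perm (Fin n) =>
        ∃ x, n ≤ 2 * (cyc u x).card ∧ (cyc u x).card + m ≤ n ∧ u ^ (cyc u x).card = 1) := by
    intro u hu
    obtain ⟨x, h1, h2⟩ := (Finset.mem_filter.mp hu).2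
    rw [Finset.mem_union, Finset.mem_filter, Finset.mem_filter]
    rcases lt_or_ge n ((cyc u x).card + m) with h | h
    · exact Or.inl ⟨Finset.mem_univ _, x, h1, h⟩
    · exact Or.inr ⟨Finset.mem_univ _, x, h1, h, h2⟩
  have hU' := (Finset.card_le_card hU).trans (Finset.card_union_le _ _)
  have e : (2 * m / n + 2 * (1 + Real.log n) / m) * n.factorial =
      m * n.factorial / (n / 2 : ℝ) + n * (1 + Real.log n) * n.factorial / (n / 2 * m : ℝ) := by
    field_simp
  rw [e]
  refine le_trans ?_ (add_le_add hA' hB')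
  exact_mod_cast hU'

theorem eventually_card_hasDividingLongCycle_le {ε : ℝ} (hε : 0 < ε) :
    ∀ᶠ n : ℕ in Filter.atTop, ((Finset.univ.filter fun u : Perm (Fin n) =>
      HasDividingLongCycle u).card : ℝ) ≤ ε * n.factorial := by
  have hδ : 0 < ε / 2 / (16 / ε + 2) := by positivity
  filter_upwards [Filter.eventually_ge_atTop 3, eventually_mul_log_pow_le 1 hδ] with n hn hlog
  have h1 := one_le_log hn
  have hn0 : (0 : ℝ) < n := by exact_mod_cast (by omega : 0 < n)
  have hpos : 0 < 8 * Real.log n / ε := by positivity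
  refine (card_hasDividingLongCycle_le (by omega) (Nat.ceil_pos.mpr hpos)).trans ?_
  refine mul_le_mul_of_nonneg_right ?_ (Nat.cast_nonneg _)
  have h2 := Nat.le_ceil (8 * Real.log n / ε)
  have h3 := (Nat.ceil_lt_add_one hpos.le).le
  set m : ℝ := ((⌈8 * Real.log n / ε⌉₊ : ℕ) : ℝ) with hm
  have hm0 : 0 < m := hpos.trans_le h2
  have h4 : 2 * m / n ≤ ε / 2 := by
    rw [pow_one, div_mul_eq_mul_div, le_div_iff₀ (by positivity)] at hlog
    rw [div_le_iff₀ hn0]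
    have : 2 * (8 * Real.log n / ε) = 16 / ε * Real.log n := by ring
    nlinarith
  have h5 : 2 * (1 + Real.log n) / m ≤ ε / 2 := by
    rw [div_le_iff₀ hε] at h2
    rw [div_le_iff₀ hm0]
    linarith
  linarith

end DividingCycles

section RandomGenerators

variable {n : ℕ}

/-- A power of a word `h ^ (i + 1) * g` with one long cycle is a short word of small support. -/
theorem exists_small_support_word {g h : Perm (Fin n)} {r i : ℕ} (hi : i < r) {x : Fin n}
    (hx : 23 * n < 24 * (cyc (h ^ (i + 1) * g) x).card)
    (h1 : (h ^ (i + 1) * g) ^ (cyc (h ^ (i + 1) * g) x).card ≠ 1) :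
    ∃ w : Perm (Fin n), w ≠ 1 ∧ w ∈ wordBall (genSet g h) ((r + 1) * n) ∧
      24 * w.support.card ≤ n := by
  set u := h ^ (i + 1) * g with hu
  have hle : (cyc u x).card ≤ n := (Finset.card_le_univ _).trans_eq (Fintype.card_fin n)
  refine ⟨u ^ (cyc u x).card, h1, ?_, ?_⟩
  · have e1 : h ^ (i + 1) ∈ wordBall (genSet g h) ((i + 1) * 1) :=
      pow_mem_wordBall (mem_wordBall_one (by simp [genSet])) _
    have e2 : g ∈ wordBall (genSet g h) 1 := mem_wordBall_one (by simp [genSet])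
    have e3 := pow_mem_wordBall (mul_mem_wordBall e1 e2) (cyc u x).card
    refine wordBall_mono ?_ e3
    rw [mul_comm (r + 1)]
    exact Nat.mul_le_mul hle (by omega)
  · have h2 : (u ^ (cyc u x).card).support ⊆ (cyc u x)ᶜ := fun z hz => by
      rw [Finset.mem_compl]
      exact fun hz' => Perm.mem_support.mp hz (pow_card_cyc_apply_of_mem hz')
    have h3 := Finset.card_le_card h2
    rw [Finset.card_compl, Fintype.card_fin] at h3
    omega

theorem lt_two_pow_two_pow_clog_clog (n : ℕ) : n < 2 ^ 2 ^ (Nat.clog 2 (Nat.clog 2 n) + 1) := by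
  have h1 : n ≤ 2 ^ Nat.clog 2 n := Nat.le_pow_clog (by norm_num) n
  have h2 : Nat.clog 2 n ≤ 2 ^ Nat.clog 2 (Nat.clog 2 n) := Nat.le_pow_clog (by norm_num) _
  refine h1.trans_lt (Nat.pow_lt_pow_right (by norm_num) (h2.trans_lt ?_))
  exact Nat.pow_lt_pow_right (by norm_num) (Nat.lt_succ_self _)

theorem four_pow_clog_clog_le (hn : 3 ≤ n) :
    (4 : ℝ) ^ (Nat.clog 2 (Nat.clog 2 n) + 1) ≤ 144 * Real.log n ^ 2 := by
  have hc : 1 < Nat.clog 2 n := by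
    rw [Nat.lt_clog_iff_pow_lt (by norm_num)]
    omega
  have h1 : 2 ^ (Nat.clog 2 (Nat.clog 2 n)).pred < Nat.clog 2 n :=
    Nat.pow_pred_clog_lt_self (by norm_num) hc
  have h2 : 0 < Nat.clog 2 (Nat.clog 2 n) := Nat.clog_pos (by norm_num) hc
  have h3 : (2 : ℝ) ^ Nat.clog 2 (Nat.clog 2 n) ≤ 6 * Real.log n := by
    have h4 : (2 : ℝ) ^ Nat.clog 2 (Nat.clog 2 n) =
        2 * 2 ^ (Nat.clog 2 (Nat.clog 2 n)).pred := by
      rw [← pow_succ', Nat.pred_eq_sub_one, Nat.sub_add_cancel h2]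
    have h5 : (2 : ℝ) ^ (Nat.clog 2 (Nat.clog 2 n)).pred ≤ Nat.clog 2 n := by
      exact_mod_cast h1.le
    have := nat_clog_le hn
    linarith
  calc (4 : ℝ) ^ (Nat.clog 2 (Nat.clog 2 n) + 1)
      = 4 * (2 ^ Nat.clog 2 (Nat.clog 2 n)) ^ 2 := by
        rw [pow_succ, show (4 : ℝ) = 2 ^ 2 by norm_num, ← pow_mul, ← pow_mul]
        ring
    _ ≤ 4 * (6 * Real.log n) ^ 2 := by gcongr
    _ = 144 * Real.log n ^ 2 := by ring

theorem word_length_le {r : ℕ} (hn : 3 ≤ n) (h1 : Real.log n ^ 2 ≤ n)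
    (h2 : 1728 * ((r : ℝ) + 433) ≤ Real.log n) :
    ((12 * 4 ^ (Nat.clog 2 (Nat.clog 2 n) + 1) *
      ((r + 1) * n + 2 * (24 * Nat.clog 2 n ^ 2)) : ℕ) : ℝ) ≤ n * Real.log n ^ 3 := by
  have hl := one_le_log hn
  have h3 := four_pow_clog_clog_le hn
  have h4 : (Nat.clog 2 n : ℝ) ^ 2 ≤ (3 * Real.log n) ^ 2 :=
    pow_le_pow_left₀ (Nat.cast_nonneg _) (nat_clog_le hn) 2
  push_cast
  calc (12 : ℝ) * 4 ^ (Nat.clog 2 (Nat.clog 2 n) + 1) *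
        ((r + 1) * n + 2 * (24 * (Nat.clog 2 n : ℝ) ^ 2))
      ≤ 12 * (144 * Real.log n ^ 2) * ((r + 1) * n + 2 * (24 * (9 * n))) := by
        gcongr
        linarith
    _ = n * Real.log n ^ 2 * (1728 * (r + 433)) := by ring
    _ ≤ n * Real.log n ^ 2 * Real.log n := by gcongr
    _ = n * Real.log n ^ 3 := by ring

/-- The mixing bound holds for every pair `(g, h)` with fast mixing on pairs of points and a word
`h ^ (i + 1) * g` of which a nontrivial power has small support. -/
theorem mixing_of_long_cycle {r : ℕ} (hn : 5 ≤ n) (hlog : Real.log n ^ 2 ≤ n)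
    (hr : 1728 * ((r : ℝ) + 433) ≤ Real.log n) {g h : Perm (Fin n)}
    (hlong : ∃ i < r, ∃ x, 23 * n < 24 * (cyc (h ^ (i + 1) * g) x).card)
    (hne : ¬ ∃ i < r, HasDividingLongCycle (h ^ (i + 1) * g))
    (hmix : ∃ ν, IsPairMixing (genSet g h) (24 * (Nat.clog 2 n) ^ 2) ν) {k : ℕ}
    (hk : 48 * (n : ℝ) ^ 3 * Real.log n ^ 7 ≤ k) (x : Perm (Fin n))
    (hx : x ∈ Subgroup.closure ({g, h} : Set (Perm (Fin n)))) :
    |convPow (lazyWalk g h) k x -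
      1 / (Nat.card ↥(Subgroup.closure ({g, h} : Set (Perm (Fin n)))) : ℝ)| ≤
      1 / (2 * (Nat.card ↥(Subgroup.closure ({g, h} : Set (Perm (Fin n)))) : ℝ)) := by
  obtain ⟨i, hi, y, hy⟩ := hlong
  obtain ⟨ν, hν⟩ := hmix
  obtain ⟨w, hw, hwL, hw24⟩ := exists_small_support_word hi hy
    fun h1 => hne ⟨i, hi, y, by omega, h1⟩
  have hl := one_le_log (n := n) (by omega)
  have hL := word_length_le (by omega) hlog hr
  refine mixing_of_swap_mul_swap_mem_wordBall hn (L := 12 * 4 ^ (Nat.clog 2 (Nat.clog 2 n) + 1) *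
      ((r + 1) * n + 2 * (24 * Nat.clog 2 n ^ 2))) ?_ (fun a b c hab hbc hac => ?_) ?_ x hx
  · have : 0 < n := by omega
    exact Nat.succ_le_of_lt (by positivity)
  · exact hν.all_three_cycles (inv_mem_genSet g h) (by omega) _ hw hwL hw24
      (lt_two_pow_two_pow_clog_clog n) hab hbc hac
  · refine le_trans ?_ hk
    calc 48 * (n : ℝ) * ((12 * 4 ^ (Nat.clog 2 (Nat.clog 2 n) + 1) *
          ((r + 1) * n + 2 * (24 * Nat.clog 2 n ^ 2)) : ℕ) : ℝ) ^ 2 * Real.log n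
        ≤ 48 * (n : ℝ) * (n * Real.log n ^ 3) ^ 2 * Real.log n := by gcongr
      _ = 48 * (n : ℝ) ^ 3 * Real.log n ^ 7 := by ring

theorem card_exists_word_le (r : ℕ) (P : Perm (Fin n) → Prop) :
    ((Finset.univ.filter fun p : Perm (Fin n) × Perm (Fin n) =>
      ∃ i < r, P (p.2 ^ (i + 1) * p.1)).card : ℝ) ≤
      n.factorial * (r * (Finset.univ.filter P).card) := by
  refine (card_filter_prod_le (fun g h : Perm (Fin n) => ∃ i < r, P (h ^ (i + 1) * g)) ∅
    (K := r * (Finset.univ.filter P).card) (by positivity) fun h _ => ?_).trans ?_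
  · have h1 : (Finset.univ.filter fun g : Perm (Fin n) => ∃ i < r, P (h ^ (i + 1) * g)) ⊆
        (Finset.range r).biUnion fun i => Finset.univ.filter fun g => P (h ^ (i + 1) * g) := by
      intro g hg
      obtain ⟨i, hi, hP⟩ := (Finset.mem_filter.mp hg).2
      exact Finset.mem_biUnion.mpr ⟨i, Finset.mem_range.mpr hi,
        Finset.mem_filter.mpr ⟨Finset.mem_univ _, hP⟩⟩
    have h2 : ∀ i ∈ Finset.range r, (Finset.univ.filter fun g => P (h ^ (i + 1) * g)).card ≤
        (Finset.univ.filter P).card := fun i _ =>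
      Finset.card_le_card_of_injOn (fun g => h ^ (i + 1) * g)
        (fun g hg => Finset.mem_coe.mpr (Finset.mem_filter.mpr
          ⟨Finset.mem_univ _, (Finset.mem_filter.mp (Finset.mem_coe.mp hg)).2⟩))
        (mul_right_injective _).injOn
    have h3 := (Finset.card_le_card h1).trans
      (Finset.card_biUnion_le.trans (Finset.sum_le_card_nsmul _ _ _ h2))
    rw [Finset.card_range, smul_eq_mul] at h3
    exact_mod_cast h3
  · rw [Finset.card_empty, Nat.cast_zero, zero_mul, zero_add, Fintype.card_perm, Fintype.card_fin]

theorem card_filter_not_pairs_le (P : Perm (Fin n) → Perm (Fin n) → Prop) :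
    (Finset.univ.filter fun p : Perm (Fin n) × Perm (Fin n) => ¬ P p.1 p.2).card ≤
      (Finset.univ.filter fun f : Bool → Perm (Fin n) => ¬ P (f true) (f false)).card := by
  refine Finset.card_le_card_of_injOn (fun p b => cond b p.1 p.2) (fun p hp => ?_) ?_
  · rw [Finset.mem_coe, Finset.mem_filter] at hp ⊢
    exact ⟨Finset.mem_univ _, hp.2⟩
  · intro p _ q _ hpq
    exact Prod.ext (congrFun hpq true) (congrFun hpq false)

end RandomGenerators

/-- **Random generators of the symmetric group: strong mixing time.**
There exist absolute constants `c, C > 0` such that, with probability `1 - o(1)` for a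
random pair `(g, h) ∈ Sym(n) × Sym(n)`, for every `k ≥ C·n³·(log n)^c` and every `x ∈ G`
one has `|μ^{*k}(x) − 1/|G|| ≤ 1/(2|G|)`; i.e. the strong mixing time of `Γ(G, S)` is
`O(n³·(log n)^c)`. -/
theorem random_generators_mixing_time :
    ∃ c C : ℝ, 0 < c ∧ 0 < C ∧
      ∀ ε : ℝ, 0 < ε → ∃ N : ℕ, ∀ n : ℕ, N ≤ n →
        (1 - ε) * (Nat.factorial n : ℝ) ^ 2 ≤
          (Set.ncard {p : Perm (Fin n) × Perm (Fin n) |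
              ∀ k : ℕ, C * (n : ℝ) ^ 3 * Real.log n ^ c ≤ (k : ℝ) →
                ∀ x ∈ Subgroup.closure ({p.1, p.2} : Set (Perm (Fin n))),
                  |convPow (lazyWalk p.1 p.2) k x -
                      1 / (Nat.card ↥(Subgroup.closure ({p.1, p.2} : Set (Perm (Fin n)))) : ℝ)| ≤
                    1 / (2 * (Nat.card ↥(Subgroup.closure
                      ({p.1, p.2} : Set (Perm (Fin n)))) : ℝ))} : ℝ) := by
  refine ⟨7, 48, by norm_num, by norm_num, fun ε hε => ?_⟩
  obtain ⟨r, hr⟩ := eventually_exists_long_cycle (ε := ε / 3) (by positivity)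
  have hlog : ∀ᶠ n : ℕ in Filter.atTop, 1728 * ((r : ℝ) + 433) ≤ Real.log n :=
    (Real.tendsto_log_atTop.comp tendsto_natCast_atTop_atTop).eventually_ge_atTop _
  rw [← Filter.eventually_atTop]
  filter_upwards [hr, eventually_card_hasDividingLongCycle_le
    (ε := ε / 3 / (r + 1)) (by positivity), eventually_isPairMixing (ε := ε / 3) (by positivity),
    hlog, eventually_mul_log_pow_le 2 one_pos, Filter.eventually_ge_atTop 5]
    with n h1 h2 h3 h4 h5 h6
  rw [one_mul] at h5
  set P : Perm (Fin n) × Perm (Fin n) → Prop := fun p =>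
    ∀ k : ℕ, 48 * (n : ℝ) ^ 3 * Real.log n ^ (7 : ℝ) ≤ (k : ℝ) →
      ∀ x ∈ Subgroup.closure ({p.1, p.2} : Set (Perm (Fin n))),
        |convPow (lazyWalk p.1 p.2) k x -
            1 / (Nat.card ↥(Subgroup.closure ({p.1, p.2} : Set (Perm (Fin n)))) : ℝ)| ≤
          1 / (2 * (Nat.card ↥(Subgroup.closure
            ({p.1, p.2} : Set (Perm (Fin n)))) : ℝ)) with hP
  set B₁ := Finset.univ.filter fun p : Perm (Fin n) × Perm (Fin n) =>
    ∀ i < r, ∀ x, 24 * (cyc (p.2 ^ (i + 1) * p.1) x).card ≤ 23 * n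
  set B₂ := Finset.univ.filter fun p : Perm (Fin n) × Perm (Fin n) =>
    ∃ i < r, HasDividingLongCycle (p.2 ^ (i + 1) * p.1)
  set B₃ := Finset.univ.filter fun p : Perm (Fin n) × Perm (Fin n) =>
    ¬ ∃ ν, IsPairMixing (genSet p.1 p.2) (24 * (Nat.clog 2 n) ^ 2) ν
  have hB₂ : (B₂.card : ℝ) ≤ ε / 3 * (n.factorial : ℝ) ^ 2 := by
    refine (card_exists_word_le r HasDividingLongCycle).trans ?_
    have hr1 : (r : ℝ) * (ε / 3 / (r + 1)) ≤ ε / 3 := by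
      rw [mul_div_assoc', div_le_iff₀ (by positivity)]
      nlinarith
    calc (n.factorial : ℝ) * (r * ((Finset.univ.filter fun u : Perm (Fin n) =>
          HasDividingLongCycle u).card : ℝ))
        ≤ n.factorial * (r * (ε / 3 / (r + 1) * n.factorial)) := by gcongr
      _ = r * (ε / 3 / (r + 1)) * (n.factorial : ℝ) ^ 2 := by ring
      _ ≤ _ := mul_le_mul_of_nonneg_right hr1 (by positivity)
  have hB₃ : (B₃.card : ℝ) ≤ ε / 3 * (n.factorial : ℝ) ^ 2 := by
    have e : (Fintype.card (Bool → Perm (Fin n)) : ℝ) = (n.factorial : ℝ) ^ 2 := by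
      rw [Fintype.card_fun, Fintype.card_perm, Fintype.card_fin, Fintype.card_bool]
      push_cast
      rfl
    rw [e] at h3
    exact le_trans (Nat.cast_le.mpr (card_filter_not_pairs_le fun g h =>
      ∃ ν, IsPairMixing (genSet g h) (24 * (Nat.clog 2 n) ^ 2) ν)) h3
  have hsub : (Finset.univ : Finset (Perm (Fin n) × Perm (Fin n))) ⊆
      Finset.univ.filter P ∪ (B₁ ∪ (B₂ ∪ B₃)) := by
    intro p _
    by_contra hp
    simp only [Finset.mem_union, not_or] at hp
    obtain ⟨hp0, hp1, hp2, hp3⟩ := hp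
    refine hp0 (Finset.mem_filter.mpr ⟨Finset.mem_univ _, fun k hk => ?_⟩)
    refine mixing_of_long_cycle (r := r) h6 h5 h4 ?_ ?_ ?_ ?_
    · by_contra! hc
      exact hp1 (Finset.mem_filter.mpr ⟨Finset.mem_univ _, hc⟩)
    · exact fun hc => hp2 (Finset.mem_filter.mpr ⟨Finset.mem_univ _, hc⟩)
    · by_contra hc
      exact hp3 (Finset.mem_filter.mpr ⟨Finset.mem_univ _, hc⟩)
    · have e : Real.log n ^ (7 : ℝ) = Real.log n ^ 7 := by
        exact_mod_cast Real.rpow_natCast (Real.log n) 7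
      rwa [e] at hk
  have hcard := (Finset.card_le_card hsub).trans ((Finset.card_union_le _ _).trans
    (Nat.add_le_add_left ((Finset.card_union_le _ _).trans
      (Nat.add_le_add_left (Finset.card_union_le _ _) _)) _))
  rw [Finset.card_univ, Fintype.card_prod, Fintype.card_perm, Fintype.card_fin] at hcard
  have hcard' : (n.factorial : ℝ) * n.factorial ≤
      (Finset.univ.filter P).card + ((B₁.card : ℝ) + (B₂.card + B₃.card)) := by
    exact_mod_cast hcard
  have hset : {p | P p}.ncard = (Finset.univ.filter P).card := by
    rw [← Set.ncard_coe_finset]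
    congr 1
    ext p
    simp
  rw [hset]
  linarith
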